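/- Let n ≥ 1, let 0 < q < p < ∞, set r = pq/(p−q), and let g be a holomorphic function on B_n. Then the following are equivalent: (i) J_g is compact from H^p to H^q (meaning ‖J_g f_k‖_{H^q} → 0 for every sequence (f_k) in H^p with sup_k ‖f_k‖_{H^p} < ∞ converging to 0 uniformly on compact subsets of B_n); (ii) J_g is bounded from H^p to H^q (there is C with ‖J_g f‖_{H^q} ≤ C‖f‖_{H^p} for all f ∈ H^p); (iii) g ∈ H^r. -/

import Mathlib

open MeasureTheory Metric Set Filter
open scoped ENNReal NNReal Topology

noncomputable section

/-- ℂⁿ with its Euclidean (Hermitian) structure. -/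
abbrev En (n : ℕ) := EuclideanSpace ℂ (Fin n)

instance (n : ℕ) : MeasurableSpace (En n) := borel _
instance (n : ℕ) : BorelSpace (En n) := ⟨rfl⟩

/-- The open unit ball `B_n` of ℂⁿ. -/
def Bn (n : ℕ) : Set (En n) := Metric.ball 0 1

/-- The unit sphere `S_n = ∂B_n`. -/
def Sn (n : ℕ) : Set (En n) := Metric.sphere 0 1

/-- The Hermitian inner product `⟨z,w⟩ = ∑ z_k * conj (w_k)`. -/
def herm {n : ℕ} (z w : En n) : ℂ := ∑ k, z k * (starRingEnd ℂ) (w k)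

/-- The surface measure on the unit sphere, normalized so that `σ(S_n) = 1`
(the `(2n-1)`-dimensional Hausdorff measure restricted to the sphere, normalized). -/
def sigmaS (n : ℕ) : Measure (En n) :=
  ((μH[(2 * n - 1 : ℝ)] (Sn n))⁻¹) • (μH[(2 * n - 1 : ℝ)]).restrict (Sn n)

/-- Lebesgue measure on the unit ball, normalized so that `v(B_n) = 1`. -/
def volN (n : ℕ) : Measure (En n) :=
  ((volume (Bn n))⁻¹) • volume.restrict (Bn n)

/-- The radial derivative `Rg(z) = ∑ z_k ∂g/∂z_k (z) = (Dg)(z)[z]`. -/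
def radD {n : ℕ} (g : En n → ℂ) (z : En n) : ℂ := fderiv ℂ g z z

/-- The Volterra-type integration operator `J_g f(z) = ∫₀¹ f(tz) Rg(tz) dt/t`. -/
def J {n : ℕ} (g f : En n → ℂ) (z : En n) : ℂ :=
  ∫ t in Set.Ioo (0 : ℝ) 1, f (t • z) * radD g (t • z) / (t : ℂ)

/-- The Hardy space quasinorm `‖f‖_{H^p}`, with values in `ℝ≥0∞`:
`‖f‖_{H^p}^p = sup_{0<r<1} ∫_{S_n} |f(rζ)|^p dσ(ζ)`. -/
def hNorm (n : ℕ) (p : ℝ) (f : En n → ℂ) : ℝ≥0∞ :=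
  (⨆ r ∈ Set.Ioo (0 : ℝ) 1,
    ∫⁻ ζ, (‖f (r • ζ)‖₊ : ℝ≥0∞) ^ p ∂(sigmaS n)) ^ (1 / p)

/-- Membership in the Hardy space `H^p(B_n)`. -/
def MemHp (n : ℕ) (p : ℝ) (f : En n → ℂ) : Prop :=
  DifferentiableOn ℂ f (Bn n) ∧ hNorm n p f < ⊤

/-- The Carleson box `B_δ(ζ) = {z ∈ B_n : |1 - ⟨z,ζ⟩| < δ}`. -/
def cBox {n : ℕ} (ζ : En n) (δ : ℝ) : Set (En n) :=
  {z ∈ Bn n | ‖(1 : ℂ) - herm z ζ‖ < δ}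

/-- The measure `dμ_g(z) = |Rg(z)|²(1-|z|²) dv(z)`. -/
def muJ (n : ℕ) (g : En n → ℂ) : Measure (En n) :=
  (volN n).withDensity
    (fun z => (‖radD g z‖₊ : ℝ≥0∞) ^ 2 * ENNReal.ofReal (1 - ‖z‖ ^ 2))

/-- The admissible approach region `Γ_α(ζ) = {z ∈ B_n : |1-⟨z,ζ⟩| < (α/2)(1-|z|²)}`. -/
def Gam {n : ℕ} (α : ℝ) (ζ : En n) : Set (En n) :=
  {z ∈ Bn n | ‖(1 : ℂ) - herm z ζ‖ < α / 2 * (1 - ‖z‖ ^ 2)}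

open Classical in
/-- The involutive automorphism `φ_a` of the unit ball interchanging `0` and `a`:
`φ_a(z) = (a - P_a z - √(1-|a|²) (z - P_a z)) / (1 - ⟨z,a⟩)`, where `P_a` is the
orthogonal projection onto `ℂa`. -/
def mob {n : ℕ} (a z : En n) : En n :=
  if a = 0 then -z
  else ((1 : ℂ) - herm z a)⁻¹ •
    ((a - (herm z a / herm a a) • a) -
      ((Real.sqrt (1 - ‖a‖ ^ 2) : ℂ)) • (z - (herm z a / herm a a) • a))

/-- The norm of the invariant (real) gradient `∇̃f(z) = ∇(f ∘ φ_z)(0)`. -/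
def invGrad {n : ℕ} {F : Type*} [NormedAddCommGroup F] [NormedSpace ℝ F]
    (f : En n → F) (z : En n) : ℝ :=
  ‖fderiv ℝ (fun w => f (mob z w)) 0‖

/-- The invariant measure `dλ_n(z) = (1-|z|²)^{-(n+1)} dv(z)`. -/
def lamN (n : ℕ) : Measure (En n) :=
  (volN n).withDensity (fun z => ENNReal.ofReal ((1 - ‖z‖ ^ 2) ^ (-(n + 1 : ℝ))))

/-- The invariant Poisson integral `u_φ(z) = ∫_{S_n} φ(ζ) (1-|z|²)ⁿ/|1-⟨z,ζ⟩|^{2n} dσ(ζ)`. -/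
def poisson (n : ℕ) (φ : En n → ℝ) (z : En n) : ℝ :=
  ∫ ζ, φ ζ * ((1 - ‖z‖ ^ 2) ^ n / ‖(1 : ℂ) - herm z ζ‖ ^ (2 * n)) ∂(sigmaS n)

/-- The function `μ̃(ζ) = ∫_{Γ_α(ζ)} (1-|z|²)^{-n} dμ(z)`. -/
def tildeMu (n : ℕ) (α : ℝ) (μ : Measure (En n)) (ζ : En n) : ℝ≥0∞ :=
  ∫⁻ z in Gam α ζ, ENNReal.ofReal ((1 - ‖z‖ ^ 2) ^ (-(n : ℝ))) ∂μ

/-- The `L^{p/(p-s)}(S_n)`-norm of `μ̃`. -/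
def tildeMuNorm (n : ℕ) (α p s : ℝ) (μ : Measure (En n)) : ℝ≥0∞ :=
  (∫⁻ ζ, tildeMu n α μ ζ ^ (p / (p - s)) ∂(sigmaS n)) ^ ((p - s) / p)


/-- `X` has gradient `G` (as a complex number) and continuous Laplacian `L` on `s`. -/
structure IsJet (s : Set ℂ) (X : ℂ → ℝ) (G : ℂ → ℂ) (L : ℂ → ℝ) : Prop where
  grad : ∀ z ∈ s, HasFDerivAt X (innerSL ℝ (G z)) z
  lap : ∀ z ∈ s, ∃ A : ℂ →L[ℝ] ℂ, HasFDerivAt G A z ∧ (A 1).re + (A Complex.I).im = L z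
  cont : ContinuousOn L s

namespace IsJet

variable {s : Set ℂ} {X Y : ℂ → ℝ} {G H : ℂ → ℂ} {L M : ℂ → ℝ}

lemma continuousOn (h : IsJet s X G L) : ContinuousOn X s :=
  fun z hz => (h.grad z hz).continuousAt.continuousWithinAt

lemma continuousOn_grad (h : IsJet s X G L) : ContinuousOn G s := fun z hz => by
  obtain ⟨A, hA, -⟩ := h.lap z hz
  exact hA.continuousAt.continuousWithinAt

lemma mono {t : Set ℂ} (h : IsJet s X G L) (hts : t ⊆ s) : IsJet t X G L :=
  ⟨fun z hz => h.grad z (hts hz), fun z hz => h.lap z (hts hz), h.cont.mono hts⟩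

lemma const (s : Set ℂ) (c : ℝ) : IsJet s (fun _ => c) (fun _ => 0) (fun _ => 0) := by
  refine ⟨fun z _ => ?_, fun z _ => ⟨0, hasFDerivAt_const _ _, by simp⟩, continuousOn_const⟩
  simpa using hasFDerivAt_const c z

lemma add (h : IsJet s X G L) (k : IsJet s Y H M) :
    IsJet s (fun z => X z + Y z) (fun z => G z + H z) (fun z => L z + M z) := by
  refine ⟨fun z hz => ?_, fun z hz => ?_, h.cont.add k.cont⟩
  · rw [map_add]
    exact (h.grad z hz).add (k.grad z hz)
  · obtain ⟨A, hA, hA'⟩ := h.lap z hz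
    obtain ⟨B, hB, hB'⟩ := k.lap z hz
    refine ⟨A + B, hA.add hB, ?_⟩
    rw [← hA', ← hB']; simp; ring

lemma const_mul (h : IsJet s X G L) (c : ℝ) :
    IsJet s (fun z => c * X z) (fun z => c • G z) (fun z => c * L z) := by
  refine ⟨fun z hz => ?_, fun z hz => ?_, continuousOn_const.mul h.cont⟩
  · have := (h.grad z hz).const_mul c
    rwa [← map_smul] at this
  · obtain ⟨A, hA, hA'⟩ := h.lap z hz
    refine ⟨c • A, hA.const_smul c, ?_⟩
    rw [← hA']; simp; ring

lemma sub (h : IsJet s X G L) (k : IsJet s Y H M) :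
    IsJet s (fun z => X z - Y z) (fun z => G z + (-1 : ℝ) • H z) (fun z => L z - M z) := by
  have := h.add (k.const_mul (-1))
  simpa [sub_eq_add_neg] using this

lemma mul (h : IsJet s X G L) (k : IsJet s Y H M) :
    IsJet s (fun z => X z * Y z) (fun z => X z • H z + Y z • G z)
      (fun z => X z * M z + Y z * L z + 2 * ((G z).re * (H z).re + (G z).im * (H z).im)) := by
  refine ⟨fun z hz => ?_, fun z hz => ?_, ?_⟩
  · have := (h.grad z hz).mul (k.grad z hz)
    rwa [← map_smul, ← map_smul, ← map_add] at this
  · obtain ⟨A, hA, hA'⟩ := h.lap z hz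
    obtain ⟨B, hB, hB'⟩ := k.lap z hz
    refine ⟨_, ((h.grad z hz).smul hB).add ((k.grad z hz).smul hA), ?_⟩
    rw [← hA', ← hB']
    simp [Complex.inner]
    ring
  · have h1 := h.continuousOn
    have h2 := k.continuousOn
    have h3 := h.continuousOn_grad
    have h4 := k.continuousOn_grad
    have h5 := h.cont
    have h6 := k.cont
    have h3r := Complex.continuous_re.comp_continuousOn h3
    have h4r := Complex.continuous_re.comp_continuousOn h4
    have h3i := Complex.continuous_im.comp_continuousOn h3
    have h4i := Complex.continuous_im.comp_continuousOn h4
    exact ((h1.mul h6).add (h2.mul h5)).add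
      (continuousOn_const.mul ((h3r.mul h4r).add (h3i.mul h4i)))

lemma rpow (h : IsJet s X G L) (hX : ∀ z ∈ s, 0 < X z) (β : ℝ) :
    IsJet s (fun z => X z ^ β) (fun z => (β * X z ^ (β - 1)) • G z)
      (fun z => β * X z ^ (β - 1) * L z + β * (β - 1) * X z ^ (β - 2) * ‖G z‖ ^ 2) := by
  have hc : ∀ γ : ℝ, ContinuousOn (fun z => X z ^ γ) s := fun γ =>
    h.continuousOn.rpow_const fun z hz => Or.inl (hX z hz).ne'
  refine ⟨fun z hz => ?_, fun z hz => ?_, ?_⟩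
  · have := (h.grad z hz).rpow_const (p := β) (Or.inl (hX z hz).ne')
    rwa [← map_smul] at this
  · obtain ⟨A, hA, hA'⟩ := h.lap z hz
    have h1 := ((h.grad z hz).rpow_const (p := β - 1) (Or.inl (hX z hz).ne')).const_mul β
    refine ⟨_, h1.smul hA, ?_⟩
    rw [← hA', ← Complex.normSq_eq_norm_sq, Complex.normSq_apply, show β - 1 - 1 = β - 2 by ring]
    simp [Complex.inner]
    ring
  · exact ((continuousOn_const.mul (hc _)).mul h.cont).add
      ((continuousOn_const.mul (hc _)).mul (h.continuousOn_grad.norm.pow 2))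

lemma normSq {f f' : ℂ → ℂ} (hs : IsOpen s) (hf : ∀ z ∈ s, HasDerivAt f (f' z) z) :
    IsJet s (fun z => ‖f z‖ ^ 2) (fun z => 2 * f z * starRingEnd ℂ (f' z))
      (fun z => 4 * ‖f' z‖ ^ 2) := by
  have hd : DifferentiableOn ℂ f s := fun z hz => (hf z hz).differentiableAt.differentiableWithinAt
  have hf'eq : ∀ z ∈ s, deriv f z = f' z := fun z hz => (hf z hz).deriv
  have hd' : DifferentiableOn ℂ f' s :=
    (hd.deriv hs).congr fun z hz => (hf'eq z hz).symm
  refine ⟨fun z hz => ?_, fun z hz => ?_, ?_⟩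
  · have h1 := ((hf z hz).hasFDerivAt.restrictScalars ℝ).norm_sq
    have e : innerSL ℝ (2 * f z * (starRingEnd ℂ) (f' z)) = 2 • (innerSL ℝ (f z)).comp
        ((ContinuousLinearMap.toSpanSingleton ℂ (f' z)).restrictScalars ℝ) := by
      ext <;> (simp [Complex.inner]; ring)
    rw [e]
    exact h1
  · have h2 := (hf z hz).hasFDerivAt.restrictScalars ℝ
    have h3 := ((hd'.differentiableAt (hs.mem_nhds hz)).hasDerivAt.hasFDerivAt).restrictScalars ℝ
    have h4 := (Complex.conjCLE.toContinuousLinearMap.hasFDerivAt (x := f' z)).comp z h3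
    refine ⟨_, (h2.const_mul 2).mul h4, ?_⟩
    rw [← Complex.normSq_eq_norm_sq, Complex.normSq_apply]
    simp
    ring
  · exact continuousOn_const.mul (hd'.continuousOn.norm.pow 2)

end IsJet

/-- A positive function with `log X` subharmonic, in the sense of jets. -/
structure IsLSH (s : Set ℂ) (X : ℂ → ℝ) (G : ℂ → ℂ) (L : ℂ → ℝ) : Prop extends
    IsJet s X G L where
  pos : ∀ z ∈ s, 0 < X z
  log_sub : ∀ z ∈ s, ‖G z‖ ^ 2 ≤ X z * L z

namespace IsLSH

variable {s : Set ℂ} {X Y : ℂ → ℝ} {G H : ℂ → ℂ} {L M : ℂ → ℝ}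

lemma lap_nonneg (h : IsLSH s X G L) {z : ℂ} (hz : z ∈ s) : 0 ≤ L z := by
  have h1 := h.log_sub z hz
  have h2 := h.pos z hz
  by_contra! h3
  nlinarith [sq_nonneg ‖G z‖]

lemma const (s : Set ℂ) {c : ℝ} (hc : 0 < c) : IsLSH s (fun _ => c) (fun _ => 0) (fun _ => 0) :=
  ⟨IsJet.const s c, fun _ _ => hc, fun _ _ => by simp⟩

end IsLSH

/-- The arithmetic behind stability of log-subharmonicity under sums. -/
lemma norm_add_sq_le_of_sq_le {E : Type*} [SeminormedAddCommGroup E] {a b : E} {x y l m : ℝ}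
    (hx : 0 ≤ x) (hy : 0 ≤ y) (hl : 0 ≤ l) (hm : 0 ≤ m)
    (ha : ‖a‖ ^ 2 ≤ x * l) (hb : ‖b‖ ^ 2 ≤ y * m) : ‖a + b‖ ^ 2 ≤ (x + y) * (l + m) := by
  have h1 : ‖a + b‖ ^ 2 ≤ (‖a‖ + ‖b‖) ^ 2 := by gcongr; exact norm_add_le a b
  have h2 : 2 * (‖a‖ * ‖b‖) ≤ x * m + y * l := by
    apply abs_le_of_sq_le_sq' _ (by positivity) |>.2
    have : (‖a‖ * ‖b‖) ^ 2 ≤ (x * l) * (y * m) := by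
      rw [mul_pow]; gcongr
    nlinarith [sq_nonneg (x * m - y * l)]
  nlinarith

namespace IsLSH

variable {s : Set ℂ} {X Y : ℂ → ℝ} {G H : ℂ → ℂ} {L M : ℂ → ℝ}

/-- Adding a log-subharmonic function to a nonnegative one with the same gradient bound. -/
lemma jet_add (h : IsJet s X G L) (hX : ∀ z ∈ s, 0 ≤ X z) (hL : ∀ z ∈ s, 0 ≤ L z)
    (hG : ∀ z ∈ s, ‖G z‖ ^ 2 ≤ X z * L z) (k : IsLSH s Y H M) :
    IsLSH s (fun z => X z + Y z) (fun z => G z + H z) (fun z => L z + M z) :=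
  ⟨h.add k.toIsJet, fun z hz => add_pos_of_nonneg_of_pos (hX z hz) (k.pos z hz), fun z hz =>
    norm_add_sq_le_of_sq_le (hX z hz) (k.pos z hz).le (hL z hz) (k.lap_nonneg hz)
      (hG z hz) (k.log_sub z hz)⟩

lemma add (h : IsLSH s X G L) (k : IsLSH s Y H M) :
    IsLSH s (fun z => X z + Y z) (fun z => G z + H z) (fun z => L z + M z) :=
  jet_add h.toIsJet (fun z hz => (h.pos z hz).le) (fun _ hz => h.lap_nonneg hz) h.log_sub k

lemma mul (h : IsLSH s X G L) (k : IsLSH s Y H M) :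
    IsLSH s (fun z => X z * Y z) (fun z => X z • H z + Y z • G z)
      (fun z => X z * M z + Y z * L z + 2 * ((G z).re * (H z).re + (G z).im * (H z).im)) := by
  refine ⟨h.toIsJet.mul k.toIsJet, fun z hz => mul_pos (h.pos z hz) (k.pos z hz), fun z hz => ?_⟩
  have h1 := h.log_sub z hz
  have h2 := k.log_sub z hz
  have h3 := h.pos z hz
  have h4 := k.pos z hz
  rw [← Complex.normSq_eq_norm_sq, Complex.normSq_apply] at *
  simp only [Complex.add_re, Complex.add_im, Complex.real_smul, Complex.re_ofReal_mul,
    Complex.im_ofReal_mul]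
  have h5 := mul_le_mul_of_nonneg_left h1 (sq_nonneg (Y z))
  have h6 := mul_le_mul_of_nonneg_left h2 (sq_nonneg (X z))
  nlinarith

lemma rpow (h : IsLSH s X G L) {β : ℝ} (hβ : 0 < β) :
    IsLSH s (fun z => X z ^ β) (fun z => (β * X z ^ (β - 1)) • G z)
      (fun z => β * X z ^ (β - 1) * L z + β * (β - 1) * X z ^ (β - 2) * ‖G z‖ ^ 2) := by
  refine ⟨h.toIsJet.rpow h.pos β, fun z hz => Real.rpow_pos_of_pos (h.pos z hz) _, fun z hz => ?_⟩
  have h1 := h.log_sub z hz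
  have h3 := h.pos z hz
  have e1 : X z ^ β = X z ^ (β - 2) * X z ^ 2 := by
    rw [← Real.rpow_natCast, ← Real.rpow_add h3]; norm_num
  have e2 : X z ^ (β - 1) = X z ^ (β - 2) * X z := by
    nth_rw 3 [← Real.rpow_one (X z)]; rw [← Real.rpow_add h3]; ring_nf
  have h4 := Real.rpow_pos_of_pos h3 (β - 2)
  rw [norm_smul, mul_pow, Real.norm_eq_abs, sq_abs, e1, e2]
  set u := X z ^ (β - 2)
  have : β * u ^ 2 * X z ^ 2 * (‖G z‖ ^ 2) ≤ β * u ^ 2 * X z ^ 2 * (X z * L z) := by gcongr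
  nlinarith

/-- `|f|² + c` is log-subharmonic. -/
lemma normSq_add_const {f f' : ℂ → ℂ} (hs : IsOpen s) (hf : ∀ z ∈ s, HasDerivAt f (f' z) z)
    {c : ℝ} (hc : 0 < c) :
    IsLSH s (fun z => ‖f z‖ ^ 2 + c) (fun z => 2 * f z * starRingEnd ℂ (f' z) + 0)
      (fun z => 4 * ‖f' z‖ ^ 2 + 0) := by
  refine jet_add (IsJet.normSq hs hf) (fun _ _ => by positivity) (fun _ _ => by positivity)
    (fun z _ => ?_) (const s hc)
  simp only [norm_mul, RCLike.norm_conj, Complex.norm_ofNat]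
  nlinarith

/-- `∑ |f_i|² + c` is log-subharmonic. -/
lemma sum_normSq_add_const {ι : Type*} (t : Finset ι) {f f' : ι → ℂ → ℂ} (hs : IsOpen s)
    (hf : ∀ i ∈ t, ∀ z ∈ s, HasDerivAt (f i) (f' i z) z) {c : ℝ} (hc : 0 < c) :
    ∃ G, IsLSH s (fun z => ∑ i ∈ t, ‖f i z‖ ^ 2 + c) G (fun z => 4 * ∑ i ∈ t, ‖f' i z‖ ^ 2) := by
  classical
  induction t using Finset.induction_on with
  | empty => exact ⟨fun _ => 0, by simpa using const s hc⟩
  | insert a t ha ih =>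
    obtain ⟨G, hG⟩ := ih fun i hi => hf i (by simp [hi])
    have := jet_add (IsJet.normSq hs (hf a (by simp))) (fun _ _ => by positivity)
      (fun _ _ => by positivity) (fun z _ => ?_) hG
    · refine ⟨fun z => 2 * f a z * (starRingEnd ℂ) (f' a z) + G z, ?_⟩
      simp only [Finset.sum_insert ha, add_assoc, mul_add]
      simpa only [add_assoc] using this
    · simp only [norm_mul, RCLike.norm_conj, Complex.norm_ofNat]
      nlinarith

end IsLSH

namespace IsJet

variable {s : Set ℂ} {X Y : ℂ → ℝ} {G H : ℂ → ℂ} {L M : ℂ → ℝ}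

lemma comp_exp (h : IsJet s X G L) :
    IsJet (Complex.exp ⁻¹' s) (fun w => X (Complex.exp w))
      (fun w => G (Complex.exp w) * starRingEnd ℂ (Complex.exp w))
      (fun w => ‖Complex.exp w‖ ^ 2 * L (Complex.exp w)) := by
  have hE : ∀ w, HasFDerivAt Complex.exp
      ((ContinuousLinearMap.toSpanSingleton ℂ (Complex.exp w)).restrictScalars ℝ) w := fun w =>
    (Complex.hasDerivAt_exp w).hasFDerivAt.restrictScalars ℝ
  refine ⟨fun w hw => ?_, fun w hw => ?_, ?_⟩
  · have h1 := (h.grad _ hw).comp w (hE w)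
    have e : innerSL ℝ (G (Complex.exp w) * starRingEnd ℂ (Complex.exp w)) =
        (innerSL ℝ (G (Complex.exp w))).comp
        ((ContinuousLinearMap.toSpanSingleton ℂ (Complex.exp w)).restrictScalars ℝ) := by
      ext; simp [Complex.inner]; ring
    rw [e]
    exact h1
  · obtain ⟨A, hA, hA'⟩ := h.lap _ hw
    have h1 := hA.comp w (hE w)
    have h4 := (Complex.conjCLE.toContinuousLinearMap.hasFDerivAt (x := Complex.exp w)).comp w (hE w)
    refine ⟨_, h1.mul h4, ?_⟩
    rw [← hA', ← Complex.normSq_eq_norm_sq, Complex.normSq_apply]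
    have hAl : ∀ v : ℂ, A v = v.re • A 1 + v.im • A Complex.I := fun v => by
      rw [← map_smul, ← map_smul, ← map_add]; congr 1
      apply Complex.ext <;> simp
    simp
    rw [hAl (Complex.exp w), hAl (Complex.I * Complex.exp w)]
    simp
    ring
  · exact (Complex.continuous_exp.norm.pow 2).continuousOn.mul
      (h.cont.comp Complex.continuous_exp.continuousOn fun _ h => h)

/-- Divergence theorem on `[a, b] × [0, 2π]` for a gradient that is `2π`-periodic in `Im`. -/
lemma flux_sub {a b : ℝ} (hab : a ≤ b) (h : IsJet {w | a ≤ w.re ∧ w.re ≤ b} X G L)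
    (hper : ∀ w, G (w + 2 * Real.pi * Complex.I) = G w) :
    (∫ y in (0 : ℝ)..2 * Real.pi, (G (b + y * Complex.I)).re) -
      ∫ y in (0 : ℝ)..2 * Real.pi, (G (a + y * Complex.I)).re =
    ∫ t in a..b, ∫ y in (0 : ℝ)..2 * Real.pi, L (t + y * Complex.I) := by
  have hφ : Continuous fun p : ℝ × ℝ => (p.1 + p.2 * Complex.I : ℂ) := by fun_prop
  have hmem : ∀ p ∈ uIcc a b ×ˢ uIcc 0 (2 * Real.pi),
      ((p.1 + p.2 * Complex.I : ℂ)) ∈ {w : ℂ | a ≤ w.re ∧ w.re ≤ b} := by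
    rintro p ⟨h1, -⟩
    rw [uIcc_of_le hab] at h1
    simpa using h1
  have hmem' : ∀ p ∈ Ioo (min a b) (max a b) ×ˢ Ioo (min 0 (2 * Real.pi)) (max 0 (2 * Real.pi)),
      ((p.1 + p.2 * Complex.I : ℂ)) ∈ {w : ℂ | a ≤ w.re ∧ w.re ≤ b} := by
    rintro p ⟨h1, -⟩
    rw [min_eq_left hab, max_eq_right hab] at h1
    simpa using ⟨h1.1.le, h1.2.le⟩
  have hD : ∀ p : ℝ × ℝ, HasFDerivAt (fun p : ℝ × ℝ => (p.1 + p.2 * Complex.I : ℂ))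
      (Complex.equivRealProdCLM.symm : ℝ × ℝ →L[ℝ] ℂ) p := fun p => by
    have := (Complex.equivRealProdCLM.symm : ℝ × ℝ →L[ℝ] ℂ).hasFDerivAt (x := p)
    refine this.congr_of_eventuallyEq (Eventually.of_forall fun q => ?_)
    exact (Complex.equivRealProdCLM_symm_apply q).symm
  have hGc : ContinuousOn (fun p : ℝ × ℝ => G (p.1 + p.2 * Complex.I))
      (uIcc a b ×ˢ uIcc 0 (2 * Real.pi)) :=
    h.continuousOn_grad.comp hφ.continuousOn hmem
  have hLc : ContinuousOn (fun p : ℝ × ℝ => L (p.1 + p.2 * Complex.I))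
      (uIcc a b ×ˢ uIcc 0 (2 * Real.pi)) :=
    h.cont.comp hφ.continuousOn hmem
  choose! A hA hA' using h.lap
  have key := integral2_divergence_prod_of_hasFDerivAt
    (fun p : ℝ × ℝ => (G (p.1 + p.2 * Complex.I)).re)
    (fun p : ℝ × ℝ => (G (p.1 + p.2 * Complex.I)).im)
    (fun p => Complex.reCLM.comp ((A (p.1 + p.2 * Complex.I)).comp
      (Complex.equivRealProdCLM.symm : ℝ × ℝ →L[ℝ] ℂ)))
    (fun p => Complex.imCLM.comp ((A (p.1 + p.2 * Complex.I)).comp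
      (Complex.equivRealProdCLM.symm : ℝ × ℝ →L[ℝ] ℂ)))
    a 0 b (2 * Real.pi)
    (Complex.continuous_re.comp_continuousOn hGc)
    (Complex.continuous_im.comp_continuousOn hGc)
    (fun p hp => Complex.reCLM.hasFDerivAt.comp p ((hA _ (hmem' p hp)).comp p (hD p)))
    (fun p hp => Complex.imCLM.hasFDerivAt.comp p ((hA _ (hmem' p hp)).comp p (hD p)))
  have e1 : (Complex.equivRealProdCLM.symm : ℝ × ℝ →L[ℝ] ℂ) (1, 0) = 1 := by
    simpa using Complex.equivRealProdCLM_symm_apply (1, 0)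
  have e2 : (Complex.equivRealProdCLM.symm : ℝ × ℝ →L[ℝ] ℂ) (0, 1) = Complex.I := by
    simpa using Complex.equivRealProdCLM_symm_apply (0, 1)
  simp only [ContinuousLinearMap.comp_apply, e1, e2, Complex.reCLM_apply, Complex.imCLM_apply] at key
  have h_int : IntegrableOn (fun p : ℝ × ℝ => ((A (p.1 + p.2 * Complex.I)) 1).re +
      ((A (p.1 + p.2 * Complex.I)) Complex.I).im) (uIcc a b ×ˢ uIcc 0 (2 * Real.pi)) := by
    refine (hLc.integrableOn_compact (isCompact_uIcc.prod isCompact_uIcc)).congr_fun ?_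
      (measurableSet_uIcc.prod measurableSet_uIcc)
    intro p hp
    exact (hA' _ (hmem p hp)).symm
  have := key h_int
  rw [eq_comm] at this
  have e3 : ∀ x : ℝ, G (x + ((2 * Real.pi : ℝ) : ℂ) * Complex.I) = G (x + ((0 : ℝ) : ℂ) * Complex.I) := by
    intro x
    have := hper x
    push_cast
    rw [this]; simp
  simp only [e3, sub_self, zero_add] at this
  rw [this]
  refine intervalIntegral.integral_congr fun t ht => intervalIntegral.integral_congr fun y hy => ?_
  exact hA' _ (hmem (t, y) ⟨ht, hy⟩)

/-- Integrating the real part of the gradient in the horizontal direction. -/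
lemma integral_sub {a b : ℝ} (hab : a ≤ b) (h : IsJet {w | a ≤ w.re ∧ w.re ≤ b} X G L) :
    (∫ y in (0 : ℝ)..2 * Real.pi, X (b + y * Complex.I)) -
      ∫ y in (0 : ℝ)..2 * Real.pi, X (a + y * Complex.I) =
    ∫ t in a..b, ∫ y in (0 : ℝ)..2 * Real.pi, (G (t + y * Complex.I)).re := by
  have hφ : Continuous fun p : ℝ × ℝ => (p.1 + p.2 * Complex.I : ℂ) := by fun_prop
  have hmem : ∀ p ∈ uIcc a b ×ˢ uIcc 0 (2 * Real.pi),
      ((p.1 + p.2 * Complex.I : ℂ)) ∈ {w : ℂ | a ≤ w.re ∧ w.re ≤ b} := by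
    rintro p ⟨h1, -⟩
    rw [uIcc_of_le hab] at h1
    simpa using h1
  have hmem' : ∀ p ∈ Ioo (min a b) (max a b) ×ˢ Ioo (min 0 (2 * Real.pi)) (max 0 (2 * Real.pi)),
      ((p.1 + p.2 * Complex.I : ℂ)) ∈ {w : ℂ | a ≤ w.re ∧ w.re ≤ b} := by
    rintro p ⟨h1, -⟩
    rw [min_eq_left hab, max_eq_right hab] at h1
    simpa using ⟨h1.1.le, h1.2.le⟩
  have hD : ∀ p : ℝ × ℝ, HasFDerivAt (fun p : ℝ × ℝ => (p.1 + p.2 * Complex.I : ℂ))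
      (Complex.equivRealProdCLM.symm : ℝ × ℝ →L[ℝ] ℂ) p := fun p => by
    have := (Complex.equivRealProdCLM.symm : ℝ × ℝ →L[ℝ] ℂ).hasFDerivAt (x := p)
    refine this.congr_of_eventuallyEq (Eventually.of_forall fun q => ?_)
    exact (Complex.equivRealProdCLM_symm_apply q).symm
  have hGc : ContinuousOn (fun p : ℝ × ℝ => G (p.1 + p.2 * Complex.I))
      (uIcc a b ×ˢ uIcc 0 (2 * Real.pi)) :=
    h.continuousOn_grad.comp hφ.continuousOn hmem
  have key := integral2_divergence_prod_of_hasFDerivAt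
    (fun p : ℝ × ℝ => X (p.1 + p.2 * Complex.I)) (fun _ => 0)
    (fun p => (innerSL ℝ (G (p.1 + p.2 * Complex.I))).comp
      (Complex.equivRealProdCLM.symm : ℝ × ℝ →L[ℝ] ℂ))
    (fun p => 0) a 0 b (2 * Real.pi) (h.continuousOn.comp hφ.continuousOn hmem) continuousOn_const
    (fun p hp => (h.grad _ (hmem' p hp)).comp p (hD p)) (fun p _ => hasFDerivAt_const _ _)
  have e1 : (Complex.equivRealProdCLM.symm : ℝ × ℝ →L[ℝ] ℂ) (1, 0) = 1 := by
    simpa using Complex.equivRealProdCLM_symm_apply (1, 0)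
  simp only [ContinuousLinearMap.comp_apply, e1, innerSL_apply_apply, Complex.inner, one_mul,
    Complex.conj_re, zero_apply, add_zero, intervalIntegral.integral_zero,
    sub_zero, zero_add] at key
  rw [key]
  exact (Complex.continuous_re.comp_continuousOn hGc).integrableOn_compact
    (isCompact_uIcc.prod isCompact_uIcc)

lemma circleAverage_exp (X : ℂ → ℝ) (t : ℝ) : Real.circleAverage X 0 (Real.exp t) =
    (2 * Real.pi)⁻¹ * ∫ y in (0 : ℝ)..2 * Real.pi, X (Complex.exp (t + y * Complex.I)) := by
  rw [Real.circleAverage_def, smul_eq_mul]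
  congr 1
  refine intervalIntegral.integral_congr fun y _ => ?_
  simp [circleMap, Complex.exp_add]

/-- **Monotonicity of circle means** of a function with nonnegative Laplacian. -/
theorem circleAverage_mono {ρ : ℝ} (h : IsJet (ball 0 ρ) X G L) (hL : ∀ z ∈ ball (0 : ℂ) ρ, 0 ≤ L z)
    {r₁ r₂ : ℝ} (h0 : 0 ≤ r₁) (h12 : r₁ ≤ r₂) (h2 : r₂ < ρ) :
    Real.circleAverage X 0 r₁ ≤ Real.circleAverage X 0 r₂ := by
  have hpos : ∀ r₁ r₂ : ℝ, 0 < r₁ → r₁ ≤ r₂ → r₂ < ρ →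
      Real.circleAverage X 0 r₁ ≤ Real.circleAverage X 0 r₂ := by
    intro r₁ r₂ h0 h12 h2
    have h02 : 0 < r₂ := h0.trans_le h12
    have hsub : ∀ a b : ℝ, Real.exp b < ρ →
        {w : ℂ | a ≤ w.re ∧ w.re ≤ b} ⊆ Complex.exp ⁻¹' ball 0 ρ := by
      rintro a b hb w ⟨-, hw⟩
      simp only [mem_preimage, mem_ball_zero_iff, Complex.norm_exp]
      exact (Real.exp_le_exp.2 hw).trans_lt hb
    have hper : ∀ w, (fun w => G (Complex.exp w) * starRingEnd ℂ (Complex.exp w))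
        (w + 2 * Real.pi * Complex.I) = (fun w => G (Complex.exp w) * starRingEnd ℂ (Complex.exp w)) w := by
      intro w
      simp [Complex.exp_add, Complex.exp_two_pi_mul_I]
    have hΦ : ∀ t : ℝ, Real.exp t < ρ → 0 ≤ ∫ y in (0 : ℝ)..2 * Real.pi,
        (G (Complex.exp (t + y * Complex.I)) *
          starRingEnd ℂ (Complex.exp (t + y * Complex.I))).re := by
      intro t ht
      obtain ⟨C, hC⟩ := (isCompact_closedBall (0 : ℂ) (Real.exp t)).exists_bound_of_continuousOn
        (h.continuousOn_grad.mono (closedBall_subset_ball ht))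
      have hlow : ∀ a ≤ t, -(C * (2 * Real.pi)) * Real.exp a ≤ ∫ y in (0 : ℝ)..2 * Real.pi,
          (G (Complex.exp (t + y * Complex.I)) *
          starRingEnd ℂ (Complex.exp (t + y * Complex.I))).re := by
        intro a hat
        have h1 := flux_sub hat (h.comp_exp.mono (hsub a t ht)) hper
        have h2 : 0 ≤ ∫ t in a..t, ∫ y in (0 : ℝ)..2 * Real.pi,
            ‖Complex.exp (t + y * Complex.I)‖ ^ 2 * L (Complex.exp (t + y * Complex.I)) := by
          refine intervalIntegral.integral_nonneg hat fun u hu => intervalIntegral.integral_nonneg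
            (by positivity) fun y _ => mul_nonneg (by positivity) (hL _ ?_)
          exact hsub a t ht (by simpa using hu)
        have h3 : ‖∫ y in (0 : ℝ)..2 * Real.pi, (G (Complex.exp (a + y * Complex.I)) *
          starRingEnd ℂ (Complex.exp (a + y * Complex.I))).re‖ ≤ C * Real.exp a * |2 * Real.pi - 0| := by
          refine intervalIntegral.norm_integral_le_of_norm_le_const fun y _ => ?_
          refine (Complex.abs_re_le_norm _).trans ?_
          rw [norm_mul, RCLike.norm_conj]
          have e : ‖Complex.exp (a + y * Complex.I)‖ = Real.exp a := by
            rw [Complex.norm_exp]; simp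
          rw [e]
          gcongr
          apply hC
          rw [mem_closedBall_zero_iff, e]
          exact Real.exp_le_exp.2 hat
        rw [Real.norm_eq_abs, sub_zero, abs_of_pos (by positivity : (0:ℝ) < 2 * Real.pi)] at h3
        have h4 := (abs_le.1 h3).1
        nlinarith
      have hlim : Tendsto (fun a => -(C * (2 * Real.pi)) * Real.exp a) atBot (𝓝 0) := by
        simpa using Real.tendsto_exp_atBot.const_mul (-(C * (2 * Real.pi)))
      exact le_of_tendsto hlim ((eventually_le_atBot t).mono hlow)
    rw [← Real.exp_log h0, ← Real.exp_log h02, circleAverage_exp, circleAverage_exp]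
    gcongr
    rw [← sub_nonneg]
    have hle := Real.log_le_log h0 h12
    have hlt : Real.exp (Real.log r₂) < ρ := by rwa [Real.exp_log h02]
    have h1 := integral_sub hle (h.comp_exp.mono (hsub _ _ hlt))
    rw [h1]
    refine intervalIntegral.integral_nonneg hle fun u hu => hΦ u ?_
    exact (Real.exp_le_exp.2 hu.2).trans_lt hlt
  rcases h0.eq_or_lt with rfl | h0
  · rcases h12.eq_or_lt with rfl | h12
    · exact le_rfl
    have hc : ContinuousOn (Real.circleAverage X 0) (Ico 0 ρ) :=
      Real.ContinuousOn.circleAverage (h.continuousOn.mono fun z hz => by simpa using hz.2)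
        fun r hr => hr.1
    have h3 : Tendsto (Real.circleAverage X 0) (𝓝[>] 0) (𝓝 (Real.circleAverage X 0 0)) :=
      (hc 0 ⟨le_rfl, h12.trans h2⟩).mono_left
        (nhdsWithin_le_of_mem (mem_of_superset (Ioo_mem_nhdsGT (h12.trans h2)) Ioo_subset_Ico_self))
    refine le_of_tendsto h3 ?_
    filter_upwards [Ioo_mem_nhdsGT h12] with r hr
    exact hpos r r₂ hr.1 hr.2.le h2
  · exact hpos _ _ h0 h12 h2

end IsJet

/-- Lower bound for the Laplacian of `m ^ (1 - τ) * k ^ τ`. -/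
lemma lap_geom_mean_ge {m k Lm Lk τ : ℝ} {Gm Gk : ℂ} (hm : 0 < m) (hk : 0 < k) (hτ : 0 < τ)
    (hτ1 : τ < 1) (hGm : ‖Gm‖ ^ 2 ≤ m * Lm) (hGk : ‖Gk‖ ^ 2 ≤ k * Lk) :
    m ^ (1 - τ) * k ^ τ * (τ ^ 2 / 2 * (Lk / k) - Lm / m) ≤
    m ^ (1 - τ) * (τ * k ^ (τ - 1) * Lk + τ * (τ - 1) * k ^ (τ - 2) * ‖Gk‖ ^ 2) +
      k ^ τ * ((1 - τ) * m ^ (1 - τ - 1) * Lm + (1 - τ) * (1 - τ - 1) * m ^ (1 - τ - 2) * ‖Gm‖ ^ 2) +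
      2 * ((((1 - τ) * m ^ (1 - τ - 1)) • Gm).re * ((τ * k ^ (τ - 1)) • Gk).re +
        (((1 - τ) * m ^ (1 - τ - 1)) • Gm).im * ((τ * k ^ (τ - 1)) • Gk).im) := by
  have p2 : ∀ {x : ℝ} (y : ℝ), 0 < x → x ^ (y - 2) = x ^ y / x ^ 2 := fun {x} y hx => by
    rw [Real.rpow_sub hx]; norm_num
  rw [Real.rpow_sub_one hm.ne', Real.rpow_sub_one hk.ne', p2 _ hm, p2 _ hk]
  rw [← Complex.normSq_eq_norm_sq, Complex.normSq_apply] at hGm hGk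
  rw [← Complex.normSq_eq_norm_sq Gm, ← Complex.normSq_eq_norm_sq Gk, Complex.normSq_apply,
    Complex.normSq_apply]
  simp only [Complex.real_smul, Complex.re_ofReal_mul, Complex.im_ofReal_mul]
  have hA : 0 < m ^ (1 - τ) * k ^ τ := by positivity
  generalize m ^ (1 - τ) = A at *
  generalize k ^ τ = B at *
  obtain ⟨u1, h1⟩ : ∃ u, Gm.re = m * u := ⟨Gm.re / m, by field_simp⟩
  obtain ⟨u2, h2⟩ : ∃ u, Gm.im = m * u := ⟨Gm.im / m, by field_simp⟩
  obtain ⟨v1, h3⟩ : ∃ u, Gk.re = k * u := ⟨Gk.re / k, by field_simp⟩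
  obtain ⟨v2, h4⟩ : ∃ u, Gk.im = k * u := ⟨Gk.im / k, by field_simp⟩
  obtain ⟨a, rfl⟩ : ∃ u, Lm = m * u := ⟨Lm / m, by field_simp⟩
  obtain ⟨b, rfl⟩ : ∃ u, Lk = k * u := ⟨Lk / k, by field_simp⟩
  rw [h1, h2] at hGm ⊢
  rw [h3, h4] at hGk ⊢
  have ha : u1 ^ 2 + u2 ^ 2 ≤ a := by
    have : m ^ 2 * (u1 ^ 2 + u2 ^ 2) ≤ m ^ 2 * a := by nlinarith
    exact le_of_mul_le_mul_left this (by positivity)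
  have hb : v1 ^ 2 + v2 ^ 2 ≤ b := by
    have : k ^ 2 * (v1 ^ 2 + v2 ^ 2) ≤ k ^ 2 * b := by nlinarith
    exact le_of_mul_le_mul_left this (by positivity)
  have e : A * (τ * (B / k) * (k * b) + τ * (τ - 1) * (B / k ^ 2) * (k * v1 * (k * v1) + k * v2 * (k * v2))) +
      B * ((1 - τ) * (A / m) * (m * a) + (1 - τ) * (1 - τ - 1) * (A / m ^ 2) *
        (m * u1 * (m * u1) + m * u2 * (m * u2))) +
      2 * ((1 - τ) * (A / m) * (m * u1) * (τ * (B / k) * (k * v1)) +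
        (1 - τ) * (A / m) * (m * u2) * (τ * (B / k) * (k * v2))) =
      A * B * (τ * b + τ * (τ - 1) * (v1 ^ 2 + v2 ^ 2) + (1 - τ) * a + (1 - τ) * (-τ) * (u1 ^ 2 + u2 ^ 2)
        + 2 * ((1 - τ) * τ * (u1 * v1 + u2 * v2))) := by
    field_simp
    ring
  rw [e]
  apply mul_le_mul_of_nonneg_left _ hA.le
  rw [mul_div_cancel_left₀ _ hk.ne', mul_div_cancel_left₀ _ hm.ne']
  have h5 : 0 ≤ (1 - τ) * (a - (u1 ^ 2 + u2 ^ 2)) := mul_nonneg (by linarith) (by linarith)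
  have h6 : τ ^ 2 * (b - (v1 ^ 2 + v2 ^ 2)) ≤ τ * (b - (v1 ^ 2 + v2 ^ 2)) :=
    mul_le_mul_of_nonneg_right (by nlinarith) (by linarith)
  have h7 : (1 - τ) ^ 2 * (u1 ^ 2 + u2 ^ 2) ≤ a := by
    have h9 : (1 - τ) ^ 2 ≤ 1 := by nlinarith
    have h10 := mul_le_mul_of_nonneg_right h9 (by positivity : 0 ≤ u1 ^ 2 + u2 ^ 2)
    linarith
  have h8 : 0 ≤ τ ^ 2 * (b - (v1 ^ 2 + v2 ^ 2)) := mul_nonneg (by positivity) (by linarith)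
  linarith [sq_nonneg (2 * (1 - τ) * u1 + τ * v1), sq_nonneg (2 * (1 - τ) * u2 + τ * v2)]

lemma rpow_geom_mean_le_left {m k τ : ℝ} (hm : 0 < m) (hk : 0 < k) (hkm : k ≤ m) (hτ : 0 < τ) :
    m ^ (1 - τ) * k ^ τ ≤ m := by
  calc m ^ (1 - τ) * k ^ τ ≤ m ^ (1 - τ) * m ^ τ := by gcongr
    _ = m := by rw [← Real.rpow_add hm]; simp

lemma rpow_geom_mean_le_add {m k τ : ℝ} (hm : 0 < m) (hk : 0 < k) (hτ : 0 < τ) (hτ1 : τ < 1) :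
    m ^ (1 - τ) * k ^ τ ≤ m + k := by
  have h := Real.geom_mean_le_arith_mean2_weighted (w₁ := 1 - τ) (w₂ := τ) (by linarith) hτ.le
    hm.le hk.le (by ring)
  nlinarith

/-- The pointwise inequality distributing a weighted product between `T` and `k`. -/
lemma weighted_product_le {m k T LT Lk Lm Ln P S τ η β : ℝ} (hm : 0 < m) (hk : 0 < k)
    (hT : m + k ≤ T) (hτ : 0 < τ) (hτS : τ < S) (hP : 0 < P) (hβ : P + S = β) (hβ1 : 1 ≤ β)
    (hη : 0 < η) (hη1 : η ≤ 1) (hLm : 0 ≤ Lm) (hLk : 0 ≤ Lk) (hLn0 : 0 ≤ Ln)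
    (hLn : m ^ (1 - τ) * k ^ τ * (τ ^ 2 / 2 * (Lk / k) - Lm / m) ≤ Ln)
    (hLT : LT = Lm + Lk + Ln) :
    T ^ (1 - β) * (m ^ P * k ^ (S - 1) * Lk) ≤ η ^ (-P) * Lk + η ^ (S - τ) * (2 / τ ^ 2) * LT := by
  have hb : 0 ≤ Lk / k := by positivity
  have hLT0 : 0 ≤ LT := by rw [hLT]; positivity
  have e1 : m ^ P * k ^ (S - 1) * Lk = m ^ P * k ^ S * (Lk / k) := by
    rw [Real.rpow_sub_one hk.ne']; field_simp
  rw [e1]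
  rcases le_or_gt (η * m) k with h | h
  · have h1 : T ^ (1 - β) * (m ^ P * k ^ S) ≤ η ^ (-P) * k := by
      have h2 : T ^ (1 - β) ≤ k ^ (1 - β) :=
        Real.rpow_le_rpow_of_nonpos hk (by linarith) (by linarith)
      have h3 : m ^ P ≤ η ^ (-P) * k ^ P := by
        rw [Real.rpow_neg hη.le, ← Real.inv_rpow hη.le, ← Real.mul_rpow (by positivity) hk.le]
        apply Real.rpow_le_rpow hm.le _ hP.le
        rw [inv_mul_eq_div, le_div_iff₀ hη]; linarith
      calc T ^ (1 - β) * (m ^ P * k ^ S) ≤ k ^ (1 - β) * ((η ^ (-P) * k ^ P) * k ^ S) := by gcongr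
        _ = η ^ (-P) * (k ^ (1 - β) * k ^ P * k ^ S) := by ring
        _ = η ^ (-P) * k := by
          rw [← Real.rpow_add hk, ← Real.rpow_add hk, show 1 - β + P + S = 1 by linarith,
            Real.rpow_one]
    calc T ^ (1 - β) * (m ^ P * k ^ S * (Lk / k)) = T ^ (1 - β) * (m ^ P * k ^ S) * (Lk / k) := by
          ring
      _ ≤ η ^ (-P) * k * (Lk / k) := by gcongr
      _ = η ^ (-P) * Lk + 0 := by field_simp; ring
      _ ≤ _ := by gcongr; positivity
  · have hkm : k ≤ m := by nlinarith
    have h1 : T ^ (1 - β) * (m ^ P * k ^ S) ≤ η ^ (S - τ) * (m ^ (1 - τ) * k ^ τ) := by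
      have h2 : T ^ (1 - β) ≤ m ^ (1 - β) :=
        Real.rpow_le_rpow_of_nonpos hm (by linarith) (by linarith)
      have h3 : k ^ (S - τ) ≤ η ^ (S - τ) * m ^ (S - τ) := by
        rw [← Real.mul_rpow hη.le hm.le]
        exact Real.rpow_le_rpow hk.le h.le (by linarith)
      calc T ^ (1 - β) * (m ^ P * k ^ S) ≤ m ^ (1 - β) * (m ^ P * k ^ S) := by gcongr
        _ = m ^ (1 - β) * m ^ P * (k ^ (S - τ) * k ^ τ) := by
          rw [← Real.rpow_add hk]; ring_nf
        _ ≤ m ^ (1 - β) * m ^ P * ((η ^ (S - τ) * m ^ (S - τ)) * k ^ τ) := by gcongr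
        _ = η ^ (S - τ) * ((m ^ (1 - β) * m ^ P * m ^ (S - τ)) * k ^ τ) := by ring
        _ = _ := by
          rw [← Real.rpow_add hm, ← Real.rpow_add hm, show 1 - β + P + (S - τ) = 1 - τ by linarith]
    have h4 := rpow_geom_mean_le_left hm hk hkm hτ
    have h5 : m ^ (1 - τ) * k ^ τ * (Lk / k) ≤ 2 / τ ^ 2 * LT := by
      have h6 : m ^ (1 - τ) * k ^ τ * (Lm / m) ≤ Lm := by
        calc _ ≤ m * (Lm / m) := by gcongr
          _ = Lm := by field_simp
      have h7 : m ^ (1 - τ) * k ^ τ * (τ ^ 2 / 2 * (Lk / k)) ≤ LT := by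
        rw [hLT]; nlinarith
      calc m ^ (1 - τ) * k ^ τ * (Lk / k) = 2 / τ ^ 2 * (m ^ (1 - τ) * k ^ τ * (τ ^ 2 / 2 * (Lk / k))) := by
            field_simp
        _ ≤ _ := by gcongr
    calc T ^ (1 - β) * (m ^ P * k ^ S * (Lk / k)) = T ^ (1 - β) * (m ^ P * k ^ S) * (Lk / k) := by
          ring
      _ ≤ η ^ (S - τ) * (m ^ (1 - τ) * k ^ τ) * (Lk / k) := by gcongr
      _ = η ^ (S - τ) * (m ^ (1 - τ) * k ^ τ * (Lk / k)) := by ring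
      _ ≤ η ^ (S - τ) * (2 / τ ^ 2 * LT) := by gcongr
      _ = 0 + η ^ (S - τ) * (2 / τ ^ 2) * LT := by ring
      _ ≤ _ := by gcongr; positivity

/-- Laplacian of the composite power `(Q + (θ T) ^ β) ^ α`, `β = 1 / α`. -/
lemma lap_rpow_add_rpow_le {Q LQ T LT α β θ D : ℝ} {GT : ℂ} {g : ℝ} (hQ : 0 ≤ Q) (hT : 0 < T)
    (hLT : 0 ≤ LT) (hGT : ‖GT‖ ^ 2 ≤ T * LT) (hα : 0 < α) (hα1 : α ≤ 1) (hβ : α * β = 1)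
    (hθ : 0 < θ) (hD : LQ ≤ D) (hD0 : 0 ≤ D) (hg : 0 ≤ g) :
    α * (Q + (θ * T) ^ β) ^ (α - 1) * (LQ + (β * (θ * T) ^ (β - 1) * (θ * LT) +
      β * (β - 1) * (θ * T) ^ (β - 2) * ‖θ • GT‖ ^ 2)) +
      α * (α - 1) * (Q + (θ * T) ^ β) ^ (α - 2) * g ≤
    α * θ ^ (1 - β) * (T ^ (1 - β) * D) + θ / α * LT := by
  have hβ1 : 1 ≤ β := by nlinarith
  have hθT : 0 < θ * T := by positivity
  have hE : 0 < Q + (θ * T) ^ β := by positivity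
  have h1 : α * (α - 1) * (Q + (θ * T) ^ β) ^ (α - 2) * g ≤ 0 := by
    have : 0 ≤ α * (1 - α) * (Q + (θ * T) ^ β) ^ (α - 2) * g := by
      have : 0 ≤ 1 - α := by linarith
      positivity
    linarith
  have h2 : (Q + (θ * T) ^ β) ^ (α - 1) ≤ (θ * T) ^ (1 - β) := by
    have : (θ * T) ^ (1 - β) = ((θ * T) ^ β) ^ (α - 1) := by
      rw [← Real.rpow_mul hθT.le]; congr 1; linarith
    rw [this]
    exact Real.rpow_le_rpow_of_nonpos (by positivity) (by linarith) (by linarith)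
  have h3 : (β * (θ * T) ^ (β - 1) * (θ * LT) +
      β * (β - 1) * (θ * T) ^ (β - 2) * ‖θ • GT‖ ^ 2) ≤ β ^ 2 * (θ * T) ^ (β - 1) * (θ * LT) := by
    have e : (θ * T) ^ (β - 1) = (θ * T) ^ (β - 2) * (θ * T) := by
      nth_rw 3 [← Real.rpow_one (θ * T)]; rw [← Real.rpow_add hθT]; ring_nf
    have h4 : ‖θ • GT‖ ^ 2 ≤ (θ * T) * (θ * LT) := by
      rw [norm_smul, mul_pow, Real.norm_eq_abs, sq_abs]; nlinarith [sq_nonneg θ]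
    have h5 : 0 ≤ β * (β - 1) * (θ * T) ^ (β - 2) := by
      have : 0 ≤ β - 1 := by linarith
      positivity
    have := mul_le_mul_of_nonneg_left h4 h5
    rw [e]
    nlinarith
  have h6 : 0 ≤ β ^ 2 * (θ * T) ^ (β - 1) * (θ * LT) := by positivity
  calc _ ≤ α * (Q + (θ * T) ^ β) ^ (α - 1) * (LQ + (β * (θ * T) ^ (β - 1) * (θ * LT) +
      β * (β - 1) * (θ * T) ^ (β - 2) * ‖θ • GT‖ ^ 2)) := by linarith
    _ ≤ α * (Q + (θ * T) ^ β) ^ (α - 1) * (D + β ^ 2 * (θ * T) ^ (β - 1) * (θ * LT)) := by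
      gcongr
    _ ≤ α * (θ * T) ^ (1 - β) * (D + β ^ 2 * (θ * T) ^ (β - 1) * (θ * LT)) := by
      gcongr
    _ = α * (θ * T) ^ (1 - β) * D + α * β ^ 2 * ((θ * T) ^ (1 - β) * (θ * T) ^ (β - 1)) * (θ * LT) := by
      ring
    _ = _ := by
      rw [← Real.rpow_add hθT, show 1 - β + (β - 1) = 0 by ring, Real.rpow_zero,
        Real.mul_rpow hθ.le hT.le, show α * β ^ 2 = 1 / α by
          rw [eq_div_iff hα.ne']; linear_combination (α * β + 1) * hβ]
      ring

lemma Real.rpow_add_le_add_rpow_of_nonneg {a b p : ℝ} (ha : 0 ≤ a) (hb : 0 ≤ b) (hp : 0 ≤ p)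
    (hp1 : p ≤ 1) : (a + b) ^ p ≤ a ^ p + b ^ p := by
  exact_mod_cast NNReal.rpow_add_le_add_rpow ⟨a, ha⟩ ⟨b, hb⟩ hp hp1

lemma IsJet.circleIntegrable {ρ R : ℝ} {X : ℂ → ℝ} {G : ℂ → ℂ} {L : ℂ → ℝ}
    (h : IsJet (ball 0 ρ) X G L) (hR : 0 ≤ R) (hRρ : R < ρ) : CircleIntegrable X 0 R :=
  (h.continuousOn.mono (sphere_subset_closedBall.trans (closedBall_subset_ball hRρ))).circleIntegrable hR

/-- Comparison of circle means for a function whose Laplacian is controlled by a weighted product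
of log-subharmonic functions. -/
theorem circleAverage_rpow_le_of_lap_le {P S α K ε : ℝ} (hP : 0 < P) (hS : 0 < S) (hα : 0 < α)
    (hα1 : α ≤ 1) (hPS : α * (P + S) = 1) (hK : 0 ≤ K) (hε : 0 < ε) :
    ∃ C, 0 ≤ C ∧ ∀ (ρ : ℝ) (m k Q : ℂ → ℝ) (Gm Gk GQ : ℂ → ℂ) (Lm Lk LQ : ℂ → ℝ),
      IsLSH (ball 0 ρ) m Gm Lm → IsLSH (ball 0 ρ) k Gk Lk → IsJet (ball 0 ρ) Q GQ LQ →
      (∀ z ∈ ball (0 : ℂ) ρ, 0 ≤ Q z) →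
      (∀ z ∈ ball (0 : ℂ) ρ, LQ z ≤ K * (m z ^ P * k z ^ (S - 1) * Lk z)) →
      ∀ R₀ R, 0 ≤ R₀ → R₀ ≤ R → R < ρ →
        Real.circleAverage (fun z => Q z ^ α) 0 R ≤ Real.circleAverage (fun z => Q z ^ α) 0 R₀ +
          ε * (Real.circleAverage m 0 R + Real.circleAverage k 0 R) +
          C * (Real.circleAverage k 0 R - Real.circleAverage k 0 R₀) := by
  obtain ⟨τ, hτ, hτ1, hτS⟩ : ∃ τ, 0 < τ ∧ τ < 1 ∧ τ < S :=
    ⟨min (S / 2) (1 / 2), by positivity, by have := min_le_right (S / 2) (1 / 2 : ℝ); linarith,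
      by have := min_le_left (S / 2) (1 / 2 : ℝ); linarith⟩
  set β := P + S with hβ
  have hβ1 : 1 ≤ β := by nlinarith
  set θ := α * ε / 4 with hθ
  have hθ0 : 0 < θ := by positivity
  set B := α * K * θ ^ (1 - β) * (2 / τ ^ 2) with hB
  obtain ⟨η, hη, hη1, hηB⟩ : ∃ η : ℝ, 0 < η ∧ η ≤ 1 ∧ B * η ^ (S - τ) ≤ ε / 4 := by
    have h1 : Tendsto (fun η : ℝ => B * η ^ (S - τ)) (𝓝[>] 0) (𝓝 0) := by
      have : Continuous fun η : ℝ => B * η ^ (S - τ) :=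
        continuous_const.mul (Real.continuous_rpow_const (by linarith))
      have h2 := this.tendsto 0
      simp only [Real.zero_rpow (by linarith : S - τ ≠ 0), mul_zero] at h2
      exact h2.mono_left nhdsWithin_le_nhds
    have h3 := (h1.eventually (ge_mem_nhds (by positivity : (0:ℝ) < ε / 4))).and
      (Ioo_mem_nhdsGT (one_pos : (0:ℝ) < 1))
    obtain ⟨η, h4, h5⟩ := h3.exists
    exact ⟨η, h5.1, h5.2.le, h4⟩
  have hc1 : θ ≤ θ / α + B * η ^ (S - τ) := by
    have : θ ≤ θ / α := by rw [le_div_iff₀ hα]; nlinarith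
    have : 0 ≤ B * η ^ (S - τ) := by positivity
    linarith
  set c1 := θ / α + B * η ^ (S - τ) with hc1def
  have hc1ε : 2 * c1 ≤ ε := by
    have : θ / α = ε / 4 := by rw [hθ]; field_simp
    linarith
  set c2 := α * K * θ ^ (1 - β) * η ^ (-P) with hc2
  refine ⟨c2, by positivity, ?_⟩
  intro ρ m k Q Gm Gk GQ Lm Lk LQ hm hk hQ hQ0 hLQ R₀ R hR₀ hR₀R hRρ
  have hn := (hm.rpow (by linarith : 0 < 1 - τ)).mul (hk.rpow hτ)
  have hT := (hm.add hk).add hn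
  have hY := (hT.toIsJet.const_mul θ).rpow (fun z hz => mul_pos hθ0 (hT.pos z hz)) β
  have hEpos : ∀ z ∈ ball (0 : ℂ) ρ, 0 < Q z + (θ * (m z + k z + m z ^ (1 - τ) * k z ^ τ)) ^ β :=
    fun z hz => add_pos_of_nonneg_of_pos (hQ0 z hz)
      (Real.rpow_pos_of_pos (mul_pos hθ0 (hT.pos z hz)) _)
  have hE := (hQ.add hY).rpow hEpos α
  have hW := ((hT.toIsJet.const_mul c1).add (hk.toIsJet.const_mul c2)).sub hE
  have hmono := hW.circleAverage_mono (fun z hz => ?_) hR₀ hR₀R hRρ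
  · have hR : 0 ≤ R := hR₀.trans hR₀R
    have hR₀ρ : R₀ < ρ := hR₀R.trans_lt hRρ
    have hQα : ContinuousOn (fun z => Q z ^ α) (ball 0 ρ) :=
      hQ.continuousOn.rpow_const fun z _ => Or.inr hα.le
    have iQ : ∀ r, 0 ≤ r → r < ρ → CircleIntegrable (fun z => Q z ^ α) 0 r := fun r h1 h2 =>
      (hQα.mono (sphere_subset_closedBall.trans (closedBall_subset_ball h2))).circleIntegrable h1
    have expand : ∀ r, 0 ≤ r → r < ρ → Real.circleAverage
        (fun z => c1 * (m z + k z + m z ^ (1 - τ) * k z ^ τ) + c2 * k z -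
          (Q z + (θ * (m z + k z + m z ^ (1 - τ) * k z ^ τ)) ^ β) ^ α) 0 r =
        c1 * Real.circleAverage (fun z => m z + k z + m z ^ (1 - τ) * k z ^ τ) 0 r +
        c2 * Real.circleAverage k 0 r -
        Real.circleAverage (fun z => (Q z + (θ * (m z + k z + m z ^ (1 - τ) * k z ^ τ)) ^ β) ^ α) 0 r := by
      intro r h1 h2
      have i1 := (hT.toIsJet.const_mul c1).circleIntegrable h1 h2
      have i2 := (hk.toIsJet.const_mul c2).circleIntegrable h1 h2
      have i12 := ((hT.toIsJet.const_mul c1).add (hk.toIsJet.const_mul c2)).circleIntegrable h1 h2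
      rw [Real.circleAverage_fun_sub i12 (hE.circleIntegrable h1 h2),
        Real.circleAverage_fun_add i1 i2]
      congr 2
      · exact Real.circleAverage_fun_smul (a := c1)
      · exact Real.circleAverage_fun_smul (a := c2)
    rw [expand R₀ hR₀ hR₀ρ, expand R hR hRρ] at hmono
    have mem : ∀ r, 0 ≤ r → r < ρ → ∀ z ∈ sphere (0 : ℂ) |r|, z ∈ ball (0 : ℂ) ρ := by
      intro r h1 h2 z hz
      rw [abs_of_nonneg h1] at hz
      exact (sphere_subset_closedBall.trans (closedBall_subset_ball h2)) hz
    have b1 : Real.circleAverage (fun z => Q z ^ α) 0 R ≤ Real.circleAverage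
        (fun z => (Q z + (θ * (m z + k z + m z ^ (1 - τ) * k z ^ τ)) ^ β) ^ α) 0 R := by
      refine Real.circleAverage_mono (iQ R hR hRρ) (hE.circleIntegrable hR hRρ) fun z hz => ?_
      have hz := mem R hR hRρ z hz
      have := (Real.rpow_pos_of_pos (mul_pos hθ0 (hT.pos z hz)) β).le
      exact Real.rpow_le_rpow (hQ0 z hz) (by linarith) hα.le
    have b2 : Real.circleAverage
        (fun z => (Q z + (θ * (m z + k z + m z ^ (1 - τ) * k z ^ τ)) ^ β) ^ α) 0 R₀ ≤
        Real.circleAverage (fun z => Q z ^ α) 0 R₀ +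
        θ * Real.circleAverage (fun z => m z + k z + m z ^ (1 - τ) * k z ^ τ) 0 R₀ := by
      have i3 := (hT.toIsJet.const_mul θ).circleIntegrable hR₀ hR₀ρ
      have e : θ * Real.circleAverage (fun z => m z + k z + m z ^ (1 - τ) * k z ^ τ) 0 R₀ =
          Real.circleAverage (fun z => θ * (m z + k z + m z ^ (1 - τ) * k z ^ τ)) 0 R₀ :=
        (Real.circleAverage_fun_smul (a := θ)).symm
      rw [e, ← Real.circleAverage_fun_add (iQ _ hR₀ hR₀ρ) i3]
      refine Real.circleAverage_mono (hE.circleIntegrable hR₀ hR₀ρ)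
        ((iQ _ hR₀ hR₀ρ).add i3) fun z hz => ?_
      have hz := mem R₀ hR₀ hR₀ρ z hz
      have hp := mul_pos hθ0 (hT.pos z hz)
      refine (Real.rpow_add_le_add_rpow_of_nonneg (hQ0 z hz) (by positivity) hα.le hα1).trans ?_
      rw [← Real.rpow_mul hp.le, mul_comm β α, hPS, Real.rpow_one]
    have b3 : Real.circleAverage (fun z => m z + k z + m z ^ (1 - τ) * k z ^ τ) 0 R ≤
        2 * (Real.circleAverage m 0 R + Real.circleAverage k 0 R) := by
      have i1 := hm.toIsJet.circleIntegrable hR hRρ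
      have i2 := hk.toIsJet.circleIntegrable hR hRρ
      have e : 2 * (Real.circleAverage m 0 R + Real.circleAverage k 0 R) =
          Real.circleAverage (fun z => (2 : ℝ) * (m z + k z)) 0 R := by
        rw [← Real.circleAverage_fun_add i1 i2]
        exact (Real.circleAverage_fun_smul (a := (2 : ℝ))).symm
      rw [e]
      refine Real.circleAverage_mono (hT.toIsJet.circleIntegrable hR hRρ)
        (((hm.add hk).toIsJet.const_mul 2).circleIntegrable hR hRρ) fun z hz => ?_
      have hz := mem R hR hRρ z hz
      have := rpow_geom_mean_le_add (hm.pos z hz) (hk.pos z hz) hτ hτ1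
      linarith
    have b4 : 0 ≤ Real.circleAverage (fun z => m z + k z + m z ^ (1 - τ) * k z ^ τ) 0 R₀ :=
      Real.circleAverage_nonneg_of_nonneg fun z hz => (hT.pos z (mem R₀ hR₀ hR₀ρ z hz)).le
    have b5 : 0 ≤ Real.circleAverage m 0 R + Real.circleAverage k 0 R :=
      add_nonneg
        (Real.circleAverage_nonneg_of_nonneg fun z hz => (hm.pos z (mem R hR hRρ z hz)).le)
        (Real.circleAverage_nonneg_of_nonneg fun z hz => (hk.pos z (mem R hR hRρ z hz)).le)
    have b6 : θ * Real.circleAverage (fun z => m z + k z + m z ^ (1 - τ) * k z ^ τ) 0 R₀ ≤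
        c1 * Real.circleAverage (fun z => m z + k z + m z ^ (1 - τ) * k z ^ τ) 0 R₀ := by gcongr
    have b7 : c1 * Real.circleAverage (fun z => m z + k z + m z ^ (1 - τ) * k z ^ τ) 0 R ≤
        ε * (Real.circleAverage m 0 R + Real.circleAverage k 0 R) := by
      have hc10 : 0 ≤ c1 := hθ0.le.trans hc1
      nlinarith
    nlinarith
  · have hmz := hm.pos z hz
    have hkz := hk.pos z hz
    have hD0 : 0 ≤ K * (m z ^ P * k z ^ (S - 1) * Lk z) := by
      have := hk.lap_nonneg hz
      positivity
    have hlap := lap_rpow_add_rpow_le (g := ‖GQ z + ((β * (θ * (m z + k z + m z ^ (1 - τ) * k z ^ τ)) ^ (β - 1)) •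
      (θ • (Gm z + Gk z + (m z ^ (1 - τ) • (τ * k z ^ (τ - 1)) • Gk z +
        k z ^ τ • ((1 - τ) * m z ^ (1 - τ - 1)) • Gm z))))‖ ^ 2)
      (hQ0 z hz) (hT.pos z hz) (hT.lap_nonneg hz) (hT.log_sub z hz) hα hα1 hPS hθ0
      (hLQ z hz) hD0 (by positivity)
    have hw := weighted_product_le (T := m z + k z + m z ^ (1 - τ) * k z ^ τ) hmz hkz (by
      have : 0 < m z ^ (1 - τ) * k z ^ τ := by positivity
      linarith) hτ hτS hP rfl hβ1 hη hη1 (hm.lap_nonneg hz) (hk.lap_nonneg hz) (hn.lap_nonneg hz)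
      (lap_geom_mean_ge hmz hkz hτ hτ1 (hm.log_sub z hz) (hk.log_sub z hz)) rfl
    have hcoef : 0 ≤ α * K * θ ^ (1 - β) := by positivity
    have hw' := mul_le_mul_of_nonneg_left hw hcoef
    refine sub_nonneg.2 (hlap.trans ?_)
    rw [hc1def, hc2, hB]
    linarith

namespace IsLSH

variable {s : Set ℂ} {X : ℂ → ℝ} {G : ℂ → ℂ} {L : ℂ → ℝ}

lemma rpow_lap_ge (h : IsLSH s X G L) {β : ℝ} (hβ : 0 < β) {z : ℂ} (hz : z ∈ s) :
    β * min 1 β * (X z ^ (β - 1) * L z) ≤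
      β * X z ^ (β - 1) * L z + β * (β - 1) * X z ^ (β - 2) * ‖G z‖ ^ 2 := by
  have h1 := h.log_sub z hz
  have h2 := h.lap_nonneg hz
  have h3 := h.pos z hz
  have e2 : X z ^ (β - 1) = X z ^ (β - 2) * X z := by
    nth_rw 3 [← Real.rpow_one (X z)]; rw [← Real.rpow_add h3]; ring_nf
  have h4 := Real.rpow_pos_of_pos h3 (β - 2)
  rw [e2]
  set u := X z ^ (β - 2)
  rcases le_total 1 β with hb | hb
  · rw [min_eq_left hb]
    have : 0 ≤ β * (β - 1) * u * ‖G z‖ ^ 2 := by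
      have : 0 ≤ β - 1 := by linarith
      positivity
    linarith
  · rw [min_eq_right hb]
    have h5 : 0 ≤ β * (1 - β) * u := by
      have : 0 ≤ 1 - β := by linarith
      positivity
    have := mul_le_mul_of_nonneg_left h1 h5
    linarith

lemma rpow_lap_le (h : IsLSH s X G L) {β : ℝ} (hβ : 1 ≤ β) {z : ℂ} (hz : z ∈ s) :
    β * X z ^ (β - 1) * L z + β * (β - 1) * X z ^ (β - 2) * ‖G z‖ ^ 2 ≤
      β ^ 2 * (X z ^ (β - 1) * L z) := by
  have h1 := h.log_sub z hz
  have h3 := h.pos z hz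
  have e2 : X z ^ (β - 1) = X z ^ (β - 2) * X z := by
    nth_rw 3 [← Real.rpow_one (X z)]; rw [← Real.rpow_add h3]; ring_nf
  have h4 := Real.rpow_pos_of_pos h3 (β - 2)
  rw [e2]
  have h5 : 0 ≤ β * (β - 1) * X z ^ (β - 2) := by
    have : 0 ≤ β - 1 := by linarith
    positivity
  have := mul_le_mul_of_nonneg_left h1 h5
  linarith

end IsLSH

lemma continuous_circleAverage_param {φ : ℝ → ℂ → ℝ} {R : ℝ}
    (h : Continuous fun x : ℝ × ℝ => φ x.1 (circleMap 0 R x.2)) :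
    Continuous fun e => Real.circleAverage (φ e) 0 R := by
  have := intervalIntegral.continuous_parametric_intervalIntegral_of_continuous' (μ := volume)
    (f := fun e θ => φ e (circleMap 0 R θ)) h 0 (2 * Real.pi)
  exact this.const_smul (2 * Real.pi)⁻¹

lemma continuous_comp_circleMap {ρ R : ℝ} {f : ℂ → ℂ} (hf : ContinuousOn f (ball 0 ρ)) (hR : 0 ≤ R)
    (hRρ : R < ρ) : Continuous fun θ : ℝ => f (circleMap 0 R θ) := by
  refine hf.comp_continuous (continuous_circleMap 0 R) fun θ => ?_
  rw [mem_ball_zero_iff]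
  simpa [abs_of_nonneg hR] using hRρ

/-- Means of regularised powers converge to means of powers. -/
lemma tendsto_circleAverage_reg {ρ R : ℝ} {f : ℂ → ℂ} (hf : ContinuousOn f (ball 0 ρ)) (hR : 0 ≤ R)
    (hRρ : R < ρ) {s : ℝ} (hs : 0 < s) :
    Tendsto (fun e : ℝ => Real.circleAverage (fun z => (‖f z‖ ^ 2 + e) ^ (s / 2)) 0 R) (𝓝[>] 0)
      (𝓝 (Real.circleAverage (fun z => ‖f z‖ ^ s) 0 R)) := by
  have hc : Continuous fun e : ℝ => Real.circleAverage (fun z => (‖f z‖ ^ 2 + e) ^ (s / 2)) 0 R := by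
    apply continuous_circleAverage_param
    have := continuous_comp_circleMap hf hR hRρ
    exact ((((this.comp continuous_snd).norm.pow 2).add continuous_fst).rpow_const
      fun _ => Or.inr (by positivity))
  have h := hc.tendsto 0
  have e : (fun z => (‖f z‖ ^ 2 + 0) ^ (s / 2)) = fun z => ‖f z‖ ^ s := by
    funext z
    rw [add_zero, ← Real.rpow_natCast, ← Real.rpow_mul (norm_nonneg _)]
    congr 1; push_cast; ring
  rw [e] at h
  exact h.mono_left nhdsWithin_le_nhds

lemma hasDerivAt_of_differentiableOn_ball {ρ : ℝ} {f : ℂ → ℂ} (hf : DifferentiableOn ℂ f (ball 0 ρ)) :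
    ∀ z ∈ ball (0 : ℂ) ρ, HasDerivAt f (deriv f z) z := fun _ hz =>
  (hf.differentiableAt (isOpen_ball.mem_nhds hz)).hasDerivAt

/-- **Hardy's convexity theorem** (monotonicity part). -/
theorem circleAverage_norm_rpow_mono {ρ : ℝ} {f : ℂ → ℂ} (hf : DifferentiableOn ℂ f (ball 0 ρ))
    {s : ℝ} (hs : 0 < s) {r₁ r₂ : ℝ} (h0 : 0 ≤ r₁) (h12 : r₁ ≤ r₂) (h2 : r₂ < ρ) :
    Real.circleAverage (fun z => ‖f z‖ ^ s) 0 r₁ ≤ Real.circleAverage (fun z => ‖f z‖ ^ s) 0 r₂ := by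
  refine le_of_tendsto_of_tendsto
    (tendsto_circleAverage_reg hf.continuousOn h0 (h12.trans_lt h2) hs)
    (tendsto_circleAverage_reg hf.continuousOn (h0.trans h12) h2 hs) ?_
  filter_upwards [self_mem_nhdsWithin] with e he
  have h := (IsLSH.normSq_add_const isOpen_ball (hasDerivAt_of_differentiableOn_ball hf)
    (mem_Ioi.1 he)).rpow (half_pos hs)
  exact h.toIsJet.circleAverage_mono (fun z hz => h.lap_nonneg hz) h0 h12 h2

lemma exists_nat_two_le_half_le (q : ℝ) : ∃ N : ℕ, 2 ≤ N ∧ q / 2 ≤ N := by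
  obtain ⟨N, hN⟩ := exists_nat_ge (q / 2)
  exact ⟨N + 2, by omega, by push_cast; linarith⟩

/-- Forward estimate on the disc: the means of `F` with `F' = f g'`. -/
theorem circleAverage_primitive_le {p q r ε : ℝ} (hp : 0 < p) (hq : 0 < q) (hr : 0 < r)
    (hpqr : 1 / q = 1 / p + 1 / r) (hε : 0 < ε) :
    ∃ C, 0 ≤ C ∧ ∀ (ρ : ℝ) (F f g : ℂ → ℂ), DifferentiableOn ℂ f (ball 0 ρ) →
      DifferentiableOn ℂ g (ball 0 ρ) →
      (∀ z ∈ ball (0 : ℂ) ρ, HasDerivAt F (f z * deriv g z) z) →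
      ∀ R₀ R, 0 ≤ R₀ → R₀ ≤ R → R < ρ →
        Real.circleAverage (fun z => ‖F z‖ ^ q) 0 R ≤
          2 * Real.circleAverage (fun z => ‖F z‖ ^ q) 0 R₀ +
          ε * (Real.circleAverage (fun z => ‖f z‖ ^ p) 0 R +
            Real.circleAverage (fun z => ‖g z‖ ^ r) 0 R) +
          C * (Real.circleAverage (fun z => ‖g z‖ ^ r) 0 R -
            Real.circleAverage (fun z => ‖g z‖ ^ r) 0 R₀) := by
  obtain ⟨N, hN2, hNq⟩ := exists_nat_two_le_half_le q
  have hN2' : (2 : ℝ) ≤ N := by exact_mod_cast hN2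
  have hN0 : (0 : ℝ) < N := by linarith
  have hN1 : (0 : ℝ) < N - 1 := by linarith
  set P : ℝ := 2 * (N - 1) / q + 2 / p with hP
  have hP0 : 0 < P := by positivity
  set K0 : ℝ := (4 * N ^ 2) * (1 / (4 * (r / 2 * min 1 (r / 2)))) with hK0
  have hrm : 0 < r / 2 * min 1 (r / 2) := by positivity
  set ε₁ : ℝ := min (ε / 2) (1 / 2) with hε₁
  have hε₁0 : 0 < ε₁ := by positivity
  have hε₁1 : ε₁ ≤ 1 / 2 := min_le_right _ _
  have hε₁2 : 2 * ε₁ ≤ ε := by have := min_le_left (ε / 2) (1 / 2 : ℝ); linarith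
  have hα : (q / (2 * N)) * (P + 2 / r) = 1 := by
    have : P + 2 / r = 2 * (N - 1) / q + 2 * (1 / p + 1 / r) := by rw [hP]; ring
    rw [this, ← hpqr]; field_simp; ring
  obtain ⟨C, hC, hmain⟩ := circleAverage_rpow_le_of_lap_le (P := P) (S := 2 / r) (α := q / (2 * N))
    (K := K0) (ε := ε₁) hP0 (by positivity) (by positivity)
    (by rw [div_le_one (by positivity)]; linarith) hα (by positivity) hε₁0
  refine ⟨2 * C, by positivity, ?_⟩
  intro ρ F f g hf hg hF R₀ R hR₀ hR₀R hRρ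
  have hR : 0 ≤ R := hR₀.trans hR₀R
  have hR₀ρ : R₀ < ρ := hR₀R.trans_lt hRρ
  have hFc : ContinuousOn F (ball 0 ρ) := fun z hz => (hF z hz).continuousAt.continuousWithinAt
  have dg := hasDerivAt_of_differentiableOn_ball hg
  have df := hasDerivAt_of_differentiableOn_ball hf
  have reg : ∀ e : ℝ, 0 < e →
      Real.circleAverage (fun z => ‖F z‖ ^ q) 0 R ≤ Real.circleAverage (fun z => ‖F z‖ ^ q) 0 R₀ +
          ε₁ * (Real.circleAverage (fun z => (‖F z‖ ^ 2 + e) ^ (q / 2)) 0 R +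
            Real.circleAverage (fun z => (‖f z‖ ^ 2 + e) ^ (p / 2)) 0 R +
            Real.circleAverage (fun z => (‖g z‖ ^ 2 + e) ^ (r / 2)) 0 R) +
          C * (Real.circleAverage (fun z => (‖g z‖ ^ 2 + e) ^ (r / 2)) 0 R -
            Real.circleAverage (fun z => (‖g z‖ ^ 2 + e) ^ (r / 2)) 0 R₀) := by
    intro e he
    have jF := IsLSH.normSq_add_const isOpen_ball hF he
    have jf := IsLSH.normSq_add_const isOpen_ball df he
    have jg := IsLSH.normSq_add_const isOpen_ball dg he
    have hm := (jF.rpow (div_pos hN1 hP0)).mul (jf.rpow (one_div_pos.2 hP0))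
    have hk := jg.rpow (half_pos hr)
    have hQ := IsJet.normSq (f := fun z => F z ^ N) isOpen_ball (fun z hz => (hF z hz).pow N)
    have h := hmain ρ _ _ _ _ _ _ _ _ _ hm hk hQ (fun _ _ => by positivity) (fun z hz => ?_)
      R₀ R hR₀ hR₀R hRρ
    · have eQ : (fun z => (‖F z ^ N‖ ^ 2) ^ (q / (2 * N))) = fun z => ‖F z‖ ^ q := by
        funext z
        rw [norm_pow, ← pow_mul, ← Real.rpow_natCast, ← Real.rpow_mul (norm_nonneg _)]
        congr 1; push_cast; field_simp
      rw [eQ] at h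
      refine h.trans ?_
      gcongr
      have i1 := (jF.rpow (half_pos hq)).toIsJet.circleIntegrable hR hRρ
      have i2 := (jf.rpow (half_pos hp)).toIsJet.circleIntegrable hR hRρ
      rw [← Real.circleAverage_fun_add i1 i2]
      refine Real.circleAverage_mono (hm.toIsJet.circleIntegrable hR hRρ) (i1.add i2) fun z _ => ?_
      have x1 : 0 < ‖F z‖ ^ 2 + e := by positivity
      have x2 : 0 < ‖f z‖ ^ 2 + e := by positivity
      have y := Real.geom_mean_le_arith_mean2_weighted (w₁ := (N - 1) / P * (2 / q))
        (w₂ := 1 / P * (2 / p)) (by positivity) (by positivity)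
        (Real.rpow_nonneg x1.le (q / 2)) (Real.rpow_nonneg x2.le (p / 2)) (by
          have : (N - 1) / P * (2 / q) + 1 / P * (2 / p) = P / P := by
            nth_rw 3 [hP]; ring
          rw [this, div_self hP0.ne'])
      rw [← Real.rpow_mul x1.le, ← Real.rpow_mul x2.le] at y
      have e1 : q / 2 * ((N - 1) / P * (2 / q)) = (N - 1) / P := by field_simp
      have e2 : p / 2 * (1 / P * (2 / p)) = 1 / P := by field_simp
      rw [e1, e2] at y
      refine y.trans ?_
      have w1 : (N - 1) / P * (2 / q) ≤ 1 := by
        rw [div_mul_eq_mul_div, div_le_one hP0, hP]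
        have : (0:ℝ) < 2 / p := by positivity
        have e3 : ((N : ℝ) - 1) * (2 / q) = 2 * (N - 1) / q := by ring
        linarith
      have w2 : 1 / P * (2 / p) ≤ 1 := by
        rw [div_mul_eq_mul_div, div_le_one hP0, hP]
        have : 0 < 2 * ((N : ℝ) - 1) / q := by positivity
        linarith
      have z1 := mul_le_mul_of_nonneg_right w1 (Real.rpow_nonneg x1.le (q / 2))
      have z2 := mul_le_mul_of_nonneg_right w2 (Real.rpow_nonneg x2.le (p / 2))
      linarith
    · have x1 : 0 < ‖F z‖ ^ 2 + e := by positivity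
      have x2 : 0 < ‖f z‖ ^ 2 + e := by positivity
      have x3 : 0 < ‖g z‖ ^ 2 + e := by positivity
      have emP : ((‖F z‖ ^ 2 + e) ^ ((N - 1) / P) * (‖f z‖ ^ 2 + e) ^ (1 / P)) ^ P =
          (‖F z‖ ^ 2 + e) ^ (N - 1) * (‖f z‖ ^ 2 + e) := by
        rw [Real.mul_rpow (by positivity) (by positivity), ← Real.rpow_mul x1.le,
          ← Real.rpow_mul x2.le, div_mul_cancel₀ _ hP0.ne', div_mul_cancel₀ _ hP0.ne',
          Real.rpow_one, ← Real.rpow_natCast (‖F z‖ ^ 2 + e) (N - 1)]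
        congr 2
        rw [Nat.cast_sub (by omega)]; simp
      have ekS : ((‖g z‖ ^ 2 + e) ^ (r / 2)) ^ (2 / r - 1) = (‖g z‖ ^ 2 + e) ^ (1 - r / 2) := by
        rw [← Real.rpow_mul x3.le]; congr 1; field_simp
      rw [emP, ekS]
      have low := jg.rpow_lap_ge (half_pos hr) hz
      have e5 : (‖g z‖ ^ 2 + e) ^ (1 - r / 2) * (‖g z‖ ^ 2 + e) ^ (r / 2 - 1) = 1 := by
        rw [← Real.rpow_add x3]; simp
      have low2 : ‖deriv g z‖ ^ 2 ≤ 1 / (4 * (r / 2 * min 1 (r / 2))) * ((‖g z‖ ^ 2 + e) ^ (1 - r / 2) *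
          (r / 2 * (‖g z‖ ^ 2 + e) ^ (r / 2 - 1) * (4 * ‖deriv g z‖ ^ 2 + 0) +
          r / 2 * (r / 2 - 1) * (‖g z‖ ^ 2 + e) ^ (r / 2 - 2) *
            ‖2 * g z * (starRingEnd ℂ) (deriv g z) + 0‖ ^ 2)) := by
        calc ‖deriv g z‖ ^ 2 = 1 / (4 * (r / 2 * min 1 (r / 2))) * ((‖g z‖ ^ 2 + e) ^ (1 - r / 2) *
            (r / 2 * min 1 (r / 2) * ((‖g z‖ ^ 2 + e) ^ (r / 2 - 1) * (4 * ‖deriv g z‖ ^ 2 + 0)))) := by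
              rw [show (‖g z‖ ^ 2 + e) ^ (1 - r / 2) *
                (r / 2 * min 1 (r / 2) * ((‖g z‖ ^ 2 + e) ^ (r / 2 - 1) * (4 * ‖deriv g z‖ ^ 2 + 0))) =
                ((‖g z‖ ^ 2 + e) ^ (1 - r / 2) * (‖g z‖ ^ 2 + e) ^ (r / 2 - 1)) *
                (4 * (r / 2 * min 1 (r / 2)) * ‖deriv g z‖ ^ 2) by ring, e5, one_mul, one_div,
                inv_mul_cancel_left₀ (by positivity)]
          _ ≤ _ := by gcongr
      have eL : 4 * ‖(N : ℂ) * F z ^ (N - 1) * (f z * deriv g z)‖ ^ 2 =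
          4 * N ^ 2 * (((‖F z‖ ^ 2) ^ (N - 1) * ‖f z‖ ^ 2) * ‖deriv g z‖ ^ 2) := by
        simp only [norm_mul, norm_pow, Complex.norm_natCast]; ring
      rw [eL, hK0]
      simp only [mul_assoc (4 * (N : ℝ) ^ 2)]
      refine mul_le_mul_of_nonneg_left ?_ (by positivity)
      calc ((‖F z‖ ^ 2) ^ (N - 1) * ‖f z‖ ^ 2) * ‖deriv g z‖ ^ 2 ≤
          ((‖F z‖ ^ 2 + e) ^ (N - 1) * (‖f z‖ ^ 2 + e)) * ‖deriv g z‖ ^ 2 := by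
            gcongr <;> linarith
        _ ≤ _ := by
          refine (mul_le_mul_of_nonneg_left low2 (by positivity)).trans (le_of_eq ?_)
          ring
  have hlim : Tendsto (fun e : ℝ => Real.circleAverage (fun z => ‖F z‖ ^ q) 0 R₀ +
          ε₁ * (Real.circleAverage (fun z => (‖F z‖ ^ 2 + e) ^ (q / 2)) 0 R +
            Real.circleAverage (fun z => (‖f z‖ ^ 2 + e) ^ (p / 2)) 0 R +
            Real.circleAverage (fun z => (‖g z‖ ^ 2 + e) ^ (r / 2)) 0 R) +
          C * (Real.circleAverage (fun z => (‖g z‖ ^ 2 + e) ^ (r / 2)) 0 R -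
            Real.circleAverage (fun z => (‖g z‖ ^ 2 + e) ^ (r / 2)) 0 R₀)) (𝓝[>] 0)
      (𝓝 (Real.circleAverage (fun z => ‖F z‖ ^ q) 0 R₀ +
          ε₁ * (Real.circleAverage (fun z => ‖F z‖ ^ q) 0 R +
            Real.circleAverage (fun z => ‖f z‖ ^ p) 0 R +
            Real.circleAverage (fun z => ‖g z‖ ^ r) 0 R) +
          C * (Real.circleAverage (fun z => ‖g z‖ ^ r) 0 R -
            Real.circleAverage (fun z => ‖g z‖ ^ r) 0 R₀))) := by
    have t1 := tendsto_circleAverage_reg hFc hR hRρ hq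
    have t2 := tendsto_circleAverage_reg hf.continuousOn hR hRρ hp
    have t3 := tendsto_circleAverage_reg hg.continuousOn hR hRρ hr
    have t4 := tendsto_circleAverage_reg hg.continuousOn hR₀ hR₀ρ hr
    exact ((((t1.add t2).add t3).const_mul ε₁).const_add _).add ((t3.sub t4).const_mul C)
  have hfin := ge_of_tendsto hlim (eventually_nhdsWithin_of_forall fun e he => reg e he)
  have n1 : 0 ≤ Real.circleAverage (fun z => ‖F z‖ ^ q) 0 R :=
    Real.circleAverage_nonneg_of_nonneg fun z _ => by positivity
  have n2 : 0 ≤ Real.circleAverage (fun z => ‖f z‖ ^ p) 0 R +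
      Real.circleAverage (fun z => ‖g z‖ ^ r) 0 R :=
    add_nonneg (Real.circleAverage_nonneg_of_nonneg fun z _ => by positivity)
      (Real.circleAverage_nonneg_of_nonneg fun z _ => by positivity)
  have n3 := mul_le_mul_of_nonneg_right hε₁1 n1
  have n4 := mul_le_mul_of_nonneg_right hε₁2 n2
  linarith

/-- Backward estimate on the disc: the means of `g` are controlled by those of the primitives of
`F_i g'` as soon as `∑ |F_i|²` dominates a power of `|g|² + 1`. -/
theorem circleAverage_le_primitives {q κ c : ℝ} (hq : 0 < q) (hκ : 0 < κ) (hc : 0 < c) :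
    ∃ C, 0 ≤ C ∧ ∀ (ι : Type) (t : Finset ι) (ρ : ℝ) (g : ℂ → ℂ) (F G : ι → ℂ → ℂ),
      DifferentiableOn ℂ g (ball 0 ρ) →
      (∀ i ∈ t, ∀ z ∈ ball (0 : ℂ) ρ, HasDerivAt (G i) (F i z * deriv g z) z) →
      (∀ z ∈ ball (0 : ℂ) ρ, c * (‖g z‖ ^ 2 + 1) ^ κ ≤ ∑ i ∈ t, ‖F i z‖ ^ 2) →
      ∀ R, 0 ≤ R → R < ρ →
        Real.circleAverage (fun z => (‖g z‖ ^ 2 + 1) ^ ((κ + 1) * q / 2)) 0 R ≤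
          2 * (‖g 0‖ ^ 2 + 1) ^ ((κ + 1) * q / 2) +
          C * Real.circleAverage (fun z => (∑ i ∈ t, ‖G i z‖ ^ 2 + 1) ^ (q / 2)) 0 R := by
  obtain ⟨N, hN2, hNq⟩ := exists_nat_two_le_half_le q
  have hN2' : (2 : ℝ) ≤ N := by exact_mod_cast hN2
  have hN0 : (0 : ℝ) < N := by linarith
  have hN1 : (0 : ℝ) < N - 1 := by linarith
  set γ : ℝ := (κ + 1) * N with hγ
  have hγ1 : 1 ≤ γ := by nlinarith
  have hqm : 0 < q / 2 * min 1 (q / 2) := by positivity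
  set K : ℝ := γ ^ 2 * (1 / (c * (q / 2 * min 1 (q / 2)))) with hK
  obtain ⟨C, hC, hmain⟩ := circleAverage_rpow_le_of_lap_le (P := 2 * (N - 1) / q) (S := 2 / q)
    (α := q / (2 * N)) (K := K) (ε := 1 / 2) (by positivity) (by positivity) (by positivity)
    (by rw [div_le_one (by positivity)]; linarith) (by field_simp; ring) (by positivity) (by norm_num)
  refine ⟨1 + 2 * C, by positivity, ?_⟩
  intro ι t ρ g F G hg hG hF R hR hRρ
  have dg := hasDerivAt_of_differentiableOn_ball hg
  have jg := IsLSH.normSq_add_const isOpen_ball dg one_pos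
  obtain ⟨GY, jY⟩ := IsLSH.sum_normSq_add_const t isOpen_ball hG one_pos
  have hm := jg.rpow (by positivity : 0 < (κ + 1) * q / 2)
  have hk := jY.rpow (half_pos hq)
  have hQ := jg.toIsJet.rpow jg.pos γ
  have h := hmain ρ _ _ _ _ _ _ _ _ _ hm hk hQ (fun _ _ => by positivity) (fun z hz => ?_)
    0 R le_rfl hR hRρ
  · have eQ : (fun z => ((‖g z‖ ^ 2 + 1) ^ γ) ^ (q / (2 * N))) =
        fun z => (‖g z‖ ^ 2 + 1) ^ ((κ + 1) * q / 2) := by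
      funext z
      rw [← Real.rpow_mul (by positivity)]
      congr 1; rw [hγ]; field_simp
    rw [eQ, Real.circleAverage_zero] at h
    have n1 : 0 ≤ Real.circleAverage (fun z => (∑ i ∈ t, ‖G i z‖ ^ 2 + 1) ^ (q / 2)) 0 0 :=
      Real.circleAverage_nonneg_of_nonneg fun z _ => by positivity
    have n2 := mul_nonneg hC n1
    linarith
  · have x1 : 0 < ‖g z‖ ^ 2 + 1 := by positivity
    have x2 : 0 < ∑ i ∈ t, ‖G i z‖ ^ 2 + 1 := by positivity
    have emP : ((‖g z‖ ^ 2 + 1) ^ ((κ + 1) * q / 2)) ^ (2 * (N - 1) / q) =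
        (‖g z‖ ^ 2 + 1) ^ ((κ + 1) * (N - 1)) := by
      rw [← Real.rpow_mul x1.le]; congr 1; field_simp
    have ekS : ((∑ i ∈ t, ‖G i z‖ ^ 2 + 1) ^ (q / 2)) ^ (2 / q - 1) =
        (∑ i ∈ t, ‖G i z‖ ^ 2 + 1) ^ (1 - q / 2) := by
      rw [← Real.rpow_mul x2.le]; congr 1; field_simp
    rw [emP, ekS]
    refine (jg.rpow_lap_le hγ1 hz).trans ?_
    have low := jY.rpow_lap_ge (half_pos hq) hz
    set Lk := q / 2 * (∑ i ∈ t, ‖G i z‖ ^ 2 + 1) ^ (q / 2 - 1) * (4 * ∑ i ∈ t, ‖F i z * deriv g z‖ ^ 2) +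
      q / 2 * (q / 2 - 1) * (∑ i ∈ t, ‖G i z‖ ^ 2 + 1) ^ (q / 2 - 2) * ‖GY z‖ ^ 2 with hLk
    have e5 : (∑ i ∈ t, ‖G i z‖ ^ 2 + 1) ^ (1 - q / 2) * (∑ i ∈ t, ‖G i z‖ ^ 2 + 1) ^ (q / 2 - 1) = 1 := by
      rw [← Real.rpow_add x2]; simp
    have e6 : ∑ i ∈ t, ‖F i z * deriv g z‖ ^ 2 = (∑ i ∈ t, ‖F i z‖ ^ 2) * ‖deriv g z‖ ^ 2 := by
      rw [Finset.sum_mul]; simp [mul_pow]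
    have low2 : c * (q / 2 * min 1 (q / 2)) * ((‖g z‖ ^ 2 + 1) ^ κ * (4 * ‖deriv g z‖ ^ 2)) ≤
        (∑ i ∈ t, ‖G i z‖ ^ 2 + 1) ^ (1 - q / 2) * Lk := by
      calc c * (q / 2 * min 1 (q / 2)) * ((‖g z‖ ^ 2 + 1) ^ κ * (4 * ‖deriv g z‖ ^ 2)) =
          (q / 2 * min 1 (q / 2)) * (4 * ((c * (‖g z‖ ^ 2 + 1) ^ κ) * ‖deriv g z‖ ^ 2)) := by ring
        _ ≤ (q / 2 * min 1 (q / 2)) * (4 * ((∑ i ∈ t, ‖F i z‖ ^ 2) * ‖deriv g z‖ ^ 2)) := by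
          gcongr; exact hF z hz
        _ = (∑ i ∈ t, ‖G i z‖ ^ 2 + 1) ^ (1 - q / 2) * (q / 2 * min 1 (q / 2) *
            ((∑ i ∈ t, ‖G i z‖ ^ 2 + 1) ^ (q / 2 - 1) * (4 * ∑ i ∈ t, ‖F i z * deriv g z‖ ^ 2))) := by
          rw [e6, show ∀ a b x y : ℝ, a * (x * (b * y)) = (a * b) * (x * y) by intros; ring,
            show ∀ a b : ℝ, a * (q / 2 * min 1 (q / 2) * b) = q / 2 * min 1 (q / 2) * (a * b) by
              intros; ring, ← mul_assoc ((∑ i ∈ t, ‖G i z‖ ^ 2 + 1) ^ (1 - q / 2)), e5, one_mul]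
          ring
        _ ≤ _ := by gcongr
    rw [hK, mul_assoc]
    gcongr γ ^ 2 * ?_
    have e7 : (‖g z‖ ^ 2 + 1) ^ (γ - 1) = (‖g z‖ ^ 2 + 1) ^ ((κ + 1) * (N - 1)) * (‖g z‖ ^ 2 + 1) ^ κ := by
      rw [← Real.rpow_add x1]; congr 1; rw [hγ]; ring
    rw [e7, add_zero, one_div, inv_mul_eq_div, le_div_iff₀ (by positivity)]
    have := mul_le_mul_of_nonneg_left low2
      (Real.rpow_nonneg x1.le ((κ + 1) * (N - 1)))
    linarith

section Sphere

variable {n : ℕ}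

lemma isCompact_Sn : IsCompact (Sn n) := isCompact_sphere _ _

lemma norm_eq_one_of_mem_Sn {ζ : En n} (h : ζ ∈ Sn n) : ‖ζ‖ = 1 := by simpa [Sn] using h

lemma sigmaS_eq_zero_or_isProbabilityMeasure (n : ℕ) :
    sigmaS n = 0 ∨ IsProbabilityMeasure (sigmaS n) := by
  by_cases h0 : μH[(2 * n - 1 : ℝ)] (Sn n) = 0
  · left; rw [sigmaS, Measure.restrict_eq_zero.2 h0, smul_zero]
  by_cases h1 : μH[(2 * n - 1 : ℝ)] (Sn n) = ⊤
  · left; rw [sigmaS, h1, ENNReal.inv_top, zero_smul]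
  · right
    constructor
    rw [sigmaS, Measure.smul_apply, Measure.restrict_apply_univ, smul_eq_mul,
      ENNReal.inv_mul_cancel h0 h1]

lemma ae_mem_Sn (n : ℕ) : ∀ᵐ ζ ∂(sigmaS n), ζ ∈ Sn n :=
  Measure.ae_smul_measure (ae_restrict_mem isCompact_Sn.measurableSet) _

lemma sigmaS_restrict_Sn (n : ℕ) : (sigmaS n).restrict (Sn n) = sigmaS n :=
  Measure.restrict_eq_self_of_ae_mem (ae_mem_Sn n)

lemma measurePreserving_sigmaS (U : En n ≃ₗᵢ[ℂ] En n) :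
    MeasurePreserving U (sigmaS n) (sigmaS n) := by
  have h := (IsometryEquiv.measurePreserving_hausdorffMeasure U.toIsometryEquiv (2 * n - 1 : ℝ))
  have h2 := h.restrict_preimage (s := Sn n) isCompact_Sn.measurableSet
  have e : (U.toIsometryEquiv ⁻¹' Sn n) = Sn n := by
    ext z; simp [Sn]
  rw [e] at h2
  exact h2.smul_measure _

/-- Multiplication by a unimodular constant. -/
def unitSmul (n : ℕ) (c : ℂ) (hc : ‖c‖ = 1) : En n ≃ₗᵢ[ℂ] En n :=
  { LinearEquiv.smulOfNeZero ℂ (En n) c (by rintro rfl; simp at hc) with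
    norm_map' := fun z => by
      show ‖c • z‖ = ‖z‖
      rw [norm_smul, hc, one_mul] }

lemma unitSmul_apply (c : ℂ) (hc : ‖c‖ = 1) (z : En n) : unitSmul n c hc z = c • z := rfl

lemma integral_comp_isometry (U : En n ≃ₗᵢ[ℂ] En n) (A : En n → ℝ) :
    ∫ ζ, A (U ζ) ∂(sigmaS n) = ∫ ζ, A ζ ∂(sigmaS n) :=
  (measurePreserving_sigmaS U).integral_comp U.toHomeomorph.measurableEmbedding A

variable [IsProbabilityMeasure (sigmaS n)]

lemma ContinuousOn.integrable_sigmaS {E : Type*} [NormedAddCommGroup E] {A : En n → E}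
    (hA : ContinuousOn A (Sn n)) : Integrable A (sigmaS n) := by
  have := hA.integrableOn_compact (μ := sigmaS n) isCompact_Sn
  rwa [IntegrableOn, sigmaS_restrict_Sn] at this

lemma integral_sigmaS_mono {A B : En n → ℝ} (hA : ContinuousOn A (Sn n)) (hB : ContinuousOn B (Sn n))
    (h : ∀ ζ ∈ Sn n, A ζ ≤ B ζ) : ∫ ζ, A ζ ∂(sigmaS n) ≤ ∫ ζ, B ζ ∂(sigmaS n) :=
  integral_mono_ae hA.integrable_sigmaS hB.integrable_sigmaS
    ((ae_mem_Sn n).mono fun ζ hζ => h ζ hζ)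

/-- Integration over the sphere in slices. -/
lemma integral_eq_integral_circleAverage {A : En n → ℝ} {R : ℝ} (hR : 0 ≤ R)
    (hA : ContinuousOn A (sphere 0 R)) :
    Integrable (fun ζ => Real.circleAverage (fun l => A (l • ζ)) 0 R) (sigmaS n) ∧
    ∫ ζ, A ((R : ℂ) • ζ) ∂(sigmaS n) =
      ∫ ζ, Real.circleAverage (fun l => A (l • ζ)) 0 R ∂(sigmaS n) := by
  set K : Set (En n × ℝ) := Sn n ×ˢ Icc 0 (2 * Real.pi)
  have hK : IsCompact K := isCompact_Sn.prod isCompact_Icc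
  have hc : ContinuousOn (fun x : En n × ℝ => A (circleMap 0 R x.2 • x.1)) K := by
    refine hA.comp (by fun_prop) ?_
    rintro ⟨ζ, θ⟩ ⟨hζ, -⟩
    have := norm_eq_one_of_mem_Sn hζ
    simp [norm_smul, this, abs_of_nonneg hR]
  have hi : Integrable (fun x : En n × ℝ => A (circleMap 0 R x.2 • x.1))
      ((sigmaS n).prod (volume.restrict (Ioc 0 (2 * Real.pi)))) := by
    have := hc.integrableOn_compact (μ := (sigmaS n).prod volume) hK
    have := this.mono_set (prod_mono_right (s := Sn n) (Ioc_subset_Icc_self (a := 0) (b := 2 * Real.pi)))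
    rwa [IntegrableOn, ← Measure.prod_restrict, sigmaS_restrict_Sn] at this
  have e : ∀ ζ : En n, Real.circleAverage (fun l => A (l • ζ)) 0 R =
      (2 * Real.pi)⁻¹ * ∫ θ in Ioc 0 (2 * Real.pi), A (circleMap 0 R θ • ζ) := by
    intro ζ
    rw [Real.circleAverage, intervalIntegral.integral_of_le Real.two_pi_pos.le, smul_eq_mul]
  simp only [e]
  refine ⟨hi.integral_prod_left.const_mul _, ?_⟩
  rw [integral_const_mul, integral_integral_swap (f := fun ζ θ => A (circleMap 0 R θ • ζ)) hi]
  have e2 : ∀ θ : ℝ, ∫ ζ, A (circleMap 0 R θ • ζ) ∂(sigmaS n) = ∫ ζ, A ((R : ℂ) • ζ) ∂(sigmaS n) := by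
    intro θ
    rw [← integral_comp_isometry (unitSmul n (Complex.exp (θ * Complex.I))
      (Complex.norm_exp_ofReal_mul_I θ)) (fun ζ => A ((R : ℂ) • ζ))]
    simp [unitSmul_apply, circleMap, smul_smul]
  simp only [e2]
  rw [integral_const]
  have := Real.pi_pos
  simp [this.le]
  field_simp

end Sphere

/-- The derivative of a holomorphic function of several variables is continuous. -/
lemma continuousOn_fderiv_of_differentiableOn {E : Type*} [NormedAddCommGroup E] [NormedSpace ℂ E]
    [ProperSpace E] {s : Set E} (hs : IsOpen s) {g : E → ℂ} (hg : DifferentiableOn ℂ g s) :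
    ContinuousOn (fderiv ℂ g) s := by
  intro w hw
  refine ContinuousAt.continuousWithinAt ?_
  obtain ⟨d, hd, hds⟩ := Metric.isOpen_iff.1 hs w hw
  set δ := d / 4 with hδ
  have hδ0 : 0 < δ := by positivity
  have hsub : closedBall w (3 * δ) ⊆ s := (closedBall_subset_ball (by linarith)).trans hds
  have huc : UniformContinuousOn g (closedBall w (3 * δ)) :=
    (isCompact_closedBall _ _).uniformContinuousOn_of_continuous (hg.continuousOn.mono hsub)
  rw [Metric.continuousAt_iff]
  intro ε hε
  obtain ⟨η, hη, hu⟩ := Metric.uniformContinuousOn_iff.1 huc (ε * δ / 2) (by positivity)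
  refine ⟨min η δ, by positivity, fun z hz => ?_⟩
  have hzη : dist z w < η := hz.trans_le (min_le_left _ _)
  have hzδ : dist z w < δ := hz.trans_le (min_le_right _ _)
  rw [dist_eq_norm]
  refine lt_of_le_of_lt (ContinuousLinearMap.opNorm_le_of_unit_norm (C := ε / 2) (by positivity) ?_)
    (half_lt_self hε)
  intro v hv
  have hin : ∀ l : ℂ, ‖l‖ ≤ δ → ∀ y, dist y w < δ → y + l • v ∈ closedBall w (3 * δ) := by
    intro l hl y hy
    rw [mem_closedBall, dist_eq_norm]
    have : ‖y + l • v - w‖ ≤ ‖y - w‖ + ‖l • v‖ := by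
      rw [show y + l • v - w = (y - w) + l • v by abel]; exact norm_add_le _ _
    rw [norm_smul, hv, mul_one] at this
    rw [dist_eq_norm] at hy
    linarith
  have hder : ∀ l : ℂ, ‖l‖ ≤ δ → ∀ y, dist y w < δ →
      HasDerivAt (fun l : ℂ => g (y + l • v)) (fderiv ℂ g (y + l • v) v) l := by
    intro l hl y hy
    have h1 := (hg.differentiableAt (hs.mem_nhds (hsub (hin l hl y hy)))).hasFDerivAt
    have h2 : HasDerivAt (fun l : ℂ => y + l • v) ((1 : ℂ) • v) l :=
      ((hasDerivAt_id l).smul_const v).const_add y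
    rw [one_smul] at h2
    exact h1.comp_hasDerivAt l h2
  have hw0 : dist w w < δ := by simpa
  have key := Complex.norm_deriv_le_of_forall_mem_sphere_norm_le (c := 0) (R := δ) (C := ε * δ / 2)
    (f := fun l : ℂ => g (z + l • v) - g (w + l • v)) hδ0 ?_ ?_
  · have h0 := ((hder 0 (by simpa using hδ0.le) z hzδ).sub (hder 0 (by simpa using hδ0.le) w hw0)).deriv
    simp only [zero_smul, add_zero] at h0
    have e : deriv (fun l : ℂ => g (z + l • v) - g (w + l • v)) 0 = fderiv ℂ g z v - fderiv ℂ g w v := h0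
    rw [e] at key
    rw [_root_.sub_apply]
    refine key.trans (le_of_eq ?_)
    field_simp
  · refine DifferentiableOn.diffContOnCl_ball (U := closedBall 0 δ) ?_ le_rfl
    intro l hl
    have hl' : ‖l‖ ≤ δ := by simpa using hl
    exact ((hder l hl' z hzδ).sub (hder l hl' w hw0)).differentiableAt.differentiableWithinAt
  · intro l hl
    have hl' : ‖l‖ = δ := by simpa using hl
    rw [← dist_eq_norm]
    refine (hu _ (hin l hl'.le z hzδ) _ (hin l hl'.le w hw0) ?_).le
    rwa [dist_add_right]

section Volterra

variable {n : ℕ} {f g : En n → ℂ}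

lemma smul_mem_Bn {z : En n} (hz : z ∈ Bn n) {t : ℝ} (ht : t ∈ Icc (0 : ℝ) 1) : t • z ∈ Bn n := by
  simp only [Bn, mem_ball_zero_iff, norm_smul, Real.norm_eq_abs, abs_of_nonneg ht.1] at *
  nlinarith [ht.2, norm_nonneg z]

lemma isOpen_Bn : IsOpen (Bn n) := isOpen_ball

lemma J_eq_intervalIntegral (z : En n) :
    J g f z = ∫ t in (0 : ℝ)..1, f (t • z) * fderiv ℂ g (t • z) z := by
  rw [J, intervalIntegral.integral_of_le zero_le_one, integral_Ioc_eq_integral_Ioo]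
  refine setIntegral_congr_fun measurableSet_Ioo fun t ht => ?_
  have ht0 : (t : ℂ) ≠ 0 := by exact_mod_cast ht.1.ne'
  simp only [radD]
  rw [show (fderiv ℂ g (t • z)) (t • z) = t * fderiv ℂ g (t • z) z by
    rw [show (t • z : En n) = (t : ℂ) • z from (RCLike.real_smul_eq_coe_smul (K := ℂ) t z), map_smul, smul_eq_mul]]
  field_simp

lemma continuousOn_J_integrand (hf : ContinuousOn f (Bn n)) (hg : DifferentiableOn ℂ g (Bn n)) :
    ContinuousOn (fun x : En n × ℝ => f (x.2 • x.1) * fderiv ℂ g (x.2 • x.1) x.1)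
      (Bn n ×ˢ Icc 0 1) := by
  have h0 : ContinuousOn (fun x : En n × ℝ => x.2 • x.1) (Bn n ×ˢ Icc 0 1) := by fun_prop
  have hm : MapsTo (fun x : En n × ℝ => x.2 • x.1) (Bn n ×ˢ Icc 0 1) (Bn n) :=
    fun x hx => smul_mem_Bn hx.1 hx.2
  exact (hf.comp h0 hm).mul
    (((continuousOn_fderiv_of_differentiableOn isOpen_Bn hg).comp h0 hm).clm_apply continuousOn_fst)

lemma intervalIntegrable_J (hf : ContinuousOn f (Bn n)) (hg : DifferentiableOn ℂ g (Bn n)) {z : En n}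
    (hz : z ∈ Bn n) :
    IntervalIntegrable (fun t : ℝ => f (t • z) * fderiv ℂ g (t • z) z) volume 0 1 := by
  refine ContinuousOn.intervalIntegrable ?_
  rw [uIcc_of_le zero_le_one]
  exact (continuousOn_J_integrand hf hg).comp (f := fun t : ℝ => (z, t)) (by fun_prop)
    fun t ht => ⟨hz, ht⟩

lemma continuousOn_J (hf : ContinuousOn f (Bn n)) (hg : DifferentiableOn ℂ g (Bn n)) :
    ContinuousOn (J g f) (Bn n) := by
  have e : J g f = fun z => ∫ t in (0 : ℝ)..1, f (t • z) * fderiv ℂ g (t • z) z :=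
    funext J_eq_intervalIntegral
  rw [e]
  intro w hw
  refine ContinuousAt.continuousWithinAt ?_
  obtain ⟨ρ, hρ, hρ1⟩ := exists_between (show ‖w‖ < 1 by simpa [Bn] using hw)
  have hsub : closedBall (0 : En n) ρ ⊆ Bn n := closedBall_subset_ball hρ1
  have hc := continuousOn_J_integrand hf hg
  obtain ⟨C, hC⟩ := ((isCompact_closedBall (0 : En n) ρ).prod isCompact_Icc).exists_bound_of_continuousOn
    (hc.mono (prod_mono_left (t := Icc (0:ℝ) 1) hsub))
  have hnh : closedBall (0 : En n) ρ ∈ 𝓝 w :=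
    mem_of_superset (isOpen_ball.mem_nhds (by simpa using hρ)) ball_subset_closedBall
  have hI : uIoc (0 : ℝ) 1 ⊆ Icc 0 1 := by rw [uIoc_of_le zero_le_one]; exact Ioc_subset_Icc_self
  refine intervalIntegral.continuousAt_of_dominated_interval (bound := fun _ => C) ?_ ?_ (by simp) ?_
  · filter_upwards [hnh] with z hz
    exact (intervalIntegrable_J hf hg (hsub hz)).def'.aestronglyMeasurable
  · filter_upwards [hnh] with z hz
    exact Eventually.of_forall fun t ht => hC (z, t) ⟨hz, hI ht⟩
  · refine Eventually.of_forall fun t ht => ?_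
    exact (hc.comp (f := fun z : En n => (z, t)) (s := Bn n) (by fun_prop)
      fun z hz => ⟨hz, hI ht⟩).continuousAt (isOpen_Bn.mem_nhds hw)

lemma J_zero : J g f 0 = 0 := by
  simp [J_eq_intervalIntegral]

lemma norm_J_le {z : En n} {ρ A B : ℝ} (hA : ∀ w, ‖w‖ ≤ ρ → ‖f w‖ ≤ A)
    (hB : ∀ w, ‖w‖ ≤ ρ → ‖fderiv ℂ g w‖ ≤ B) (hz : ‖z‖ ≤ ρ) : ‖J g f z‖ ≤ A * B * ‖z‖ := by
  rw [J_eq_intervalIntegral]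
  have := intervalIntegral.norm_integral_le_of_norm_le_const (a := 0) (b := 1) (C := A * B * ‖z‖)
    (f := fun t : ℝ => f (t • z) * fderiv ℂ g (t • z) z) ?_
  · simpa using this
  intro t ht
  rw [uIoc_of_le zero_le_one] at ht
  have hw : ‖t • z‖ ≤ ρ := by
    rw [norm_smul, Real.norm_eq_abs, abs_of_nonneg ht.1.le]
    nlinarith [ht.2, norm_nonneg z]
  rw [norm_mul, mul_assoc]
  have h1 := hA _ hw
  have h2 := ((fderiv ℂ g (t • z)).le_opNorm z).trans
    (mul_le_mul_of_nonneg_right (hB _ hw) (norm_nonneg z))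
  exact mul_le_mul h1 h2 (norm_nonneg _) ((norm_nonneg _).trans h1)

lemma J_sum {ι : Type*} (t : Finset ι) (c : ι → ℂ) (F : ι → En n → ℂ)
    (hF : ∀ i ∈ t, ContinuousOn (F i) (Bn n)) (hg : DifferentiableOn ℂ g (Bn n)) {z : En n}
    (hz : z ∈ Bn n) : J g (fun w => ∑ i ∈ t, c i * F i w) z = ∑ i ∈ t, c i * J g (F i) z := by
  simp only [J_eq_intervalIntegral]
  rw [← Finset.sum_congr rfl fun i _ => intervalIntegral.integral_const_mul (c i) _,
    ← intervalIntegral.integral_finsetSum fun i hi => (intervalIntegrable_J (hF i hi) hg hz).const_mul _]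
  refine intervalIntegral.integral_congr fun s _ => ?_
  simp only [Finset.sum_mul, mul_assoc]

lemma J_const_mul (c : ℂ) (z : En n) : J g (fun w => c * f w) z = c * J g f z := by
  simp only [J_eq_intervalIntegral, mul_assoc, intervalIntegral.integral_const_mul]

/-! ### Slices -/

lemma norm_smul_Sn {ζ : En n} (hζ : ζ ∈ Sn n) (l : ℂ) : ‖l • ζ‖ = ‖l‖ := by
  rw [norm_smul, norm_eq_one_of_mem_Sn hζ, mul_one]

lemma smul_mem_Bn_of_Sn {ζ : En n} (hζ : ζ ∈ Sn n) {l : ℂ} (hl : l ∈ ball (0 : ℂ) 1) : l • ζ ∈ Bn n := by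
  rw [Bn, mem_ball_zero_iff, norm_smul_Sn hζ]; simpa using hl

lemma hasDerivAt_slice (hg : DifferentiableOn ℂ g (Bn n)) {ζ : En n} (hζ : ζ ∈ Sn n) {l : ℂ}
    (hl : l ∈ ball (0 : ℂ) 1) : HasDerivAt (fun l : ℂ => g (l • ζ)) (fderiv ℂ g (l • ζ) ζ) l := by
  have h1 := (hg.differentiableAt (isOpen_Bn.mem_nhds (smul_mem_Bn_of_Sn hζ hl))).hasFDerivAt
  have h2 : HasDerivAt (fun l : ℂ => l • ζ) ((1 : ℂ) • ζ) l := (hasDerivAt_id l).smul_const ζ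
  rw [one_smul] at h2
  exact h1.comp_hasDerivAt l h2

lemma differentiableOn_slice (hg : DifferentiableOn ℂ g (Bn n)) {ζ : En n} (hζ : ζ ∈ Sn n) :
    DifferentiableOn ℂ (fun l : ℂ => g (l • ζ)) (ball 0 1) :=
  fun _ hl => (hasDerivAt_slice hg hζ hl).differentiableAt.differentiableWithinAt

/-- On slices, `J g f` is a primitive of `f g'`. -/
lemma hasDerivAt_J_slice (hf : DifferentiableOn ℂ f (Bn n)) (hg : DifferentiableOn ℂ g (Bn n))
    {ζ : En n} (hζ : ζ ∈ Sn n) {l : ℂ} (hl : l ∈ ball (0 : ℂ) 1) :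
    HasDerivAt (fun l : ℂ => J g f (l • ζ)) (f (l • ζ) * deriv (fun l : ℂ => g (l • ζ)) l) l := by
  have hd : DifferentiableOn ℂ (fun l : ℂ => f (l • ζ) * deriv (fun l : ℂ => g (l • ζ)) l) (ball 0 1) :=
    (differentiableOn_slice hf hζ).mul ((differentiableOn_slice hg hζ).deriv isOpen_ball)
  obtain ⟨H, H0, hH⟩ := hd.isExactOn_ball.with_val_at 0 0
  have key : ∀ l ∈ ball (0 : ℂ) 1, J g f (l • ζ) = H l := by
    intro l hl
    rw [J_eq_intervalIntegral]
    have hmem : ∀ t ∈ uIcc (0 : ℝ) 1, (t : ℂ) * l ∈ ball (0 : ℂ) 1 := by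
      intro t ht
      rw [uIcc_of_le zero_le_one] at ht
      rw [mem_ball_zero_iff] at hl ⊢
      rw [norm_mul, Complex.norm_real, Real.norm_eq_abs, abs_of_nonneg ht.1]
      nlinarith [ht.2, norm_nonneg l]
    have e : ∀ t ∈ uIcc (0 : ℝ) 1, f (t • l • ζ) * fderiv ℂ g (t • l • ζ) (l • ζ) =
        (f (((t : ℂ) * l) • ζ) * deriv (fun l : ℂ => g (l • ζ)) ((t : ℂ) * l)) * l := by
      intro t ht
      rw [(hasDerivAt_slice hg hζ (hmem t ht)).deriv, map_smul, smul_eq_mul,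
        show t • l • ζ = ((t : ℂ) * l) • ζ by
          rw [RCLike.real_smul_eq_coe_smul (K := ℂ), smul_smul]; rfl]
      ring
    have hderiv : ∀ t ∈ uIcc (0 : ℝ) 1, HasDerivAt (fun t : ℝ => H ((t : ℂ) * l))
        ((f (((t : ℂ) * l) • ζ) * deriv (fun l : ℂ => g (l • ζ)) ((t : ℂ) * l)) * l) t := by
      intro t ht
      have h1 := hH _ (hmem t ht)
      have h2 : HasDerivAt (fun s : ℂ => s * l) l (t : ℂ) := by
        simpa using (hasDerivAt_id (t : ℂ)).mul_const l
      exact (h1.comp (t : ℂ) h2).comp_ofReal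
    rw [intervalIntegral.integral_congr e, intervalIntegral.integral_eq_sub_of_hasDerivAt hderiv]
    · simp [H0]
    · refine (ContinuousOn.intervalIntegrable ?_)
      refine ContinuousOn.mul ?_ continuousOn_const
      exact hd.continuousOn.comp (f := fun t : ℝ => (t : ℂ) * l) (by fun_prop) hmem
  exact (hH l hl).congr_of_eventuallyEq
    (Filter.eventually_of_mem (isOpen_ball.mem_nhds hl) key)

end Volterra

/-- The integral mean of `|f|^p` over the sphere of radius `R`. -/
def pMean (n : ℕ) (p R : ℝ) (f : En n → ℂ) : ℝ := ∫ ζ, ‖f ((R : ℂ) • ζ)‖ ^ p ∂(sigmaS n)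

section Means

variable {n : ℕ} {p q r R : ℝ} {f g : En n → ℂ}

lemma ofReal_mem_ball (hR : 0 ≤ R) (hR1 : R < 1) : (R : ℂ) ∈ ball (0 : ℂ) 1 := by
  simpa [abs_of_nonneg hR] using hR1

lemma continuousOn_dilate {X : Type*} [TopologicalSpace X] {f : En n → X} (hf : ContinuousOn f (Bn n))
    (hR : 0 ≤ R) (hR1 : R < 1) :
    ContinuousOn (fun ζ : En n => f ((R : ℂ) • ζ)) (Sn n) :=
  hf.comp (by fun_prop) fun _ hζ => smul_mem_Bn_of_Sn hζ (ofReal_mem_ball hR hR1)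

lemma continuousOn_norm_rpow_dilate (hf : ContinuousOn f (Bn n)) (hp : 0 < p)
    (hR : 0 ≤ R) (hR1 : R < 1) :
    ContinuousOn (fun ζ : En n => ‖f ((R : ℂ) • ζ)‖ ^ p) (Sn n) :=
  (continuousOn_dilate hf hR hR1).norm.rpow_const fun _ _ => Or.inr hp.le

lemma pMean_nonneg : 0 ≤ pMean n p R f := integral_nonneg fun _ => by positivity

lemma pMean_const_mul (c : ℂ) :
    pMean n p R (fun z => c * f z) = ‖c‖ ^ p * pMean n p R f := by
  rw [pMean, pMean, ← integral_const_mul]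
  congr 1; funext ζ
  rw [norm_mul, Real.mul_rpow (norm_nonneg _) (norm_nonneg _)]

lemma pMean_zero_of_eq_zero (hp : 0 < p) (h : f 0 = 0) : pMean n p 0 f = 0 := by
  simp [pMean, h, Real.zero_rpow hp.ne']

lemma sphere_subset_Bn (hR1 : R < 1) : sphere (0 : En n) R ⊆ Bn n := fun z hz => by
  rw [mem_sphere_zero_iff_norm] at hz
  rw [Bn, mem_ball_zero_iff, hz]; exact hR1

variable [IsProbabilityMeasure (sigmaS n)]

lemma pMean_le_of_forall_norm_le (hf : ContinuousOn f (Bn n)) (hp : 0 < p) (hR : 0 ≤ R) (hR1 : R < 1)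
    {A : ℝ} (h : ∀ z, ‖z‖ ≤ R → ‖f z‖ ≤ A) : pMean n p R f ≤ A ^ p := by
  have := integral_sigmaS_mono (continuousOn_norm_rpow_dilate hf hp hR hR1)
    (continuousOn_const (c := A ^ p)) fun ζ hζ => by
      have := h ((R : ℂ) • ζ) (by rw [norm_smul_Sn hζ]; simp [abs_of_nonneg hR])
      gcongr
  simpa [pMean] using this

lemma lintegral_eq_ofReal_pMean (hf : ContinuousOn f (Bn n)) (hp : 0 < p) (hR : 0 ≤ R) (hR1 : R < 1) :
    ∫⁻ ζ, (‖f (R • ζ)‖₊ : ℝ≥0∞) ^ p ∂(sigmaS n) = ENNReal.ofReal (pMean n p R f) := by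
  rw [pMean, ofReal_integral_eq_lintegral_ofReal
    (continuousOn_norm_rpow_dilate hf hp hR hR1).integrable_sigmaS
    (Eventually.of_forall fun _ => by positivity)]
  congr 1; funext ζ
  rw [← ENNReal.ofReal_rpow_of_nonneg (norm_nonneg _) hp.le, RCLike.real_smul_eq_coe_smul (K := ℂ),
    ofReal_norm]
  rfl

lemma hNorm_le_ofReal_iff (hf : ContinuousOn f (Bn n)) (hp : 0 < p) {A : ℝ} (hA : 0 ≤ A) :
    hNorm n p f ≤ ENNReal.ofReal A ↔ ∀ R ∈ Ioo (0 : ℝ) 1, pMean n p R f ≤ A ^ p := by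
  rw [hNorm, one_div, ENNReal.rpow_inv_le_iff hp, iSup₂_le_iff]
  refine forall₂_congr fun R hR => ?_
  rw [lintegral_eq_ofReal_pMean hf hp hR.1.le hR.2, ENNReal.ofReal_rpow_of_nonneg hA hp.le,
    ENNReal.ofReal_le_ofReal_iff (by positivity)]

lemma pMean_le_of_hNorm (hf : ContinuousOn f (Bn n)) (hp : 0 < p) (h : hNorm n p f < ⊤) :
    ∀ R ∈ Ioo (0 : ℝ) 1, pMean n p R f ≤ (hNorm n p f).toReal ^ p := by
  rw [← hNorm_le_ofReal_iff hf hp ENNReal.toReal_nonneg, ENNReal.ofReal_toReal h.ne]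

lemma hNorm_lt_top_of_pMean_le (hf : ContinuousOn f (Bn n)) (hp : 0 < p) {B : ℝ} (hB : 0 ≤ B)
    (h : ∀ R ∈ Ioo (0 : ℝ) 1, pMean n p R f ≤ B) : hNorm n p f < ⊤ := by
  refine lt_of_le_of_lt ((hNorm_le_ofReal_iff hf hp (A := B ^ p⁻¹) (by positivity)).2 ?_)
    ENNReal.ofReal_lt_top
  rwa [Real.rpow_inv_rpow hB hp.ne']

lemma slice_mean (hf : ContinuousOn f (Bn n)) (hp : 0 < p) (hR : 0 ≤ R) (hR1 : R < 1) :
    Integrable (fun ζ => Real.circleAverage (fun l => ‖f (l • ζ)‖ ^ p) 0 R) (sigmaS n) ∧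
    pMean n p R f = ∫ ζ, Real.circleAverage (fun l => ‖f (l • ζ)‖ ^ p) 0 R ∂(sigmaS n) :=
  integral_eq_integral_circleAverage (A := fun z => ‖f z‖ ^ p) hR
    ((hf.mono (sphere_subset_Bn hR1)).norm.rpow_const fun _ _ => Or.inr hp.le)

lemma pMean_mono (hf : DifferentiableOn ℂ f (Bn n)) (hp : 0 < p) {R₁ R₂ : ℝ} (h0 : 0 ≤ R₁)
    (h12 : R₁ ≤ R₂) (h2 : R₂ < 1) : pMean n p R₁ f ≤ pMean n p R₂ f := by
  obtain ⟨i1, e1⟩ := slice_mean hf.continuousOn hp h0 (h12.trans_lt h2)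
  obtain ⟨i2, e2⟩ := slice_mean hf.continuousOn hp (h0.trans h12) h2
  rw [e1, e2]
  refine integral_mono_ae i1 i2 ((ae_mem_Sn n).mono fun ζ hζ => ?_)
  exact circleAverage_norm_rpow_mono (differentiableOn_slice hf hζ) hp h0 h12 h2

/-- Forward estimate on the ball. -/
theorem pMean_J_le {ε : ℝ} (hp : 0 < p) (hq : 0 < q) (hr : 0 < r) (hpqr : 1 / q = 1 / p + 1 / r)
    (hε : 0 < ε) :
    ∃ C, 0 ≤ C ∧ ∀ f g : En n → ℂ, DifferentiableOn ℂ f (Bn n) → DifferentiableOn ℂ g (Bn n) →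
      ∀ R₀ R, 0 ≤ R₀ → R₀ ≤ R → R < 1 →
        pMean n q R (J g f) ≤ 2 * pMean n q R₀ (J g f) + ε * (pMean n p R f + pMean n r R g) +
          C * (pMean n r R g - pMean n r R₀ g) := by
  obtain ⟨C, hC, hmain⟩ := circleAverage_primitive_le hp hq hr hpqr hε
  refine ⟨C, hC, fun f g hf hg R₀ R h0 h12 h2 => ?_⟩
  have hJ := continuousOn_J hf.continuousOn hg
  have hR : 0 ≤ R := h0.trans h12
  have h02 := h12.trans_lt h2
  obtain ⟨i1, e1⟩ := slice_mean hJ hq hR h2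
  obtain ⟨i2, e2⟩ := slice_mean hJ hq h0 h02
  obtain ⟨i3, e3⟩ := slice_mean hf.continuousOn hp hR h2
  obtain ⟨i4, e4⟩ := slice_mean hg.continuousOn hr hR h2
  obtain ⟨i5, e5⟩ := slice_mean hg.continuousOn hr h0 h02
  rw [e1, e2, e3, e4, e5]
  set A2 := fun ζ : En n => Real.circleAverage (fun l => ‖J g f (l • ζ)‖ ^ q) 0 R₀ with hA2
  set A3 := fun ζ : En n => Real.circleAverage (fun l => ‖f (l • ζ)‖ ^ p) 0 R with hA3
  set A4 := fun ζ : En n => Real.circleAverage (fun l => ‖g (l • ζ)‖ ^ r) 0 R with hA4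
  set A5 := fun ζ : En n => Real.circleAverage (fun l => ‖g (l • ζ)‖ ^ r) 0 R₀ with hA5
  have i34 : Integrable (fun ζ => A3 ζ + A4 ζ) (sigmaS n) := i3.add i4
  have i45 : Integrable (fun ζ => A4 ζ - A5 ζ) (sigmaS n) := i4.sub i5
  have k2 := i2.const_mul 2
  have k34 := i34.const_mul ε
  have k45 := i45.const_mul C
  have k234 : Integrable (fun ζ => 2 * A2 ζ + ε * (A3 ζ + A4 ζ)) (sigmaS n) := k2.add k34
  have k : Integrable (fun ζ => 2 * A2 ζ + ε * (A3 ζ + A4 ζ) + C * (A4 ζ - A5 ζ)) (sigmaS n) :=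
    k234.add k45
  have key : ∫ ζ, (2 * A2 ζ + ε * (A3 ζ + A4 ζ) + C * (A4 ζ - A5 ζ)) ∂(sigmaS n) =
      2 * ∫ ζ, A2 ζ ∂(sigmaS n) + ε * (∫ ζ, A3 ζ ∂(sigmaS n) + ∫ ζ, A4 ζ ∂(sigmaS n)) +
        C * (∫ ζ, A4 ζ ∂(sigmaS n) - ∫ ζ, A5 ζ ∂(sigmaS n)) := by
    rw [integral_add k234 k45, integral_add k2 k34, integral_const_mul, integral_const_mul,
      integral_const_mul, integral_add i3 i4, integral_sub i4 i5]
  rw [← key]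
  refine integral_mono_ae i1 k ((ae_mem_Sn n).mono fun ζ hζ => ?_)
  exact hmain 1 _ _ _ (differentiableOn_slice hf hζ) (differentiableOn_slice hg hζ)
    (fun z hz => hasDerivAt_J_slice hf hg hζ hz) R₀ R h0 h12 h2

lemma ENNReal.le_mul_of_forall_ofReal {x y c : ℝ≥0∞} (hx : x < ⊤) (hc : c < ⊤)
    (h : ∀ A : ℝ, 0 < A → x ≤ ENNReal.ofReal A → y ≤ c * ENNReal.ofReal A) : y ≤ c * x := by
  rcases eq_or_ne x 0 with rfl | h0
  · have ht : Tendsto (fun A : ℝ => c * ENNReal.ofReal A) (𝓝[>] 0) (𝓝 (c * ENNReal.ofReal 0)) := by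
      refine ENNReal.Tendsto.const_mul ?_ (Or.inr hc.ne)
      exact (ENNReal.continuous_ofReal.tendsto 0).mono_left nhdsWithin_le_nhds
    rw [ENNReal.ofReal_zero] at ht
    exact ge_of_tendsto ht (eventually_nhdsWithin_of_forall fun A hA => h A hA zero_le)
  · have := h x.toReal (ENNReal.toReal_pos h0 hx.ne) (ENNReal.ofReal_toReal hx.ne).ge
    rwa [ENNReal.ofReal_toReal hx.ne] at this

/-- If `g ∈ H^r`, then `J_g` is bounded from `H^p` to `H^q`. -/
theorem J_bounded_of_hNorm_lt_top (hp : 0 < p) (hq : 0 < q) (hr : 0 < r)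
    (hpqr : 1 / q = 1 / p + 1 / r) (hg : DifferentiableOn ℂ g (Bn n)) (hgr : hNorm n r g < ⊤) :
    ∃ C : ℝ≥0∞, 0 < C ∧ C < ⊤ ∧ ∀ f, MemHp n p f → hNorm n q (J g f) ≤ C * hNorm n p f := by
  obtain ⟨C, hC, hmain⟩ := pMean_J_le (n := n) hp hq hr hpqr one_pos
  set G := (hNorm n r g).toReal ^ r with hG
  have hG0 : 0 ≤ G := by positivity
  have hgm := pMean_le_of_hNorm hg.continuousOn hr hgr
  set B := 1 + G + C * G with hB
  have hB0 : 0 < B := by positivity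
  refine ⟨ENNReal.ofReal (B ^ q⁻¹), by simp; positivity, ENNReal.ofReal_lt_top, fun f hf => ?_⟩
  refine ENNReal.le_mul_of_forall_ofReal hf.2 ENNReal.ofReal_lt_top fun A hA hfA => ?_
  rw [← ENNReal.ofReal_mul (by positivity),
    hNorm_le_ofReal_iff (continuousOn_J hf.1.continuousOn hg) hq (by positivity)]
  rw [hNorm_le_ofReal_iff hf.1.continuousOn hp hA.le] at hfA
  intro R hR
  have h := hmain (fun z => ((A⁻¹ : ℝ) : ℂ) * f z) g (hf.1.const_mul _) hg 0 R le_rfl hR.1.le hR.2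
  have eJ : J g (fun z => ((A⁻¹ : ℝ) : ℂ) * f z) = fun z => ((A⁻¹ : ℝ) : ℂ) * J g f z :=
    funext fun z => J_const_mul _ z
  rw [eJ, pMean_const_mul, pMean_const_mul, pMean_const_mul,
    pMean_zero_of_eq_zero hq J_zero] at h
  have hn : ‖((A⁻¹ : ℝ) : ℂ)‖ = A⁻¹ := by simp [abs_of_pos hA]
  rw [hn, Real.inv_rpow hA.le, Real.inv_rpow hA.le] at h
  have h1 : (A ^ p)⁻¹ * pMean n p R f ≤ 1 := by
    rw [inv_mul_le_iff₀ (by positivity), mul_one]; exact hfA R hR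
  have h2 := hgm R hR
  have h3 : 0 ≤ pMean n r 0 g := pMean_nonneg
  have h4 : C * (pMean n r R g - pMean n r 0 g) ≤ C * G := by gcongr; linarith
  have h5 : (A ^ q)⁻¹ * pMean n q R (J g f) ≤ B := by linarith
  rw [inv_mul_le_iff₀ (by positivity)] at h5
  rw [Real.mul_rpow (by positivity) hA.le, Real.rpow_inv_rpow hB0.le hq.ne', mul_comm]
  exact h5

/-- If `g ∈ H^r`, then `J_g` is compact from `H^p` to `H^q`. -/
theorem J_compact_of_hNorm_lt_top (hp : 0 < p) (hq : 0 < q) (hr : 0 < r)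
    (hpqr : 1 / q = 1 / p + 1 / r) (hg : DifferentiableOn ℂ g (Bn n)) (hgr : hNorm n r g < ⊤)
    {f : ℕ → En n → ℂ} (hf : ∀ k, MemHp n p (f k)) {M : ℝ≥0∞} (hM : M < ⊤)
    (hfM : ∀ k, hNorm n p (f k) ≤ M)
    (hlim : ∀ K : Set (En n), K ⊆ Bn n → IsCompact K →
      TendstoUniformlyOn (fun k => f k) 0 atTop K) :
    Tendsto (fun k => hNorm n q (J g (f k))) atTop (𝓝 0) := by
  have hgm := pMean_le_of_hNorm hg.continuousOn hr hgr
  set S := Set.image (fun R => pMean n r R g) (Ioo (0 : ℝ) 1) with hS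
  have hSb : BddAbove S := ⟨_, by rintro _ ⟨R, hR, rfl⟩; exact hgm R hR⟩
  have hSn : S.Nonempty := ⟨_, _, (by norm_num : (1 / 2 : ℝ) ∈ Ioo (0 : ℝ) 1), rfl⟩
  set G := sSup S with hG
  have hgG : ∀ R ∈ Ioo (0 : ℝ) 1, pMean n r R g ≤ G := fun R hR => le_csSup hSb ⟨R, hR, rfl⟩
  have hG0 : 0 ≤ G := pMean_nonneg.trans (hgG (1 / 2) (by norm_num))
  have hfm : ∀ k, ∀ R ∈ Ioo (0 : ℝ) 1, pMean n p R (f k) ≤ M.toReal ^ p := by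
    intro k
    rw [← hNorm_le_ofReal_iff (hf k).1.continuousOn hp ENNReal.toReal_nonneg, ENNReal.ofReal_toReal hM.ne]
    exact hfM k
  have real : ∀ e : ℝ, 0 < e → ∀ᶠ k in atTop, hNorm n q (J g (f k)) ≤ ENNReal.ofReal e := by
    intro e he
    set a := e ^ q with ha
    have ha0 : 0 < a := by positivity
    set Z := M.toReal ^ p + G + 1 with hZ
    have hZ0 : 0 < Z := by positivity
    obtain ⟨C, hC, hmain⟩ := pMean_J_le (n := n) (ε := a / (3 * Z)) hp hq hr hpqr (by positivity)
    obtain ⟨_, ⟨R₀, hR₀, rfl⟩, hlt⟩ := exists_lt_of_lt_csSup hSn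
      (show G - a / (3 * (C + 1)) < sSup S by rw [← hG]; linarith [show 0 < a / (3 * (C + 1)) by positivity])
    have hsub : closedBall (0 : En n) R₀ ⊆ Bn n := closedBall_subset_ball hR₀.2
    obtain ⟨B, hB⟩ := (isCompact_closedBall (0 : En n) R₀).exists_bound_of_continuousOn
      ((continuousOn_fderiv_of_differentiableOn isOpen_Bn hg).mono hsub)
    set b := (a / 6) ^ q⁻¹ with hb
    have hb0 : 0 < b := by positivity
    have hbq : b ^ q = a / 6 := Real.rpow_inv_rpow (by positivity) hq.ne'
    have hunif := Metric.tendstoUniformlyOn_iff.1 (hlim _ hsub (isCompact_closedBall _ _))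
      (b / (|B| + 1)) (by positivity)
    filter_upwards [hunif] with k hk
    have hJc := continuousOn_J (hf k).1.continuousOn hg
    have hJ : ∀ z : En n, ‖z‖ ≤ R₀ → ‖J g (f k) z‖ ≤ b := by
      intro z hz
      have := norm_J_le (g := g) (f := f k) (A := b / (|B| + 1)) (B := |B|) (ρ := R₀) (z := z)
        (fun w hw => by
          have := hk w (by simpa using hw)
          simp only [Pi.zero_apply, dist_zero_left] at this
          exact this.le)
        (fun w hw => (hB w (by simpa using hw)).trans (le_abs_self _)) hz
      refine this.trans ?_
      have h1 : b / (|B| + 1) * |B| ≤ b := by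
        rw [div_mul_eq_mul_div, div_le_iff₀ (by positivity)]; nlinarith
      have h2 : ‖z‖ ≤ 1 := hz.trans hR₀.2.le
      calc _ ≤ b * 1 := by gcongr
        _ = b := mul_one b
    rw [hNorm_le_ofReal_iff hJc hq he.le]
    intro R hR
    rcases le_total R R₀ with h | h
    · have := pMean_le_of_forall_norm_le hJc hq hR.1.le hR.2 (fun z hz => hJ z (hz.trans h))
      rw [hbq] at this; linarith
    · have h0 := pMean_le_of_forall_norm_le hJc hq hR₀.1.le hR₀.2 hJ
      rw [hbq] at h0
      have h1 := hmain (f k) g (hf k).1 hg R₀ R hR₀.1.le h hR.2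
      have h2 : a / (3 * Z) * (pMean n p R (f k) + pMean n r R g) ≤ a / 3 := by
        calc _ ≤ a / (3 * Z) * Z := by
              gcongr; linarith [hfm k R hR, hgG R hR]
          _ = a / 3 := by field_simp
      have h3 : C * (pMean n r R g - pMean n r R₀ g) ≤ a / 3 := by
        calc _ ≤ C * (a / (3 * (C + 1))) := by gcongr; linarith [hgG R hR]
          _ ≤ (C + 1) * (a / (3 * (C + 1))) := by gcongr; linarith
          _ = a / 3 := by field_simp
      linarith
  rw [ENNReal.tendsto_nhds_zero]
  intro ε hε
  obtain ⟨e, he, -, hee⟩ : ∃ e : ℝ, 0 < e ∧ True ∧ ENNReal.ofReal e ≤ ε := by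
    refine ⟨(min ε 1).toReal, ENNReal.toReal_pos (by simp [hε.ne']) (by simp), trivial, ?_⟩
    rw [ENNReal.ofReal_toReal (by simp)]; exact min_le_left _ _
  exact (real e he).mono fun k hk => hk.trans hee

end Means

section Geometry

variable {n : ℕ}

/-- The component of `x` orthogonal to `η`. -/
def perp (η x : En n) : En n := x - inner ℂ η x • η

lemma add_perp (η x : En n) : inner ℂ η x • η + perp η x = x := by simp [perp]

lemma inner_perp_self {η : En n} (hη : ‖η‖ = 1) (x : En n) : inner ℂ η (perp η x) = 0 := by
  rw [perp, inner_sub_right, inner_smul_right, inner_self_eq_norm_sq_to_K, hη]; simp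

lemma inner_eq_add_perp {η : En n} (hη : ‖η‖ = 1) (x y : En n) :
    inner ℂ x y = (starRingEnd ℂ) (inner ℂ η x) * inner ℂ η y + inner ℂ (perp η x) (perp η y) := by
  conv_lhs => rw [← add_perp η x, ← add_perp η y]
  rw [inner_add_left, inner_add_right, inner_add_right, inner_smul_left, inner_smul_left,
    inner_smul_right, inner_smul_right, inner_perp_self hη, inner_self_eq_norm_sq_to_K, hη,
    ← inner_conj_symm (perp η x) η, inner_perp_self hη]
  simp

lemma norm_sq_eq_add_perp {η : En n} (hη : ‖η‖ = 1) (x : En n) :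
    ‖x‖ ^ 2 = ‖inner ℂ η x‖ ^ 2 + ‖perp η x‖ ^ 2 := by
  have h := inner_eq_add_perp hη x x
  rw [inner_self_eq_norm_sq_to_K, inner_self_eq_norm_sq_to_K, Complex.conj_mul'] at h
  exact_mod_cast (show ((‖x‖ ^ 2 : ℝ) : ℂ) = ((‖inner ℂ η x‖ ^ 2 + ‖perp η x‖ ^ 2 : ℝ) : ℂ) by
    push_cast; exact h)

/-- The nonisotropic distance `|1 - ⟨ζ, a⟩|`. -/
def qd (ζ a : En n) : ℝ := ‖1 - inner ℂ a ζ‖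

lemma qd_comm (a b : En n) : qd a b = qd b a := by
  rw [qd, qd, ← inner_conj_symm, ← Complex.norm_conj]; simp

lemma norm_perp_sq_le {η x : En n} (hη : ‖η‖ = 1) (hx : ‖x‖ ≤ 1) :
    ‖perp η x‖ ^ 2 ≤ 2 * qd x η := by
  have h := norm_sq_eq_add_perp hη x
  have h1 : ‖inner ℂ η x‖ ≤ 1 := by
    have := norm_inner_le_norm (𝕜 := ℂ) η x; rw [hη, one_mul] at this; linarith
  have h2 : 1 - ‖inner ℂ η x‖ ≤ qd x η := by
    have := norm_sub_norm_le (1 : ℂ) (inner ℂ η x); rwa [norm_one] at this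
  have : ‖x‖ ^ 2 ≤ 1 := by nlinarith [norm_nonneg x]
  nlinarith [norm_nonneg (inner ℂ η x : ℂ)]

lemma qd_triangle {a b c : En n} (hb : ‖b‖ = 1) (ha : ‖a‖ ≤ 1) (hc : ‖c‖ ≤ 1) :
    qd a c ≤ 2 * (qd a b + qd b c) := by
  have e := inner_eq_add_perp hb c a
  have h1 := norm_perp_sq_le hb ha
  have h2 := norm_perp_sq_le hb hc
  rw [qd_comm b c]
  have hp : ‖inner ℂ (perp b c) (perp b a)‖ ≤ qd a b + qd c b := by
    refine (norm_inner_le_norm _ _).trans ?_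
    nlinarith [sq_nonneg (‖perp b c‖ - ‖perp b a‖)]
  have h3 : ‖inner ℂ b a‖ ≤ 1 := by
    have := norm_inner_le_norm (𝕜 := ℂ) b a; rw [hb, one_mul] at this; linarith
  have e2 : 1 - inner ℂ c a = (1 - inner ℂ b a) + inner ℂ b a * (starRingEnd ℂ) (1 - inner ℂ b c) -
      inner ℂ (perp b c) (perp b a) := by
    rw [e]; simp; ring
  have : qd a c ≤ qd a b + ‖inner ℂ b a‖ * qd c b + ‖inner ℂ (perp b c) (perp b a)‖ := by
    rw [qd, e2]
    refine (norm_sub_le _ _).trans (add_le_add (norm_add_le _ _ |>.trans ?_) le_rfl)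
    rw [norm_mul, Complex.norm_conj]; rfl
  have h4 : 0 ≤ qd c b := norm_nonneg _
  nlinarith

/-- The unitary group acts transitively on the sphere. -/
lemma exists_isometry_map_eq {η η' : En n} (h : ‖η‖ = 1) (h' : ‖η'‖ = 1) :
    ∃ U : En n ≃ₗᵢ[ℂ] En n, U η = η' := by
  let L : (Submodule.span ℂ {η}) →ₗᵢ[ℂ] En n :=
    (Submodule.subtypeₗᵢ _).comp
      ((LinearIsometryEquiv.toSpanUnitSingleton (𝕜 := ℂ) η h).symm.trans
        (LinearIsometryEquiv.toSpanUnitSingleton (𝕜 := ℂ) η' h')).toLinearIsometry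
  refine ⟨L.extend.toLinearIsometryEquiv rfl, ?_⟩
  have e : (LinearIsometryEquiv.toSpanUnitSingleton (𝕜 := ℂ) η h) 1 =
      ⟨η, Submodule.mem_span_singleton_self η⟩ := by
    ext; simp
  have := LinearIsometry.extend_apply L ⟨η, Submodule.mem_span_singleton_self η⟩
  simp only [LinearIsometry.coe_toLinearIsometryEquiv]
  refine this.trans ?_
  have e' : (LinearIsometryEquiv.toSpanUnitSingleton (𝕜 := ℂ) η h).symm
      ⟨η, Submodule.mem_span_singleton_self η⟩ = 1 := by rw [← e, LinearIsometryEquiv.symm_apply_apply]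
  simp [L, e']

/-- Nonisotropic balls. -/
def qball (a : En n) (δ : ℝ) : Set (En n) := {ζ | qd ζ a < δ}

lemma isOpen_qball (a : En n) (δ : ℝ) : IsOpen (qball a δ) :=
  by
  have : Continuous fun ζ : En n => qd ζ a := by unfold qd; fun_prop
  exact isOpen_lt this continuous_const

lemma qball_mono (a : En n) {δ δ' : ℝ} (h : δ ≤ δ') : qball a δ ⊆ qball a δ' :=
  fun _ hζ => lt_of_lt_of_le hζ h

lemma sigmaS_qball_eq {η η' : En n} (h : ‖η‖ = 1) (h' : ‖η'‖ = 1) (δ : ℝ) :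
    sigmaS n (qball η δ) = sigmaS n (qball η' δ) := by
  obtain ⟨U, hU⟩ := exists_isometry_map_eq h h'
  rw [← (measurePreserving_sigmaS U).measure_preimage (isOpen_qball η' δ).measurableSet.nullMeasurableSet]
  congr 1
  ext ζ
  simp only [qball, qd, mem_preimage, mem_ofPred_eq, ← hU, U.inner_map_map]

/-- The measure of nonisotropic balls of radius `δ` centered on the sphere. -/
def qv (n : ℕ) (δ : ℝ) : ℝ≥0∞ := ⨆ η ∈ Sn n, sigmaS n (qball η δ)

lemma sigmaS_qball {η : En n} (h : ‖η‖ = 1) (δ : ℝ) : sigmaS n (qball η δ) = qv n δ := by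
  refine le_antisymm (le_iSup₂_of_le η (by simpa [Sn] using h) le_rfl) ?_
  exact iSup₂_le fun η' h' => (sigmaS_qball_eq (norm_eq_one_of_mem_Sn h') h δ).le

lemma qv_mono {δ δ' : ℝ} (h : δ ≤ δ') : qv n δ ≤ qv n δ' :=
  iSup₂_mono fun η _ => measure_mono (qball_mono η h)

/-- Doubling property of the nonisotropic balls. -/
lemma exists_qv_doubling (n : ℕ) : ∃ N : ℕ, 1 ≤ N ∧ ∀ δ : ℝ, 0 < δ → qv n (2 * δ) ≤ N * qv n δ := by
  have hK : IsCompact ((closedBall (0 : ℂ) 2) ×ˢ (closedBall (0 : En n) 2)) :=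
    (isCompact_closedBall _ _).prod (isCompact_closedBall _ _)
  obtain ⟨t, -, htf, ht⟩ := hK.finite_cover_balls (e := 1 / 8) (by norm_num)
  refine ⟨htf.toFinset.card + 1, by omega, fun δ hδ => iSup₂_le fun η hη => ?_⟩
  have hη1 := norm_eq_one_of_mem_Sn hη
  have hs : 0 < √δ := Real.sqrt_pos.2 hδ
  have hss : √δ * √δ = δ := Real.mul_self_sqrt hδ.le
  let T : En n → ℂ × En n := fun ζ => ((δ⁻¹ : ℝ) * (inner ℂ η ζ - 1), ((√δ)⁻¹ : ℝ) • perp η ζ)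
  let A : ℂ × En n → Set (En n) := fun x => T ⁻¹' ball x (1 / 8) ∩ Sn n ∩ qball η (2 * δ)
  have hcov : qball η (2 * δ) ∩ Sn n ⊆ ⋃ x ∈ htf.toFinset, A x := by
    rintro ζ ⟨hζ, hζS⟩
    have hζ1 := norm_eq_one_of_mem_Sn hζS
    have hmem : T ζ ∈ (closedBall (0 : ℂ) 2) ×ˢ (closedBall (0 : En n) 2) := by
      have h0 : qd ζ η < 2 * δ := hζ
      constructor
      · simp only [T, mem_closedBall_zero_iff, norm_mul, Complex.norm_real, norm_inv,
          Real.norm_of_nonneg hδ.le]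
        rw [inv_mul_le_iff₀ hδ, norm_sub_rev]; exact (mul_comm δ 2 ▸ h0.le)
      · simp only [T, mem_closedBall_zero_iff, norm_smul, norm_inv, Real.norm_of_nonneg hs.le]
        rw [inv_mul_le_iff₀ hs]
        have := norm_perp_sq_le hη1 hζ1.le
        nlinarith [norm_nonneg (perp η ζ)]
    obtain ⟨x, hx, hxb⟩ := mem_iUnion₂.1 (ht hmem)
    exact mem_iUnion₂.2 ⟨x, htf.mem_toFinset.2 hx, ⟨hxb, hζS⟩, hζ⟩
  have hA : ∀ x, sigmaS n (A x) ≤ qv n δ := by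
    intro x
    rcases (A x).eq_empty_or_nonempty with h | ⟨ω, ⟨hωx, hωS⟩, hω⟩
    · rw [h]; simp
    have hω1 := norm_eq_one_of_mem_Sn hωS
    refine (measure_mono ?_).trans (sigmaS_qball hω1 δ).le
    rintro ζ ⟨⟨hζx, hζS⟩, hζ⟩
    have hζ1 := norm_eq_one_of_mem_Sn hζS
    have hd : dist (T ζ) (T ω) < 1 / 4 := by
      have := dist_triangle_right (T ζ) (T ω) x
      have h1 : dist (T ζ) x < 1 / 8 := hζx
      have h2 : dist (T ω) x < 1 / 8 := hωx
      linarith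
    rw [Prod.dist_eq, max_lt_iff] at hd
    obtain ⟨d1, d2⟩ := hd
    have d1' : ‖inner ℂ η ζ - inner ℂ η ω‖ ≤ δ / 4 := by
      simp only [T, dist_eq_norm, ← mul_sub, norm_mul, Complex.norm_real, norm_inv,
          Real.norm_of_nonneg hδ.le, sub_sub_sub_cancel_right] at d1
      rw [inv_mul_lt_iff₀ hδ] at d1; linarith
    have d2' : ‖perp η ζ - perp η ω‖ ≤ √δ / 4 := by
      simp only [T, dist_eq_norm, ← smul_sub, norm_smul, norm_inv,
          Real.norm_of_nonneg hs.le] at d2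
      rw [inv_mul_lt_iff₀ hs] at d2; linarith
    have d3 : ‖perp η ζ‖ ≤ 2 * √δ := by
      have := norm_perp_sq_le hη1 hζ1.le
      have h0 : qd ζ η < 2 * δ := hζ
      nlinarith [norm_nonneg (perp η ζ)]
    have d4 : ‖inner ℂ η ζ‖ ≤ 1 := by
      have := norm_inner_le_norm (𝕜 := ℂ) η ζ; rw [hη1, one_mul, hζ1] at this; linarith
    show qd ζ ω < δ
    have e : 1 - inner ℂ ω ζ = inner ℂ (ζ - ω) ζ := by
      rw [inner_sub_left, inner_self_eq_norm_sq_to_K, hζ1]; simp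
    have e1 : inner ℂ η (ζ - ω) = inner ℂ η ζ - inner ℂ η ω := inner_sub_right _ _ _
    have e2 : perp η (ζ - ω) = perp η ζ - perp η ω := by
      simp only [perp, inner_sub_right, sub_smul]; abel
    rw [qd, e, inner_eq_add_perp hη1, e1, e2]
    refine (norm_add_le _ _).trans_lt ?_
    have b1 : ‖(starRingEnd ℂ) (inner ℂ η ζ - inner ℂ η ω) * inner ℂ η ζ‖ ≤ δ / 4 := by
      rw [norm_mul, Complex.norm_conj]
      nlinarith [norm_nonneg (inner ℂ η ζ : ℂ), norm_nonneg (inner ℂ η ζ - inner ℂ η ω : ℂ)]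
    have b2 : ‖inner ℂ (perp η ζ - perp η ω) (perp η ζ)‖ ≤ δ / 2 := by
      refine (norm_inner_le_norm _ _).trans ?_
      calc _ ≤ (√δ / 4) * (2 * √δ) := by gcongr
        _ = δ / 2 := by linear_combination (1 / 2) * hss
    linarith
  calc sigmaS n (qball η (2 * δ)) = sigmaS n (qball η (2 * δ) ∩ Sn n) := by
        rw [← Measure.restrict_apply (isOpen_qball _ _).measurableSet, sigmaS_restrict_Sn]
    _ ≤ sigmaS n (⋃ x ∈ htf.toFinset, A x) := measure_mono hcov
    _ ≤ ∑ x ∈ htf.toFinset, sigmaS n (A x) := measure_biUnion_finset_le _ _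
    _ ≤ ∑ x ∈ htf.toFinset, qv n δ := Finset.sum_le_sum fun x _ => hA x
    _ = htf.toFinset.card * qv n δ := by simp
    _ ≤ _ := by gcongr; simp

end Geometry

section Maximal

variable {n : ℕ}

lemma qd_le_two {ζ η : En n} (h : ‖ζ‖ ≤ 1) (h' : ‖η‖ ≤ 1) : qd ζ η ≤ 2 := by
  have := norm_inner_le_norm (𝕜 := ℂ) η ζ
  refine (norm_sub_le _ _).trans ?_
  rw [norm_one]
  nlinarith [norm_nonneg ζ, norm_nonneg η]

lemma one_sub_norm_le_qd {ζ a : En n} (h : ‖ζ‖ ≤ 1) : 1 - ‖a‖ ≤ qd ζ a := by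
  have h1 := norm_inner_le_norm (𝕜 := ℂ) a ζ
  have := norm_sub_norm_le (1 : ℂ) (inner ℂ a ζ)
  rw [norm_one] at this
  show _ ≤ ‖_‖
  nlinarith [norm_nonneg ζ, norm_nonneg a]

lemma qd_le_add_dist {ζ a b : En n} (h : ‖ζ‖ ≤ 1) : qd ζ a ≤ qd ζ b + ‖b - a‖ := by
  have h1 := norm_inner_le_norm (𝕜 := ℂ) (b - a) ζ
  have e : (1 : ℂ) - inner ℂ a ζ = (1 - inner ℂ b ζ) + inner ℂ (b - a) ζ := by
    rw [inner_sub_left]; ring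
  rw [qd, e]
  refine (norm_add_le _ _).trans (add_le_add le_rfl ?_)
  nlinarith [norm_nonneg (b - a)]

lemma measure_inter_Sn (s : Set (En n)) : sigmaS n (s ∩ Sn n) = sigmaS n s := by
  rw [← Measure.restrict_apply' isCompact_Sn.measurableSet, sigmaS_restrict_Sn]

/-- A doubling constant for the nonisotropic balls. -/
def qN (n : ℕ) : ℕ := (exists_qv_doubling n).choose

lemma one_le_qN : 1 ≤ qN n := (exists_qv_doubling n).choose_spec.1

lemma qv_two_mul_le {δ : ℝ} (h : 0 < δ) : qv n (2 * δ) ≤ qN n * qv n δ :=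
  (exists_qv_doubling n).choose_spec.2 δ h

lemma qv_two_pow_mul_le {δ : ℝ} (h : 0 < δ) (k : ℕ) : qv n (2 ^ k * δ) ≤ qN n ^ k * qv n δ := by
  induction k with
  | zero => simp
  | succ k ih =>
    calc qv n (2 ^ (k + 1) * δ) = qv n (2 * (2 ^ k * δ)) := by ring_nf
      _ ≤ qN n * qv n (2 ^ k * δ) := qv_two_mul_le (by positivity)
      _ ≤ qN n * (qN n ^ k * qv n δ) := by gcongr
      _ = _ := by ring

/-- The (uncentered) Hardy-Littlewood maximal function on the sphere. -/
def hlM (w : En n → ℝ≥0∞) (ζ : En n) : ℝ≥0∞ :=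
  ⨆ b : {b : En n × ℝ // b.1 ∈ Sn n ∧ 0 < b.2 ∧ b.2 ≤ 4 ∧ ζ ∈ qball b.1 b.2},
    (∫⁻ x in qball b.1.1 b.1.2, w x ∂(sigmaS n)) / qv n b.1.2

lemma isOpen_lt_hlM (w : En n → ℝ≥0∞) (c : ℝ≥0∞) : IsOpen {ζ | c < hlM w ζ} := by
  rw [isOpen_iff_mem_nhds]
  intro ζ hζ
  obtain ⟨⟨b, h1, h2, h3, h4⟩, hb⟩ := lt_iSup_iff.1 (show c < hlM w ζ from hζ)
  filter_upwards [(isOpen_qball b.1 b.2).mem_nhds h4] with ω hω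
  exact lt_iSup_iff.2 ⟨⟨b, h1, h2, h3, hω⟩, hb⟩

lemma measurable_hlM (w : En n → ℝ≥0∞) : Measurable (hlM w) :=
  measurable_of_Ioi fun c => (isOpen_lt_hlM w c).measurableSet

variable [IsProbabilityMeasure (sigmaS n)]

lemma Sn_nonempty : (Sn n).Nonempty := by
  by_contra h
  rw [not_nonempty_iff_eq_empty] at h
  have := ae_mem_Sn n
  simp only [h, mem_empty_iff_false] at this
  exact (NeZero.ne (sigmaS n)) (ae_eq_bot.1 (by simp [Filter.Eventually] at this))

lemma exists_unit_direction (a : En n) (ha : ‖a‖ ≤ 1) : ∃ η : En n, ‖η‖ = 1 ∧ (‖a‖ : ℂ) • η = a ∧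
    ‖η - a‖ = 1 - ‖a‖ := by
  obtain ⟨η, h1, h2⟩ : ∃ η : En n, ‖η‖ = 1 ∧ (‖a‖ : ℂ) • η = a := by
    rcases eq_or_ne a 0 with rfl | h
    · obtain ⟨η, hη⟩ := Sn_nonempty (n := n)
      exact ⟨η, norm_eq_one_of_mem_Sn hη, by simp⟩
    · have : (‖a‖ : ℂ) ≠ 0 := by simpa using h
      refine ⟨(‖a‖ : ℂ)⁻¹ • a, ?_, ?_⟩
      · rw [norm_smul]; simp [h]
      · rw [smul_smul, mul_inv_cancel₀ this, one_smul]
  refine ⟨η, h1, h2, ?_⟩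
  have : η - a = ((1 - ‖a‖ : ℝ) : ℂ) • η := by
    conv_lhs => rw [← h2]
    rw [Complex.ofReal_sub, sub_smul]; simp
  rw [this, norm_smul, h1, mul_one, Complex.norm_real, Real.norm_of_nonneg (by linarith)]

lemma qv_le_one (δ : ℝ) : qv n δ ≤ 1 := iSup₂_le fun _ _ => prob_le_one

lemma qv_eq_one {δ : ℝ} (h : 2 < δ) : qv n δ = 1 := by
  obtain ⟨η, hη⟩ := Sn_nonempty (n := n)
  have h1 := norm_eq_one_of_mem_Sn hη
  refine le_antisymm (qv_le_one δ) ?_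
  rw [← sigmaS_qball h1 δ, ← measure_univ (μ := sigmaS n), ← measure_inter_Sn univ]
  refine measure_mono fun ζ hζ => ?_
  exact (qd_le_two (norm_eq_one_of_mem_Sn hζ.2).le h1.le).trans_lt h

lemma qv_pos {δ : ℝ} (h : 0 < δ) : 0 < qv n δ := by
  obtain ⟨k, hk⟩ := pow_unbounded_of_one_lt (2 / δ) one_lt_two
  have h1 := qv_two_pow_mul_le (n := n) h k
  rw [qv_eq_one (by rwa [div_lt_iff₀ h] at hk)] at h1
  by_contra h0
  rw [nonpos_iff_eq_zero.1 (not_lt.1 h0), mul_zero] at h1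
  exact absurd h1 (by simp)

lemma qv_ne_top {δ : ℝ} : qv n δ ≠ ⊤ := ((qv_le_one δ).trans_lt ENNReal.one_lt_top).ne

lemma lintegral_qball_le {w : En n → ℝ≥0∞} {η ζ : En n} {δ : ℝ} (hη : ‖η‖ = 1) (hδ : 0 < δ)
    (hζ : ‖ζ‖ = 1) (h : ζ ∈ qball η δ) :
    ∫⁻ x in qball η δ, w x ∂(sigmaS n) ≤ qv n δ * hlM w ζ := by
  have key : ∀ δ, 0 < δ → δ ≤ 4 → ζ ∈ qball η δ →
      ∫⁻ x in qball η δ, w x ∂(sigmaS n) ≤ qv n δ * hlM w ζ := by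
    intro δ hδ h4 h
    rw [mul_comm, ← ENNReal.div_le_iff (qv_pos hδ).ne' qv_ne_top]
    exact le_iSup (fun b : {b : En n × ℝ // b.1 ∈ Sn n ∧ 0 < b.2 ∧ b.2 ≤ 4 ∧ ζ ∈ qball b.1 b.2} =>
      (∫⁻ x in qball b.1.1 b.1.2, w x ∂(sigmaS n)) / qv n b.1.2)
      ⟨(η, δ), by simpa [Sn] using hη, hδ, h4, h⟩
  rcases le_or_gt δ 4 with h4 | h4
  · exact key δ hδ h4 h
  have hz : ζ ∈ qball η 4 := (qd_le_two hζ.le hη.le).trans_lt (by norm_num)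
  have := key 4 (by norm_num) le_rfl hz
  rw [qv_eq_one (by norm_num)] at this
  rw [qv_eq_one (by linarith)]
  refine le_trans ?_ this
  have e : (sigmaS n).restrict (qball η 4) = sigmaS n :=
    Measure.restrict_eq_self_of_ae_mem ((ae_mem_Sn n).mono fun x hx =>
      (qd_le_two (norm_eq_one_of_mem_Sn hx).le hη.le).trans_lt (by norm_num))
  rw [e]
  exact setLIntegral_le_lintegral _ _

lemma hlM_le {w : En n → ℝ≥0∞} {K : ℝ≥0∞} (h : ∀ ζ, w ζ ≤ K) (ζ : En n) : hlM w ζ ≤ K := by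
  refine iSup_le fun ⟨b, h1, h2, h3, h4⟩ => ?_
  rw [ENNReal.div_le_iff (qv_pos h2).ne' qv_ne_top, ← sigmaS_qball (norm_eq_one_of_mem_Sn h1),
    ← setLIntegral_const]
  exact lintegral_mono h

/-- The weak type (1,1) inequality. -/
lemma hlM_weak (w : En n → ℝ≥0∞) (c : ℝ≥0∞) :
    c * sigmaS n {ζ | c < hlM w ζ} ≤ qN n ^ 5 * ∫⁻ ζ, w ζ ∂(sigmaS n) := by
  let B : En n × ℝ → Set (En n) := fun b => qball b.1 b.2 ∩ Sn n
  let t : Set (En n × ℝ) := {b | b.1 ∈ Sn n ∧ 0 < b.2 ∧ b.2 ≤ 4 ∧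
    c * qv n b.2 ≤ ∫⁻ x in qball b.1 b.2, w x ∂(sigmaS n)}
  have hmemB : ∀ b ∈ t, b.1 ∈ B b := by
    intro b hb
    refine ⟨?_, hb.1⟩
    show ‖_‖ < b.2
    rw [inner_self_eq_norm_sq_to_K, norm_eq_one_of_mem_Sn hb.1]
    simpa using hb.2.1
  obtain ⟨u, hut, hdis, hcov⟩ := Vitali.exists_disjoint_subfamily_covering_enlargement B t
    (fun b => b.2) 2 one_lt_two (fun b hb => hb.2.1.le) 4 (fun b hb => hb.2.2.1)
    (fun b hb => ⟨_, hmemB b hb⟩)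
  have hBm : ∀ b, MeasurableSet (B b) := fun b =>
    (isOpen_qball _ _).measurableSet.inter isCompact_Sn.measurableSet
  have hBq : ∀ b ∈ u, sigmaS n (B b) = qv n b.2 := fun b hb => by
    rw [measure_inter_Sn, sigmaS_qball (norm_eq_one_of_mem_Sn (hut hb).1)]
  have hu : u.Countable := by
    have h := Measure.countable_meas_pos_of_disjoint_iUnion (μ := sigmaS n)
      (As := fun b : u => B b.1) (fun b => hBm _) (fun b b' hbb => hdis b.2 b'.2 (by simpa [Subtype.ext_iff] using hbb))
    have e : {b : u | 0 < sigmaS n (B b.1)} = univ :=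
      eq_univ_of_forall fun b => by
        show 0 < sigmaS n (B b.1)
        rw [hBq b b.2]; exact qv_pos (hut b.2).2.1
    rw [e, countable_univ_iff] at h
    exact h
  have hsub : {ζ | c < hlM w ζ} ∩ Sn n ⊆ ⋃ b ∈ u, qball b.1 (2 ^ 5 * b.2) := by
    rintro ζ ⟨hζ, hζS⟩
    obtain ⟨⟨a, h1, h2, h3, h4⟩, hb⟩ := lt_iSup_iff.1 (show c < hlM w ζ from hζ)
    have hat : a ∈ t := ⟨h1, h2, h3,
      (ENNReal.mul_lt_of_lt_div hb).le⟩
    obtain ⟨b, hbu, ⟨x, hxa, hxb⟩, hab⟩ := hcov a hat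
    refine mem_iUnion₂.2 ⟨b, hbu, ?_⟩
    have n1 := norm_eq_one_of_mem_Sn hζS
    have n2 := norm_eq_one_of_mem_Sn hxa.2
    have n3 := norm_eq_one_of_mem_Sn h1
    have n4 := norm_eq_one_of_mem_Sn (hut hbu).1
    have d1 := qd_triangle n2 n1.le n4.le
    have d2 := qd_triangle n3 n1.le n2.le
    have d3 : qd ζ a.1 < a.2 := h4
    have d4 : qd x a.1 < a.2 := hxa.1
    have d5 : qd x b.1 < b.2 := hxb.1
    rw [qd_comm a.1 x] at d2
    show qd ζ b.1 < 2 ^ 5 * b.2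
    have := (hut hbu).2.1
    linarith
  have := hu.to_subtype
  calc c * sigmaS n {ζ | c < hlM w ζ} = c * sigmaS n ({ζ | c < hlM w ζ} ∩ Sn n) := by
        rw [measure_inter_Sn]
    _ ≤ c * ∑' b : u, sigmaS n (qball b.1.1 (2 ^ 5 * b.1.2)) := by
        gcongr
        exact (measure_mono hsub).trans (measure_biUnion_le _ hu _)
    _ ≤ c * ∑' b : u, qN n ^ 5 * qv n b.1.2 := by
        gcongr with b
        rw [sigmaS_qball (norm_eq_one_of_mem_Sn (hut b.2).1)]
        exact qv_two_pow_mul_le (hut b.2).2.1 5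
    _ = qN n ^ 5 * ∑' b : u, c * qv n b.1.2 := by
        rw [ENNReal.tsum_mul_left, ENNReal.tsum_mul_left]; ring
    _ ≤ qN n ^ 5 * ∑' b : u, ∫⁻ x in B b.1, w x ∂(sigmaS n) := by
        gcongr with b
        refine (hut b.2).2.2.2.trans (le_of_eq ?_)
        rw [← Measure.restrict_restrict (isOpen_qball _ _).measurableSet, sigmaS_restrict_Sn]
    _ = qN n ^ 5 * ∫⁻ x in ⋃ b ∈ u, B b, w x ∂(sigmaS n) := by
        rw [lintegral_biUnion hu (fun b _ => hBm b) hdis]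
    _ ≤ _ := mul_le_mul_right (setLIntegral_le_lintegral _ _) _

end Maximal

section StrongType

variable {n : ℕ} [IsProbabilityMeasure (sigmaS n)]

/-- Weak type inequality for the part of `w` above the level. -/
lemma hlM_weak_truncated {w : En n → ℝ≥0∞} (hw : Measurable w) {c : ℝ≥0∞} :
    c * sigmaS n {ζ | 2 * c < hlM w ζ} ≤ qN n ^ 5 * ∫⁻ ζ in {ζ | c < w ζ}, w ζ ∂(sigmaS n) := by
  have hm : MeasurableSet {ζ | c < w ζ} := measurableSet_lt measurable_const hw
  rw [← lintegral_indicator hm]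
  refine le_trans (mul_le_mul_right (measure_mono ?_) _) (hlM_weak _ c)
  intro ζ hζ
  obtain ⟨⟨b, h1, h2, h3, h4⟩, hb⟩ := lt_iSup_iff.1 (show 2 * c < hlM w ζ from hζ)
  show c < hlM (indicator {ζ | c < w ζ} w) ζ
  refine lt_iSup_iff.2 ⟨⟨b, h1, h2, h3, h4⟩, ?_⟩
  rw [ENNReal.lt_div_iff_mul_lt (Or.inl (qv_pos h2).ne') (Or.inl qv_ne_top)] at hb ⊢
  have hc : c ≠ ⊤ := by
    rintro rfl
    simp at hζ
  have key : ∫⁻ x in qball b.1 b.2, w x ∂(sigmaS n) ≤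
      ∫⁻ x in qball b.1 b.2, indicator {ζ | c < w ζ} w x ∂(sigmaS n) + c * qv n b.2 := by
    rw [← sigmaS_qball (norm_eq_one_of_mem_Sn h1), ← setLIntegral_const,
      ← lintegral_add_right _ measurable_const]
    refine lintegral_mono fun x => ?_
    by_cases hx : c < w x
    · simp [indicator, hx]
    · simp only [indicator, mem_ofPred_eq, hx, if_false, zero_add]; exact not_lt.1 hx
  have h5 := hb.trans_le key
  have h6 : c * qv n b.2 ≠ ⊤ := ENNReal.mul_ne_top hc qv_ne_top
  rw [two_mul, add_mul] at h5
  exact lt_of_add_lt_add_right h5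

/-- The strong type `(t,t)` inequality. -/
lemma exists_hlM_strong (n : ℕ) [IsProbabilityMeasure (sigmaS n)] {t : ℝ} (ht : 1 < t) :
    ∃ C : ℝ≥0∞, C ≠ ⊤ ∧ ∀ w : En n → ℝ≥0∞, Measurable w → ∀ K : ℝ≥0, (∀ ζ, w ζ ≤ K) →
      ∫⁻ ζ, hlM w ζ ^ t ∂(sigmaS n) ≤ C * ∫⁻ ζ, w ζ ^ t ∂(sigmaS n) := by
  refine ⟨ENNReal.ofReal t * (2 * qN n ^ 5) * ENNReal.ofReal (2 ^ (t - 1) / (t - 1)),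
    by finiteness, fun w hw K hK => ?_⟩
  have hM : ∀ ζ, hlM w ζ ≠ ⊤ := fun ζ => ((hlM_le hK ζ).trans_lt ENNReal.coe_lt_top).ne
  have hwt : ∀ ζ, w ζ ≠ ⊤ := fun ζ => ((hK ζ).trans_lt ENNReal.coe_lt_top).ne
  have e1 : ∫⁻ ζ, hlM w ζ ^ t ∂(sigmaS n) =
      ∫⁻ ζ, ENNReal.ofReal ((hlM w ζ).toReal ^ t) ∂(sigmaS n) := by
    refine lintegral_congr fun ζ => ?_
    rw [← ENNReal.ofReal_rpow_of_nonneg ENNReal.toReal_nonneg (by linarith), ENNReal.ofReal_toReal (hM ζ)]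
  rw [e1, lintegral_rpow_eq_lintegral_meas_lt_mul _ (Eventually.of_forall fun _ => ENNReal.toReal_nonneg)
    (measurable_hlM w).ennreal_toReal.aemeasurable (by linarith), mul_assoc, mul_assoc]
  gcongr
  have key : ∀ l ∈ Ioi (0 : ℝ), sigmaS n {a | l < (hlM w a).toReal} * ENNReal.ofReal (l ^ (t - 1)) ≤
      2 * qN n ^ 5 * ∫⁻ ζ, w ζ * (Iio (2 * (w ζ).toReal)).indicator (fun l => ENNReal.ofReal (l ^ (t - 2))) l ∂(sigmaS n) := by
    intro l hl
    have hl : 0 < l := hl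
    have h1 := hlM_weak_truncated hw (c := ENNReal.ofReal (l / 2))
    have e2 : {ζ | 2 * ENNReal.ofReal (l / 2) < hlM w ζ} = {a | l < (hlM w a).toReal} := by
      ext ζ
      have : 2 * ENNReal.ofReal (l / 2) = ENNReal.ofReal l := by
        rw [show (2 : ℝ≥0∞) = ENNReal.ofReal 2 by simp, ← ENNReal.ofReal_mul (by norm_num)]
        congr 1; ring
      simp only [mem_ofPred_eq, this]
      rw [ENNReal.ofReal_lt_iff_lt_toReal hl.le (hM ζ)]
    rw [e2] at h1
    have e3 : ENNReal.ofReal (l ^ (t - 1)) = 2 * (ENNReal.ofReal (l / 2) * ENNReal.ofReal (l ^ (t - 2))) := by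
      rw [show (2 : ℝ≥0∞) = ENNReal.ofReal 2 by simp, ← ENNReal.ofReal_mul (by positivity),
        ← ENNReal.ofReal_mul (by positivity)]
      congr 1
      rw [show t - 1 = 1 + (t - 2) by ring, Real.rpow_add hl, Real.rpow_one]; ring
    have e4 : ∫⁻ ζ, w ζ * (Iio (2 * (w ζ).toReal)).indicator (fun l => ENNReal.ofReal (l ^ (t - 2))) l ∂(sigmaS n)
        = (∫⁻ ζ in {ζ | ENNReal.ofReal (l / 2) < w ζ}, w ζ ∂(sigmaS n)) * ENNReal.ofReal (l ^ (t - 2)) := by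
      rw [← lintegral_indicator (measurableSet_lt measurable_const hw),
        ← lintegral_mul_const' _ _ ENNReal.ofReal_ne_top]
      refine lintegral_congr fun ζ => ?_
      have : (l ∈ Iio (2 * (w ζ).toReal)) ↔ ENNReal.ofReal (l / 2) < w ζ := by
        rw [ENNReal.ofReal_lt_iff_lt_toReal (by positivity) (hwt ζ), mem_Iio, div_lt_iff₀ two_pos, mul_comm]
      by_cases h : ENNReal.ofReal (l / 2) < w ζ
      · rw [indicator_of_mem (this.2 h), indicator_of_mem (show ζ ∈ {ζ | ENNReal.ofReal (l / 2) < w ζ} from h)]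
      · rw [indicator_of_notMem (fun h' => h (this.1 h')),
          indicator_of_notMem (show ζ ∉ {ζ | ENNReal.ofReal (l / 2) < w ζ} from h)]
        simp
    rw [e3, e4]
    calc _ = 2 * ENNReal.ofReal (l ^ (t - 2)) *
          (ENNReal.ofReal (l / 2) * sigmaS n {a | l < (hlM w a).toReal}) := by ring
      _ ≤ 2 * ENNReal.ofReal (l ^ (t - 2)) *
          (qN n ^ 5 * ∫⁻ ζ in {ζ | ENNReal.ofReal (l / 2) < w ζ}, w ζ ∂(sigmaS n)) := by gcongr
      _ = _ := by ring
  refine (setLIntegral_mono' measurableSet_Ioi key).trans ?_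
  rw [lintegral_const_mul' _ _ (by finiteness)]
  gcongr
  rw [lintegral_lintegral_swap]
  · rw [← lintegral_const_mul' _ _ (by finiteness)]
    refine lintegral_mono fun ζ => ?_
    simp only
    rw [lintegral_const_mul' _ _ (hwt ζ), lintegral_indicator measurableSet_Iio,
      Measure.restrict_restrict measurableSet_Iio, Iio_inter_Ioi]
    rcases eq_or_ne (w ζ) 0 with h0 | h0
    · simp [h0]
    have hp : 0 < (w ζ).toReal := ENNReal.toReal_pos h0 (hwt ζ)
    have : ∫⁻ l in Ioo 0 (2 * (w ζ).toReal), ENNReal.ofReal (l ^ (t - 2)) =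
        ENNReal.ofReal ((2 * (w ζ).toReal) ^ (t - 1) / (t - 1)) := by
      have hi := intervalIntegral.intervalIntegrable_rpow' (a := 0) (b := 2 * (w ζ).toReal)
        (show -1 < t - 2 by linarith)
      rw [intervalIntegrable_iff_integrableOn_Ioo_of_le (by positivity)] at hi
      rw [← ofReal_integral_eq_lintegral_ofReal hi
        ((ae_restrict_mem measurableSet_Ioo).mono fun l hl => Real.rpow_nonneg hl.1.le _),
        ← integral_Ioc_eq_integral_Ioo, ← intervalIntegral.integral_of_le (by positivity),
        integral_rpow (Or.inl (by linarith))]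
      congr 1
      rw [show t - 2 + 1 = t - 1 by ring, Real.zero_rpow (by linarith), sub_zero]
    rw [this]
    have e : w ζ ^ t = w ζ * ENNReal.ofReal ((w ζ).toReal ^ (t - 1)) := by
      rw [← ENNReal.ofReal_rpow_of_pos hp, ENNReal.ofReal_toReal (hwt ζ)]
      nth_rewrite 2 [← ENNReal.rpow_one (w ζ)]
      rw [← ENNReal.rpow_add _ _ h0 (hwt ζ)]; congr 1; ring
    rw [e, Real.mul_rpow (by norm_num) hp.le]
    have : ENNReal.ofReal (2 ^ (t - 1) * (w ζ).toReal ^ (t - 1) / (t - 1)) =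
        ENNReal.ofReal (2 ^ (t - 1) / (t - 1)) * ENNReal.ofReal ((w ζ).toReal ^ (t - 1)) := by
      rw [← ENNReal.ofReal_mul (div_nonneg (by positivity) (by linarith))]; congr 1; ring
    rw [this]
    exact le_of_eq (by ring)
  · have : Measurable fun x : ℝ × En n => w x.2 * (Iio (2 * (w x.2).toReal)).indicator
        (fun l => ENNReal.ofReal (l ^ (t - 2))) x.1 := by
      refine (hw.comp measurable_snd).mul ?_
      have hs : MeasurableSet {x : ℝ × En n | x.1 < 2 * (w x.2).toReal} :=
        measurableSet_lt measurable_fst (((hw.comp measurable_snd).ennreal_toReal).const_mul 2)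
      have := (show Measurable fun x : ℝ × En n => ENNReal.ofReal (x.1 ^ (t - 2)) by fun_prop).indicator hs
      exact this
    exact this.aemeasurable

/-- Tail estimate for the kernels in terms of the maximal function. -/
lemma lintegral_kernel_mul_le {a : En n} (ha : ‖a‖ < 1) {γ : ℝ} (hγ0 : 0 ≤ γ) (hγ : 2 * (qN n : ℝ) ≤ 2 ^ γ)
    {w : En n → ℝ≥0∞} (hw : Measurable w) {ζ₀ : En n} (h₀ : ‖ζ₀‖ = 1)
    (hζ : ζ₀ ∈ qball a (2 * (1 - ‖a‖))) :
    ∫⁻ ζ, ENNReal.ofReal (((1 - ‖a‖) / qd ζ a) ^ γ) * w ζ ∂(sigmaS n) ≤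
      2 * qN n ^ 2 * qv n (1 - ‖a‖) * hlM w ζ₀ := by
  set ℓ := 1 - ‖a‖ with hℓ
  have hℓ0 : 0 < ℓ := by linarith
  obtain ⟨η, hη1, -, hη2⟩ := exists_unit_direction a ha.le
  have hN : (1 : ℝ) ≤ qN n := by exact_mod_cast one_le_qN
  have hN0 : (qN n : ℝ≥0∞) ≠ 0 := by
    have := one_le_qN (n := n); simp; omega
  have hpt : ∀ ζ ∈ Sn n, ENNReal.ofReal ((ℓ / qd ζ a) ^ γ) * w ζ ≤
      ∑' j : ℕ, ((2 * qN n : ℝ≥0∞)⁻¹) ^ j * (qball η (2 ^ (j + 2) * ℓ)).indicator w ζ := by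
    intro ζ hζS
    have hz1 := norm_eq_one_of_mem_Sn hζS
    have hD : ℓ ≤ qd ζ a := one_sub_norm_le_qd hz1.le
    have hD0 : 0 < qd ζ a := by linarith
    obtain ⟨j, hj1, hj2⟩ := exists_nat_pow_near (one_le_div hℓ0 |>.2 hD) one_lt_two
    rw [le_div_iff₀ hℓ0] at hj1
    rw [div_lt_iff₀ hℓ0] at hj2
    refine le_trans ?_ (ENNReal.le_tsum j)
    have hmem : ζ ∈ qball η (2 ^ (j + 2) * ℓ) := by
      have := qd_le_add_dist (a := η) (b := a) hz1.le
      rw [norm_sub_rev, hη2] at this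
      show qd ζ η < _
      have : (1 : ℝ) ≤ 2 ^ (j + 1) := one_le_pow₀ (by norm_num)
      rw [pow_succ]
      nlinarith
    rw [indicator_of_mem hmem]
    gcongr
    have h1 : (ℓ / qd ζ a) ^ γ ≤ ((2 * (qN n : ℝ))⁻¹) ^ j := by
      calc (ℓ / qd ζ a) ^ γ ≤ ((2 ^ j : ℝ)⁻¹) ^ γ := by
            apply Real.rpow_le_rpow (by positivity) _ hγ0
            rw [div_le_iff₀ hD0, le_inv_mul_iff₀ (by positivity)]; exact hj1
        _ = ((2 ^ γ)⁻¹) ^ j := by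
            rw [Real.inv_rpow (by positivity), ← Real.rpow_natCast, ← Real.rpow_mul (by norm_num),
              inv_pow, ← Real.rpow_natCast, ← Real.rpow_mul (by norm_num), mul_comm]
        _ ≤ _ := by gcongr
    refine (ENNReal.ofReal_le_ofReal h1).trans (le_of_eq ?_)
    rw [ENNReal.ofReal_pow (by positivity), ENNReal.ofReal_inv_of_pos (by positivity),
      ENNReal.ofReal_mul (by norm_num)]
    simp
  have hζ' : ∀ j : ℕ, ζ₀ ∈ qball η (2 ^ (j + 2) * ℓ) := by
    intro j
    have h1 := qd_le_add_dist (a := η) (b := a) h₀.le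
    rw [norm_sub_rev, hη2] at h1
    have h2 : qd ζ₀ a < 2 * ℓ := hζ
    have : (1 : ℝ) ≤ 2 ^ j := one_le_pow₀ (by norm_num)
    show qd ζ₀ η < _
    rw [pow_add]
    nlinarith
  calc _ ≤ ∫⁻ ζ, ∑' j : ℕ, ((2 * qN n : ℝ≥0∞)⁻¹) ^ j * (qball η (2 ^ (j + 2) * ℓ)).indicator w ζ ∂(sigmaS n) :=
        lintegral_mono_ae ((ae_mem_Sn n).mono hpt)
    _ = ∑' j : ℕ, ((2 * qN n : ℝ≥0∞)⁻¹) ^ j * ∫⁻ ζ in qball η (2 ^ (j + 2) * ℓ), w ζ ∂(sigmaS n) := by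
        rw [lintegral_tsum fun j => ((hw.indicator (isOpen_qball _ _).measurableSet).const_mul _).aemeasurable]
        congr 1; funext j
        rw [lintegral_const_mul _ (hw.indicator (isOpen_qball _ _).measurableSet),
          lintegral_indicator (isOpen_qball _ _).measurableSet]
    _ ≤ ∑' j : ℕ, (2⁻¹ : ℝ≥0∞) ^ j * (qN n ^ 2 * qv n ℓ * hlM w ζ₀) := by
        refine ENNReal.tsum_le_tsum fun j => ?_
        calc _ ≤ ((2 * qN n : ℝ≥0∞)⁻¹) ^ j * ((qN n ^ (j + 2) * qv n ℓ) * hlM w ζ₀) := by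
              gcongr
              refine (lintegral_qball_le hη1 (by positivity) h₀ (hζ' j)).trans ?_
              gcongr
              exact qv_two_pow_mul_le hℓ0 _
          _ = (2⁻¹ : ℝ≥0∞) ^ j * (((qN n : ℝ≥0∞)⁻¹ * qN n) ^ j) * (qN n ^ 2 * qv n ℓ * hlM w ζ₀) := by
              rw [ENNReal.mul_inv (by simp) (by simp)]; ring
          _ = _ := by rw [ENNReal.inv_mul_cancel hN0 (by simp), one_pow, mul_one]
    _ = _ := by
        rw [ENNReal.tsum_mul_right, ENNReal.tsum_geometric_two]; ring

end StrongType

section DiscPointEvaluation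

lemma lintegral_eq_lintegral_circleMap {F : ℂ → ℝ≥0∞} (hF : Measurable F) :
    ∫⁻ w, F w = ∫⁻ t in Ioi (0 : ℝ), ENNReal.ofReal t *
      ∫⁻ θ in Ioo (-Real.pi) Real.pi, F (circleMap 0 t θ) := by
  have hm : Measurable fun p : ℝ × ℝ => F (circleMap 0 p.1 p.2) :=
    hF.comp (by unfold circleMap; fun_prop)
  have e : ∀ p : ℝ × ℝ, Complex.polarCoord.symm p = circleMap 0 p.1 p.2 := fun p => by
    simp [circleMap, Complex.exp_mul_I]
  have hm2 : Measurable fun p : ℝ × ℝ => ENNReal.ofReal p.1 * F (circleMap 0 p.1 p.2) :=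
    (ENNReal.measurable_ofReal.comp measurable_fst).mul hm
  simp only [← Complex.lintegral_comp_polarCoord_symm, polarCoord_target, Measure.volume_eq_prod,
    e, smul_eq_mul]
  rw [← Measure.prod_restrict, lintegral_prod _ hm2.aemeasurable]
  refine lintegral_congr fun t => ?_
  dsimp only
  exact lintegral_const_mul (f := fun θ => F (circleMap 0 t θ)) _ (hF.comp (continuous_circleMap 0 t).measurable)

lemma lintegral_circleMap_eq {φ : ℂ → ℝ} {t : ℝ} (hc : Continuous fun θ : ℝ => φ (circleMap 0 t θ))
    (h0 : ∀ z, 0 ≤ φ z) :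
    ∫⁻ θ in Ioo (-Real.pi) Real.pi, ENNReal.ofReal (φ (circleMap 0 t θ)) =
      ENNReal.ofReal (2 * Real.pi * Real.circleAverage φ 0 t) := by
  have hπ := Real.pi_pos
  rw [← ofReal_integral_eq_lintegral_ofReal]
  · congr 1
    rw [← integral_Ioc_eq_integral_Ioo, ← intervalIntegral.integral_of_le (by linarith),
      Real.circleAverage, smul_eq_mul, mul_inv_cancel_left₀ (by positivity)]
    have hp : Function.Periodic (fun θ => φ (circleMap 0 t θ)) (2 * Real.pi) := fun x => by
      simp [periodic_circleMap 0 t x]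
    have := hp.intervalIntegral_add_eq (-Real.pi) 0
    rw [zero_add, show -Real.pi + 2 * Real.pi = Real.pi by ring] at this
    exact this
  · exact (hc.integrableOn_Icc (a := -Real.pi) (b := Real.pi)).mono_set Ioo_subset_Icc_self
  · exact Eventually.of_forall fun θ => h0 _

/-- Point evaluation on the unit disc. -/
lemma mul_norm_rpow_le_circleAverage {H : ℂ → ℂ} {ρ : ℝ} (hρ : 1 < ρ)
    (hH : DifferentiableOn ℂ H (ball 0 ρ)) {s : ℝ} (hs : 0 < s) {d : ℝ} (hd : 0 < d) {z : ℂ}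
    (hz : ‖z‖ ≤ 1 - d) :
    d * ‖H z‖ ^ s ≤ 4 * Real.circleAverage (fun w => ‖H w‖ ^ s) 0 1 := by
  have hπ := Real.pi_pos
  set m := Real.circleAverage (fun w => ‖H w‖ ^ s) 0 1 with hm
  have hcont : ContinuousOn (fun w => ‖H w‖ ^ s) (ball 0 ρ) :=
    hH.continuousOn.norm.rpow_const fun _ _ => Or.inr hs.le
  set G : ℂ → ℝ≥0∞ := (ball z d).indicator fun w => ENNReal.ofReal (‖H w‖ ^ s) with hG
  have hsub : ball z d ⊆ ball 0 1 := fun w hw => by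
    rw [mem_ball_iff_norm] at hw
    rw [mem_ball_zero_iff]
    calc ‖w‖ = ‖(w - z) + z‖ := by rw [sub_add_cancel]
      _ ≤ ‖w - z‖ + ‖z‖ := norm_add_le _ _
      _ < 1 := by linarith
  have hsub' : ball (0 : ℂ) 1 ⊆ ball 0 ρ := ball_subset_ball hρ.le
  have hGm : Measurable G := by
    have h1 : ContinuousOn (fun w => ENNReal.ofReal (‖H w‖ ^ s)) (ball z d) :=
      ENNReal.continuous_ofReal.comp_continuousOn (hcont.mono (hsub.trans hsub'))
    classical
    have := h1.measurable_piecewise (g := 0) continuousOn_const measurableSet_ball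
    rwa [Set.piecewise_eq_indicator] at this
  have hm0 : 0 ≤ m := by
    have := circleAverage_norm_rpow_mono hH hs le_rfl zero_le_one hρ
    rw [Real.circleAverage_zero] at this
    exact le_trans (by positivity) this
  have lower : ENNReal.ofReal (d ^ 2 / 2 * (2 * Real.pi * ‖H z‖ ^ s)) ≤ ∫⁻ w, G w := by
    rw [← lintegral_add_left_eq_self G z, lintegral_eq_lintegral_circleMap (by fun_prop)]
    have e : ∫⁻ t in Ioo 0 d, ENNReal.ofReal t = ENNReal.ofReal (d ^ 2 / 2) := by
      rw [← ofReal_integral_eq_lintegral_ofReal]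
      · rw [← integral_Ioc_eq_integral_Ioo, ← intervalIntegral.integral_of_le hd.le, integral_id]
        congr 1; ring
      · exact (continuous_id.integrableOn_Icc (a := 0) (b := d)).mono_set Ioo_subset_Icc_self
      · exact (ae_restrict_mem measurableSet_Ioo).mono fun t ht => ht.1.le
    rw [ENNReal.ofReal_mul (by positivity), ← e, ← lintegral_mul_const _ (by fun_prop)]
    refine le_trans ?_ (lintegral_mono_set ((fun _ h => h.1 : Ioo (0:ℝ) d ⊆ Ioi 0)))
    refine setLIntegral_mono' measurableSet_Ioo fun t ht => ?_
    gcongr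
    have hH2 : DifferentiableOn ℂ (fun w => H (z + w)) (ball 0 (d + (ρ - 1))) := by
      refine hH.comp (by fun_prop) fun w hw => ?_
      rw [mem_ball_zero_iff] at hw ⊢
      have := norm_add_le z w
      linarith
    have hc2 := (continuous_comp_circleMap hH2.continuousOn ht.1.le (by linarith [ht.2])).norm.rpow_const
      fun _ => Or.inr hs.le
    have := circleAverage_norm_rpow_mono hH2 hs le_rfl ht.1.le (by linarith [ht.2])
    rw [Real.circleAverage_zero, add_zero] at this
    have e2 : ∀ θ, G (z + circleMap 0 t θ) = ENNReal.ofReal (‖H (z + circleMap 0 t θ)‖ ^ s) := by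
      intro θ
      rw [hG, indicator_of_mem]
      rw [mem_ball_iff_norm, add_sub_cancel_left, norm_circleMap_zero, abs_of_pos ht.1]
      exact ht.2
    simp only [e2]
    rw [lintegral_circleMap_eq (φ := fun w => ‖H (z + w)‖ ^ s) hc2 (fun _ => by positivity)]
    gcongr
  have upper : ∫⁻ w, G w ≤ ENNReal.ofReal (2 * d * (2 * Real.pi * m)) := by
    rw [lintegral_eq_lintegral_circleMap hGm]
    calc _ ≤ ∫⁻ t in Ioi (0:ℝ), (Ioo (‖z‖ - d) (‖z‖ + d)).indicator
          (fun _ => ENNReal.ofReal (2 * Real.pi * m)) t := ?_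
      _ ≤ ∫⁻ t, (Ioo (‖z‖ - d) (‖z‖ + d)).indicator
          (fun _ => ENNReal.ofReal (2 * Real.pi * m)) t := setLIntegral_le_lintegral _ _
      _ = _ := by
        rw [lintegral_indicator_const measurableSet_Ioo, Real.volume_Ioo, mul_comm,
          ← ENNReal.ofReal_mul (by linarith)]
        congr 1; ring
    refine setLIntegral_mono' measurableSet_Ioi fun t (ht : 0 < t) => ?_
    by_cases h : t ∈ Ioo (‖z‖ - d) (‖z‖ + d)
    · rw [indicator_of_mem h]
      have ht1 : t < 1 := by linarith [h.2]
      have hc2 := (continuous_comp_circleMap hH.continuousOn ht.le (ht1.trans hρ)).norm.rpow_const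
        fun _ => Or.inr hs.le
      calc _ ≤ 1 * ∫⁻ θ in Ioo (-Real.pi) Real.pi, ENNReal.ofReal (‖H (circleMap 0 t θ)‖ ^ s) := by
            refine mul_le_mul' (by simpa using ht1.le) (lintegral_mono fun θ => ?_)
            exact indicator_le_self _ _ _
        _ ≤ _ := by
            rw [one_mul, lintegral_circleMap_eq (φ := fun w => ‖H w‖ ^ s) hc2
              (fun _ => by positivity)]
            gcongr
            exact circleAverage_norm_rpow_mono hH hs ht.le ht1.le hρ
    · rw [indicator_of_notMem h]
      have : ∀ θ, G (circleMap 0 t θ) = 0 := fun θ => by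
        refine indicator_of_notMem (fun hw => h ?_) _
        rw [mem_ball_iff_norm] at hw
        have h1 := norm_sub_norm_le (circleMap 0 t θ) z
        have h2 := norm_sub_norm_le z (circleMap 0 t θ)
        rw [norm_sub_rev] at h2
        rw [norm_circleMap_zero, abs_of_pos ht] at h1 h2
        constructor <;> linarith
      simp [this]
  have := lower.trans upper
  rw [ENNReal.ofReal_le_ofReal_iff (by positivity)] at this
  have h3 : (d * Real.pi) * (d * ‖H z‖ ^ s) ≤ (d * Real.pi) * (4 * m) := by linarith
  exact le_of_mul_le_mul_left h3 (by positivity)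

end DiscPointEvaluation

section PerpRotation

variable {n : ℕ}

/-- Multiplication by `l` on the orthogonal complement of `η`. -/
def perpSmul (η : En n) (l : ℂ) (x : En n) : En n := inner ℂ η x • η + l • perp η x

lemma norm_perpSmul_sq {η : En n} (hη : ‖η‖ = 1) (l : ℂ) (x : En n) :
    ‖perpSmul η l x‖ ^ 2 = ‖inner ℂ η x‖ ^ 2 + ‖l‖ ^ 2 * ‖perp η x‖ ^ 2 := by
  have h1 : inner ℂ η (perpSmul η l x) = inner ℂ η x := by
    rw [perpSmul, inner_add_right, inner_smul_right, inner_smul_right, inner_perp_self hη,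
      inner_self_eq_norm_sq_to_K, hη]
    simp
  have h2 : perp η (perpSmul η l x) = l • perp η x := by
    rw [perp, h1, perpSmul, add_sub_cancel_left]
  rw [norm_sq_eq_add_perp hη, h1, h2, norm_smul, mul_pow]

lemma norm_perpSmul_le {η : En n} (hη : ‖η‖ = 1) {l : ℂ} {x : En n} {c : ℝ} (hx : ‖x‖ ≤ 1)
    (hc : 1 ≤ c) (hl : ‖l‖ ≤ c) : ‖perpSmul η l x‖ ≤ c := by
  have h := norm_perpSmul_sq hη l x
  have h2 := norm_sq_eq_add_perp hη x
  have : ‖x‖ ^ 2 ≤ 1 := by nlinarith [norm_nonneg x]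
  have h3 : ‖l‖ ^ 2 ≤ c ^ 2 := by gcongr
  have h4 : 1 ≤ c ^ 2 := by nlinarith
  refine abs_le_of_sq_le_sq' ?_ (by linarith) |>.2
  nlinarith [mul_le_mul_of_nonneg_right h3 (sq_nonneg ‖perp η x‖), sq_nonneg ‖inner ℂ η x‖]

/-- `perpSmul` as a unitary map. -/
def perpRot {η : En n} (hη : ‖η‖ = 1) (l : ℂ) (hl : ‖l‖ = 1) : En n ≃ₗᵢ[ℂ] En n :=
  LinearIsometry.toLinearIsometryEquiv
    { toFun := perpSmul η l
      map_add' := fun x y => by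
        simp only [perpSmul, perp, inner_add_right, add_smul, smul_add, smul_sub]; abel
      map_smul' := fun c x => by
        simp only [perpSmul, perp, inner_smul_right, RingHom.id_apply, smul_add, smul_sub, smul_smul]
        rw [mul_left_comm, mul_comm l c]
      norm_map' := fun x => by
        have h := norm_perpSmul_sq hη l x
        rw [hl, one_pow, one_mul, ← norm_sq_eq_add_perp hη] at h
        exact (sq_eq_sq₀ (norm_nonneg _) (norm_nonneg _)).1 h } rfl

lemma perpRot_apply {η : En n} (hη : ‖η‖ = 1) (l : ℂ) (hl : ‖l‖ = 1) (x : En n) :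
    perpRot hη l hl x = perpSmul η l x := rfl

lemma mem_qball_smul_iff {η : En n} {c : ℂ} (hc : ‖c‖ = 1) (ζ : En n) (ε : ℝ) :
    ζ ∈ qball (c • η) ε ↔ ‖c - inner ℂ η ζ‖ < ε := by
  have e : c - inner ℂ η ζ = c * (1 - inner ℂ (c • η) ζ) := by
    rw [inner_smul_left, mul_sub, mul_one, ← mul_assoc, Complex.mul_conj, Complex.normSq_eq_norm_sq,
      hc]
    simp
  rw [e, norm_mul, hc, one_mul]; rfl

lemma qv_le_mul_measure_norm_inner {η : En n} (hη : ‖η‖ = 1) {δ : ℝ} (hδ : 0 < δ) :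
    qv n (δ / 2) ≤ ENNReal.ofReal δ * sigmaS n {ζ | 1 - δ / 2 ≤ ‖(inner ℂ η ζ : ℂ)‖} := by
  set N := ⌊1 / δ⌋₊
  have hN : ((N : ℝ)) * δ ≤ 1 := by
    have := Nat.floor_le (a := 1 / δ) (by positivity)
    rwa [le_div_iff₀ hδ] at this
  have hN1 : 1 ≤ δ * (N + 1 : ℝ) := by
    have := (Nat.lt_floor_add_one (1 / δ)).le
    rw [div_le_iff₀ hδ] at this
    linarith
  set c : ℕ → ℂ := fun j => ⟨Real.sqrt (1 - (j * δ) ^ 2), j * δ⟩ with hcdef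
  have hc : ∀ j ∈ Finset.range (N + 1), ‖c j‖ = 1 := fun j hj => by
    have h1 : (j : ℝ) ≤ N := by exact_mod_cast Nat.lt_succ_iff.1 (Finset.mem_range.1 hj)
    have h2 : (j : ℝ) * δ ≤ 1 := (mul_le_mul_of_nonneg_right h1 hδ.le).trans hN
    have h3 : 0 ≤ 1 - ((j : ℝ) * δ) ^ 2 := by nlinarith [show 0 ≤ (j : ℝ) * δ by positivity]
    rw [← sq_eq_sq₀ (norm_nonneg _) zero_le_one, Complex.sq_norm, Complex.normSq_mk]
    rw [← sq, Real.sq_sqrt h3]; ring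
  have hdisj : (↑(Finset.range (N + 1)) : Set ℕ).PairwiseDisjoint fun j => qball (c j • η) (δ / 2) := by
    intro j hj k hk hjk
    rw [Function.onFun, Set.disjoint_left]
    intro ζ h1 h2
    rw [mem_qball_smul_iff (hc _ hj)] at h1
    rw [mem_qball_smul_iff (hc _ hk)] at h2
    have h3 : ‖c j - c k‖ < δ := by
      have := norm_sub_le (c j - inner ℂ η ζ) (c k - inner ℂ η ζ)
      rw [sub_sub_sub_cancel_right] at this
      linarith
    have h4 := (Complex.abs_im_le_norm (c j - c k)).trans_lt h3
    rw [Complex.sub_im, hcdef] at h4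
    simp only [← sub_mul, abs_mul, abs_of_pos hδ] at h4
    have h5 : (1 : ℝ) ≤ |(j : ℝ) - k| := by
      have : (1 : ℤ) ≤ |(j : ℤ) - k| := Int.one_le_abs (sub_ne_zero.2 (by exact_mod_cast hjk))
      exact_mod_cast this
    nlinarith
  have h1 : (⋃ j ∈ Finset.range (N + 1), qball (c j • η) (δ / 2)) ⊆
      {ζ | 1 - δ / 2 ≤ ‖(inner ℂ η ζ : ℂ)‖} := by
    refine iUnion₂_subset fun j hj ζ hζ => ?_
    rw [mem_qball_smul_iff (hc _ hj)] at hζ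
    have := norm_sub_norm_le (c j) (inner ℂ η ζ)
    rw [hc j hj] at this
    rw [mem_ofPred_eq]; linarith
  have h2 := measure_mono (μ := sigmaS n) h1
  rw [measure_biUnion_finset hdisj fun j _ => (isOpen_qball _ _).measurableSet,
    Finset.sum_congr rfl fun j hj => sigmaS_qball (by rw [norm_smul, hc j hj, hη, one_mul]) (δ / 2),
    Finset.sum_const, Finset.card_range, nsmul_eq_mul] at h2
  calc qv n (δ / 2) ≤ ENNReal.ofReal (δ * (N + 1 : ℝ)) * qv n (δ / 2) :=
        le_mul_of_one_le_left (zero_le) (by rwa [ENNReal.one_le_ofReal])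
    _ = ENNReal.ofReal δ * (((N + 1 : ℕ) : ℝ≥0∞) * qv n (δ / 2)) := by
        rw [ENNReal.ofReal_mul hδ.le, mul_assoc]
        congr 2
        rw [← ENNReal.ofReal_natCast]; push_cast; rfl
    _ ≤ _ := mul_le_mul_right h2 _

variable [IsProbabilityMeasure (sigmaS n)]

/-- Integration over the sphere in circles rotating the orthogonal complement of `η`. -/
lemma integral_eq_integral_circleAverage_perpSmul {A : En n → ℝ} {η : En n} (hη : ‖η‖ = 1)
    (hA : ContinuousOn A (Sn n)) :
    Integrable (fun ζ => Real.circleAverage (fun l => A (perpSmul η l ζ)) 0 1) (sigmaS n) ∧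
    ∫ ζ, A ζ ∂(sigmaS n) =
      ∫ ζ, Real.circleAverage (fun l => A (perpSmul η l ζ)) 0 1 ∂(sigmaS n) := by
  set K : Set (En n × ℝ) := Sn n ×ˢ Icc 0 (2 * Real.pi)
  have hK : IsCompact K := isCompact_Sn.prod isCompact_Icc
  have hn : ∀ θ, ‖circleMap 0 1 θ‖ = 1 := fun θ => by simp
  have hc : ContinuousOn (fun x : En n × ℝ => A (perpSmul η (circleMap 0 1 x.2) x.1)) K := by
    refine hA.comp (by unfold perpSmul perp; fun_prop) ?_
    rintro ⟨ζ, θ⟩ ⟨hζ, -⟩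
    have := norm_eq_one_of_mem_Sn hζ
    show perpSmul η (circleMap 0 1 θ) ζ ∈ Sn n
    rw [← perpRot_apply hη _ (hn θ)]
    simpa [Sn] using this
  have hi : Integrable (fun x : En n × ℝ => A (perpSmul η (circleMap 0 1 x.2) x.1))
      ((sigmaS n).prod (volume.restrict (Ioc 0 (2 * Real.pi)))) := by
    have := hc.integrableOn_compact (μ := (sigmaS n).prod volume) hK
    have := this.mono_set (prod_mono_right (s := Sn n) (Ioc_subset_Icc_self (a := 0) (b := 2 * Real.pi)))
    rwa [IntegrableOn, ← Measure.prod_restrict, sigmaS_restrict_Sn] at this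
  have e : ∀ ζ : En n, Real.circleAverage (fun l => A (perpSmul η l ζ)) 0 1 =
      (2 * Real.pi)⁻¹ * ∫ θ in Ioc 0 (2 * Real.pi), A (perpSmul η (circleMap 0 1 θ) ζ) := by
    intro ζ
    rw [Real.circleAverage, intervalIntegral.integral_of_le Real.two_pi_pos.le, smul_eq_mul]
  simp only [e]
  refine ⟨hi.integral_prod_left.const_mul _, ?_⟩
  rw [integral_const_mul,
    integral_integral_swap (f := fun ζ θ => A (perpSmul η (circleMap 0 1 θ) ζ)) hi]
  have e2 : ∀ θ : ℝ, ∫ ζ, A (perpSmul η (circleMap 0 1 θ) ζ) ∂(sigmaS n) = ∫ ζ, A ζ ∂(sigmaS n) :=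
    fun θ => integral_comp_isometry (perpRot hη _ (hn θ)) A
  simp only [e2]
  rw [integral_const]
  have := Real.pi_pos
  simp [this.le]
  field_simp

lemma integral_norm_rpow_inner_le {h : En n → ℂ} {ρ : ℝ} (hρ : 1 < ρ)
    (hh : DifferentiableOn ℂ h (ball 0 ρ)) {s : ℝ} (hs : 0 < s) {η : En n} (hη : ‖η‖ = 1) :
    ∫ ζ, ‖h ((inner ℂ η ζ : ℂ) • η)‖ ^ s ∂(sigmaS n) ≤ ∫ ζ, ‖h ζ‖ ^ s ∂(sigmaS n) := by
  have hsub : Sn n ⊆ ball 0 ρ := fun ζ hζ => by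
    rw [mem_ball_zero_iff, norm_eq_one_of_mem_Sn hζ]; exact hρ
  have hA : ContinuousOn (fun ζ => ‖h ζ‖ ^ s) (ball 0 ρ) :=
    hh.continuousOn.norm.rpow_const fun _ _ => Or.inr hs.le
  obtain ⟨hi, he⟩ := integral_eq_integral_circleAverage_perpSmul hη (hA.mono hsub)
  rw [he]
  refine integral_mono_ae (ContinuousOn.integrable_sigmaS ?_) hi ?_
  · refine hA.comp (by fun_prop) fun ζ hζ => ?_
    have := norm_inner_le_norm (𝕜 := ℂ) η ζ
    rw [hη, norm_eq_one_of_mem_Sn hζ] at this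
    rw [mem_ball_zero_iff, norm_smul, hη]; linarith
  · filter_upwards [ae_mem_Sn n] with ζ hζ
    have hd : DifferentiableOn ℂ (fun l => h (perpSmul η l ζ)) (ball 0 ρ) := by
      refine hh.comp (by unfold perpSmul; fun_prop) fun l hl => ?_
      rw [mem_ball_zero_iff] at hl ⊢
      refine (norm_perpSmul_le hη (norm_eq_one_of_mem_Sn hζ).le (le_max_left 1 ‖l‖)
        (le_max_right _ _)).trans_lt (max_lt hρ hl)
    have := circleAverage_norm_rpow_mono hd hs le_rfl zero_le_one hρ
    rw [Real.circleAverage_zero] at this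
    simpa [perpSmul] using this

/-- Point evaluation on the ball. -/
lemma qv_mul_norm_rpow_le {h : En n → ℂ} {ρ : ℝ} (hρ : 1 < ρ)
    (hh : DifferentiableOn ℂ h (ball 0 ρ)) {s : ℝ} (hs : 0 < s) {z : En n} (hz : ‖z‖ < 1) :
    (qv n (1 - ‖z‖)).toReal * ‖h z‖ ^ s ≤ 8 * qN n * ∫ ζ, ‖h ζ‖ ^ s ∂(sigmaS n) := by
  obtain ⟨η, hη, hzη, -⟩ := exists_unit_direction z hz.le
  set δ := 1 - ‖z‖ with hδdef
  have hδ : 0 < δ := by linarith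
  have hδ1 : δ ≤ 1 := by linarith [norm_nonneg z]
  set E : Set (En n) := {ζ | 1 - δ / 2 ≤ ‖(inner ℂ η ζ : ℂ)‖} with hE
  have hEm : MeasurableSet E := by
    refine (isClosed_le continuous_const ?_).measurableSet
    fun_prop
  set B : En n → ℝ := fun ζ => Real.circleAverage (fun l => ‖h ((inner ℂ η (l • ζ) : ℂ) • η)‖ ^ s) 0 1
  have hcont : ContinuousOn (fun ζ : En n => ‖h ((inner ℂ η ζ : ℂ) • η)‖ ^ s) (sphere 0 1) := by
    refine ContinuousOn.rpow_const (hh.continuousOn.comp (by fun_prop) fun ζ hζ => ?_).norm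
      fun _ _ => Or.inr hs.le
    have := norm_inner_le_norm (𝕜 := ℂ) η ζ
    rw [hη, mem_sphere_zero_iff_norm.1 hζ] at this
    rw [mem_ball_zero_iff, norm_smul, hη]; linarith
  obtain ⟨hi, he⟩ := integral_eq_integral_circleAverage zero_le_one hcont
  have h1 := integral_norm_rpow_inner_le hρ hh hs hη
  simp only [Complex.ofReal_one, one_smul] at he
  have hlow : ∫ ζ, E.indicator (fun _ => δ / 8 * ‖h z‖ ^ s) ζ ∂(sigmaS n) ≤ ∫ ζ, B ζ ∂(sigmaS n) := by
    refine integral_mono_ae ((integrable_const _).indicator hEm) hi ?_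
    filter_upwards [ae_mem_Sn n] with ζ hζ
    have hα1 : ‖(inner ℂ η ζ : ℂ)‖ ≤ 1 := by
      have := norm_inner_le_norm (𝕜 := ℂ) η ζ
      rwa [hη, norm_eq_one_of_mem_Sn hζ, one_mul] at this
    set α : ℂ := inner ℂ η ζ with hα
    have hB : B ζ = Real.circleAverage (fun l => ‖h ((l * α) • η)‖ ^ s) 0 1 := by
      simp only [B, inner_smul_right, hα]
    have hd : DifferentiableOn ℂ (fun l : ℂ => h ((l * α) • η)) (ball 0 ρ) := by
      refine hh.comp (by fun_prop) fun l hl => ?_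
      rw [mem_ball_zero_iff] at hl ⊢
      rw [norm_smul, hη, norm_mul]
      nlinarith [norm_nonneg l]
    by_cases hζE : ζ ∈ E
    · rw [indicator_of_mem hζE]
      have hζE' : 1 - δ / 2 ≤ ‖α‖ := hζE
      have hαpos : 0 < ‖α‖ := by linarith
      have hα0 : α ≠ 0 := norm_pos_iff.1 hαpos
      have hl0 : ‖(‖z‖ : ℂ) / α‖ ≤ 1 - δ / 2 := by
        rw [norm_div, Complex.norm_real, norm_norm, div_le_iff₀ hαpos]
        nlinarith
      have := mul_norm_rpow_le_circleAverage hρ hd hs (half_pos hδ) hl0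
      rw [div_mul_cancel₀ _ hα0, hzη, ← hB] at this
      linarith
    · rw [indicator_of_notMem hζE]
      have := circleAverage_norm_rpow_mono hd hs le_rfl zero_le_one hρ
      rw [Real.circleAverage_zero, ← hB] at this
      exact le_trans (by positivity) this
  rw [integral_indicator_const _ hEm, smul_eq_mul] at hlow
  have hq : (qv n δ).toReal ≤ qN n * (δ * (sigmaS n).real E) := by
    have h2 := qv_two_mul_le (n := n) (half_pos hδ)
    rw [mul_div_cancel₀ _ two_ne_zero] at h2
    have h3 := h2.trans (mul_le_mul_right (qv_le_mul_measure_norm_inner hη hδ) _)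
    have h4 := ENNReal.toReal_mono ?_ h3
    · rwa [ENNReal.toReal_mul, ENNReal.toReal_mul, ENNReal.toReal_ofReal hδ.le,
        ENNReal.toReal_natCast] at h4
    · exact ENNReal.mul_ne_top (by simp) (ENNReal.mul_ne_top (by simp) (measure_ne_top _ _))
  calc _ ≤ qN n * (δ * (sigmaS n).real E) * ‖h z‖ ^ s := by gcongr
    _ = 8 * qN n * ((sigmaS n).real E * (δ / 8 * ‖h z‖ ^ s)) := by ring
    _ ≤ _ := by gcongr; exact hlow.trans (he ▸ h1)

end PerpRotation

section CompactBounded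

variable {n : ℕ} {p q s R : ℝ} {f g : En n → ℂ}

lemma hNorm_const_mul (hp : 0 < p) (c : ℂ) :
    hNorm n p (fun z => c * f z) = ENNReal.ofReal ‖c‖ * hNorm n p f := by
  have hc : ENNReal.ofReal ‖c‖ = (‖c‖₊ : ℝ≥0∞) := by
    rw [ofReal_norm]; rfl
  have e : ∀ r : ℝ, ∫⁻ ζ, (‖c * f (r • ζ)‖₊ : ℝ≥0∞) ^ p ∂(sigmaS n) =
      (‖c‖₊ : ℝ≥0∞) ^ p * ∫⁻ ζ, (‖f (r • ζ)‖₊ : ℝ≥0∞) ^ p ∂(sigmaS n) := fun r => by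
    rw [← lintegral_const_mul' _ _ (by simp [hp.le])]
    refine lintegral_congr fun ζ => ?_
    rw [nnnorm_mul, ENNReal.coe_mul, ENNReal.mul_rpow_of_nonneg _ _ hp.le]
  simp only [hNorm, e, ← ENNReal.mul_iSup]
  rw [ENNReal.mul_rpow_of_nonneg _ _ (by positivity), ← ENNReal.rpow_mul, mul_one_div_cancel hp.ne',
    ENNReal.rpow_one, hc]

lemma hNorm_eq_zero_of_eqOn_zero (hp : 0 < p) (h : ∀ z ∈ Bn n, f z = 0) : hNorm n p f = 0 := by
  have : ∀ r ∈ Ioo (0 : ℝ) 1, ∫⁻ ζ, (‖f (r • ζ)‖₊ : ℝ≥0∞) ^ p ∂(sigmaS n) = 0 := fun r hr => by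
    rw [lintegral_eq_zero_of_ae_eq_zero]
    filter_upwards [ae_mem_Sn n] with ζ hζ
    have := h _ (smul_mem_Bn_of_Sn hζ (ofReal_mem_ball hr.1.le hr.2))
    rw [RCLike.real_smul_eq_coe_smul (K := ℂ)]
    simp only [Complex.coe_algebraMap]
    rw [this]; simp [hp]
  rw [hNorm, biSup_congr this]
  simp [hp]

lemma differentiableOn_dilate (hf : DifferentiableOn ℂ f (Bn n)) (hR : 0 < R) :
    DifferentiableOn ℂ (fun w : En n => f ((R : ℂ) • w)) (ball 0 (1 / R)) := by
  refine hf.comp (by fun_prop) fun w hw => ?_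
  rw [mem_ball_zero_iff, lt_div_iff₀ hR] at hw
  rw [Bn, mem_ball_zero_iff, norm_smul, Complex.norm_real, Real.norm_of_nonneg hR.le]
  linarith

variable [IsProbabilityMeasure (sigmaS n)]

lemma qv_mul_norm_rpow_le_pMean (hf : DifferentiableOn ℂ f (Bn n)) (hs : 0 < s) (hR : 0 < R)
    (hR1 : R < 1) {z : En n} (hz : ‖z‖ < R) :
    (qv n (1 - ‖z‖ / R)).toReal * ‖f z‖ ^ s ≤ 8 * qN n * pMean n s R f := by
  have hn : ‖((R : ℂ)⁻¹) • z‖ = ‖z‖ / R := by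
    rw [norm_smul, norm_inv, Complex.norm_real, Real.norm_of_nonneg hR.le]; field_simp
  have := qv_mul_norm_rpow_le (by rwa [lt_div_iff₀ hR, one_mul]) (differentiableOn_dilate hf hR) hs
    (z := ((R : ℂ)⁻¹) • z) (by rw [hn, div_lt_one hR]; exact hz)
  rwa [hn, smul_inv_smul₀ (by exact_mod_cast hR.ne')] at this

lemma exists_norm_le_mul_of_hNorm (n : ℕ) [IsProbabilityMeasure (sigmaS n)] (hp : 0 < p) {ρ : ℝ}
    (hρ0 : 0 ≤ ρ) (hρ : ρ < 1) :
    ∃ C, 0 ≤ C ∧ ∀ (f : En n → ℂ) (A : ℝ), DifferentiableOn ℂ f (Bn n) → 0 ≤ A →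
      hNorm n p f ≤ ENNReal.ofReal A → ∀ z, ‖z‖ ≤ ρ → ‖f z‖ ≤ C * A := by
  set R := (1 + ρ) / 2
  have hR0 : 0 < R := by positivity
  have hR1 : R < 1 := by simp only [R]; linarith
  have hρR : ρ < R := by simp only [R]; linarith
  have hd : 0 < 1 - ρ / R := by rw [sub_pos, div_lt_one hR0]; exact hρR
  set v := (qv n (1 - ρ / R)).toReal
  have hv : 0 < v := ENNReal.toReal_pos (qv_pos hd).ne' qv_ne_top
  refine ⟨(8 * qN n / v) ^ p⁻¹, by positivity, fun f A hf hA h z hz => ?_⟩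
  rw [hNorm_le_ofReal_iff hf.continuousOn hp hA] at h
  have h1 := qv_mul_norm_rpow_le_pMean hf hp hR0 hR1 (hz.trans_lt hρR)
  have h2 : v ≤ (qv n (1 - ‖z‖ / R)).toReal :=
    ENNReal.toReal_mono qv_ne_top (qv_mono (by gcongr))
  have h3 : ‖f z‖ ^ p ≤ (8 * qN n / v) * A ^ p := by
    rw [div_mul_eq_mul_div, le_div_iff₀ hv]
    have h4 := h R ⟨hR0, hR1⟩
    calc ‖f z‖ ^ p * v = v * ‖f z‖ ^ p := mul_comm _ _
      _ ≤ (qv n (1 - ‖z‖ / R)).toReal * ‖f z‖ ^ p := by gcongr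
      _ ≤ _ := h1.trans (by gcongr)
  rw [← Real.rpow_le_rpow_iff (norm_nonneg _) (by positivity) hp,
    Real.mul_rpow (by positivity) hA, Real.rpow_inv_rpow (by positivity) hp.ne']
  exact h3

/-- If `J_g` is compact from `H^p` to `H^q`, then it is bounded. -/
theorem J_bounded_of_compact (hp : 0 < p) (hq : 0 < q)
    (hcomp : ∀ f : ℕ → En n → ℂ, (∀ k, MemHp n p (f k)) →
        (∃ M : ℝ≥0∞, M < ⊤ ∧ ∀ k, hNorm n p (f k) ≤ M) →
        (∀ K : Set (En n), K ⊆ Bn n → IsCompact K →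
          TendstoUniformlyOn (fun k => f k) 0 atTop K) →
        Tendsto (fun k => hNorm n q (J g (f k))) atTop (𝓝 0)) :
    ∃ C : ℝ≥0∞, 0 < C ∧ C < ⊤ ∧ ∀ f, MemHp n p f → hNorm n q (J g f) ≤ C * hNorm n p f := by
  by_contra! hcon
  have h1 : ∀ k : ℕ, ∃ f, MemHp n p f ∧ ((k + 1 : ℕ) : ℝ≥0∞) * hNorm n p f < hNorm n q (J g f) :=
    fun k => hcon _ (by exact_mod_cast Nat.succ_pos k) (ENNReal.natCast_lt_top _)
  choose f hf hfJ using h1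
  set A : ℕ → ℝ := fun k => (hNorm n p (f k)).toReal with hA
  have hAe : ∀ k, ENNReal.ofReal (A k) = hNorm n p (f k) := fun k => ENNReal.ofReal_toReal (hf k).2.ne
  have hA0 : ∀ k, 0 < A k := fun k => by
    refine lt_of_le_of_ne ENNReal.toReal_nonneg fun h0 => ?_
    have hz : ∀ z ∈ Bn n, f k z = 0 := fun z hz => by
      obtain ⟨C, -, hC⟩ := exists_norm_le_mul_of_hNorm n hp (norm_nonneg z) (mem_ball_zero_iff.1 hz)
      have := hC (f k) (A k) (hf k).1 h0.le (hAe k).ge z le_rfl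
      rw [← h0, mul_zero] at this
      exact norm_le_zero_iff.1 this
    have hJ : hNorm n q (J g (f k)) = 0 := by
      refine hNorm_eq_zero_of_eqOn_zero hq fun z hzB => ?_
      rw [J, setIntegral_eq_zero_of_forall_eq_zero]
      intro t ht
      rw [hz _ (smul_mem_Bn hzB ⟨ht.1.le, ht.2.le⟩)]; simp
    have := hfJ k
    rw [hJ] at this
    exact not_lt_zero this
  set c : ℕ → ℝ := fun k => (A k)⁻¹ * ((k : ℝ) + 1)⁻¹ with hc
  have hc0 : ∀ k, 0 < c k := fun k => by have := hA0 k; positivity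
  have hcn : ∀ k, ENNReal.ofReal ‖((c k : ℝ) : ℂ)‖ = ENNReal.ofReal (c k) := fun k => by
    rw [Complex.norm_real, Real.norm_of_nonneg (hc0 k).le]
  have hF : ∀ k, hNorm n p (fun z => (c k : ℂ) * f k z) = ENNReal.ofReal (((k : ℝ) + 1)⁻¹) := fun k => by
    rw [hNorm_const_mul hp, hcn, ← hAe, ← ENNReal.ofReal_mul (hc0 k).le]
    congr 1
    have := (hA0 k).ne'
    simp only [hc]; field_simp
  have hlim := hcomp (fun k z => (c k : ℂ) * f k z)
    (fun k => ⟨(hf k).1.const_mul _, by rw [hF]; exact ENNReal.ofReal_lt_top⟩)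
    ⟨1, ENNReal.one_lt_top, fun k => by
      rw [hF, ENNReal.ofReal_le_one]
      exact inv_le_one_of_one_le₀ (by linarith [Nat.cast_nonneg (α := ℝ) k])⟩
    (fun K hK hKc => by
      obtain ⟨ρ, hρ0, hρ1, hKρ⟩ : ∃ ρ, 0 ≤ ρ ∧ ρ < 1 ∧ ∀ z ∈ K, ‖z‖ ≤ ρ := by
        rcases K.eq_empty_or_nonempty with rfl | hne
        · exact ⟨0, le_rfl, one_pos, by simp⟩
        · obtain ⟨z, hz, hmax⟩ := hKc.exists_isMaxOn hne continuous_norm.continuousOn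
          exact ⟨‖z‖, norm_nonneg _, mem_ball_zero_iff.1 (hK hz), fun w hw => hmax hw⟩
      obtain ⟨C, hC0, hC⟩ := exists_norm_le_mul_of_hNorm n hp hρ0 hρ1
      have hb : ∀ k, ∀ z ∈ K, ‖(c k : ℂ) * f k z‖ ≤ C * ((k : ℝ) + 1)⁻¹ := fun k z hz =>
        hC _ _ ((hf k).1.const_mul _) (by positivity) (hF k).le z (hKρ z hz)
      have ht : Tendsto (fun k : ℕ => C * ((k : ℝ) + 1)⁻¹) atTop (𝓝 0) := by
        simpa using tendsto_one_div_add_atTop_nhds_zero_nat.const_mul C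
      rw [Metric.tendstoUniformlyOn_iff]
      intro e he
      filter_upwards [ht.eventually (gt_mem_nhds he)] with k hk z hz
      rw [Pi.zero_apply, dist_zero_left]
      exact (hb k z hz).trans_lt hk)
  have hge : ∀ k, 1 ≤ hNorm n q (J g (fun z => (c k : ℂ) * f k z)) := fun k => by
    have eJ : J g (fun z => (c k : ℂ) * f k z) = fun z => (c k : ℂ) * J g (f k) z :=
      funext fun z => J_const_mul _ z
    rw [eJ, hNorm_const_mul hq, hcn]
    refine le_trans ?_ (mul_le_mul_right (hfJ k).le _)
    rw [← hAe, ← ENNReal.ofReal_natCast, ← ENNReal.ofReal_mul (by positivity),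
      ← ENNReal.ofReal_mul (hc0 k).le, ENNReal.one_le_ofReal]
    have := (hA0 k).ne'
    simp only [hc]; push_cast; field_simp; exact le_rfl
  exact absurd (ge_of_tendsto' hlim hge) (by simp)

end CompactBounded

section GaussianSums

open ProbabilityTheory

/-- Absolute moments of the standard Gaussian. -/
def gaussMoment (q : ℝ) : ℝ≥0∞ := ∫⁻ x, ‖x‖ₑ ^ q ∂(gaussianReal 0 1)

lemma gaussMoment_ne_top {q : ℝ} (hq : 0 < q) : gaussMoment q ≠ ⊤ := by
  have h := (memLp_id_gaussianReal' (μ := 0) (v := 1) (ENNReal.ofReal q) ENNReal.ofReal_ne_top).2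
  have := lintegral_rpow_enorm_lt_top_of_eLpNorm_lt_top (by simpa using hq) ENNReal.ofReal_ne_top h
  rw [ENNReal.toReal_ofReal hq.le] at this
  exact this.ne

lemma gaussMoment_ne_zero {q : ℝ} (hq : 0 < q) : gaussMoment q ≠ 0 := by
  intro h
  rw [gaussMoment, lintegral_eq_zero_iff (by fun_prop)] at h
  have h2 : ∀ᵐ x ∂(gaussianReal 0 1), x = 0 := by
    filter_upwards [h] with x hx
    simpa [hq] using hx
  have h3 : gaussianReal 0 1 {x : ℝ | x = 0}ᶜ = 0 := h2
  have h4 : gaussianReal 0 1 {x : ℝ | x = 0} = 0 :=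
    gaussianReal_absolutelyContinuous 0 one_ne_zero (by simp)
  have h5 := measure_union_le (μ := gaussianReal 0 1) {x : ℝ | x = 0} {x : ℝ | x = 0}ᶜ
  rw [union_compl_self, measure_univ, h3, h4] at h5
  simp at h5

lemma lintegral_enorm_inner_stdGaussian {ι : Type*} [Fintype ι] {q : ℝ} (hq : 0 < q)
    (b : EuclideanSpace ℝ ι) :
    ∫⁻ x, ‖(inner ℝ b x : ℝ)‖ₑ ^ q ∂(stdGaussian (EuclideanSpace ℝ ι)) = ‖b‖ₑ ^ q * gaussMoment q := by
  have h1 : (stdGaussian (EuclideanSpace ℝ ι)).map (innerSL ℝ b) =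
      (gaussianReal 0 1).map (fun x => ‖b‖ * x) := by
    rw [IsGaussian.map_eq_gaussianReal, integral_strongDual_stdGaussian, variance_dual_stdGaussian,
      gaussianReal_map_const_mul, innerSL_apply_norm]
    congr 1
    · simp
    · ext; simp
  have h2 : ∫⁻ x, ‖(inner ℝ b x : ℝ)‖ₑ ^ q ∂(stdGaussian (EuclideanSpace ℝ ι)) =
      ∫⁻ y, ‖y‖ₑ ^ q ∂((stdGaussian (EuclideanSpace ℝ ι)).map (innerSL ℝ b)) := by
    rw [lintegral_map (by fun_prop) (by fun_prop)]; rfl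
  rw [h2, h1, lintegral_map (by fun_prop) (by fun_prop), gaussMoment, ← lintegral_const_mul _ (by fun_prop)]
  refine lintegral_congr fun x => ?_
  rw [enorm_mul, ENNReal.mul_rpow_of_nonneg _ _ hq.le, enorm_norm]

/-- Gaussian sums have moments comparable with the square function. -/
lemma lintegral_gaussian_sum {ι : Type*} [Fintype ι] {q : ℝ} (hq : 0 < q) (a : ι → ℂ) :
    ENNReal.ofReal ((∑ i, ‖a i‖ ^ 2) ^ (q / 2)) * ((2 ^ (q / 2))⁻¹ * gaussMoment q) ≤
      ∫⁻ x : EuclideanSpace ℝ ι, ‖∑ i, (x i : ℂ) * a i‖ₑ ^ q ∂(stdGaussian _) ∧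
    ∫⁻ x : EuclideanSpace ℝ ι, ‖∑ i, (x i : ℂ) * a i‖ₑ ^ q ∂(stdGaussian _) ≤
      ENNReal.ofReal ((∑ i, ‖a i‖ ^ 2) ^ (q / 2)) * (2 ^ q * 2 * gaussMoment q) := by
  set u : EuclideanSpace ℝ ι := WithLp.toLp 2 fun i => (a i).re
  set v : EuclideanSpace ℝ ι := WithLp.toLp 2 fun i => (a i).im
  have hre : ∀ x : EuclideanSpace ℝ ι, (∑ i, (x i : ℂ) * a i).re = inner ℝ u x := fun x => by
    simp [PiLp.inner_apply, u]
  have him : ∀ x : EuclideanSpace ℝ ι, (∑ i, (x i : ℂ) * a i).im = inner ℝ v x := fun x => by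
    simp [PiLp.inner_apply, v]
  have hS : ∑ i, ‖a i‖ ^ 2 = ‖u‖ ^ 2 + ‖v‖ ^ 2 := by
    rw [EuclideanSpace.norm_sq_eq, EuclideanSpace.norm_sq_eq, ← Finset.sum_add_distrib]
    refine Finset.sum_congr rfl fun i _ => ?_
    rw [Complex.sq_norm, Complex.normSq_apply]
    simp [u, v, sq]
  have hS0 : 0 ≤ ∑ i, ‖a i‖ ^ 2 := by positivity
  have key : ∀ b : EuclideanSpace ℝ ι, ‖b‖ₑ ^ q = ENNReal.ofReal ((‖b‖ ^ 2) ^ (q / 2)) := fun b => by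
    rw [← ofReal_norm, ENNReal.ofReal_rpow_of_nonneg (norm_nonneg _) hq.le, ← Real.rpow_natCast,
      ← Real.rpow_mul (norm_nonneg _)]
    congr 2; push_cast; ring
  constructor
  · have main : ∀ b : EuclideanSpace ℝ ι, ∑ i, ‖a i‖ ^ 2 ≤ 2 * ‖b‖ ^ 2 →
        (∀ x : EuclideanSpace ℝ ι, |inner ℝ b x| ≤ ‖∑ i, (x i : ℂ) * a i‖) →
        ENNReal.ofReal ((∑ i, ‖a i‖ ^ 2) ^ (q / 2)) * ((2 ^ (q / 2))⁻¹ * gaussMoment q) ≤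
        ∫⁻ x : EuclideanSpace ℝ ι, ‖∑ i, (x i : ℂ) * a i‖ₑ ^ q ∂(stdGaussian _) := by
      intro b hb hx
      calc _ ≤ ‖b‖ₑ ^ q * gaussMoment q := by
            rw [← mul_assoc]
            gcongr
            rw [← div_eq_mul_inv]
            refine ENNReal.div_le_of_le_mul ?_
            have e2 : (2 : ℝ≥0∞) ^ (q / 2) = ENNReal.ofReal (2 ^ (q / 2)) := by
              rw [← ENNReal.ofReal_rpow_of_pos two_pos]; simp
            rw [key, e2, ← ENNReal.ofReal_mul (by positivity), ← Real.mul_rpow (by positivity) (by norm_num)]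
            refine ENNReal.ofReal_le_ofReal (Real.rpow_le_rpow hS0 (by linarith) (by positivity))
        _ = _ := (lintegral_enorm_inner_stdGaussian hq b).symm
        _ ≤ _ := by
            refine lintegral_mono fun x => ENNReal.rpow_le_rpow ?_ hq.le
            rw [← ofReal_norm, ← ofReal_norm]
            exact ENNReal.ofReal_le_ofReal (hx x)
    rcases le_total ‖u‖ ‖v‖ with h | h
    · refine main v ?_ fun x => by rw [← him]; exact Complex.abs_im_le_norm _
      rw [hS]; nlinarith [norm_nonneg u]
    · refine main u ?_ fun x => by rw [← hre]; exact Complex.abs_re_le_norm _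
      rw [hS]; nlinarith [norm_nonneg v]
  · have hle : ∀ x : EuclideanSpace ℝ ι, ‖∑ i, (x i : ℂ) * a i‖ₑ ^ q ≤
        2 ^ q * (‖(inner ℝ u x : ℝ)‖ₑ ^ q + ‖(inner ℝ v x : ℝ)‖ₑ ^ q) := by
      intro x
      set z := ∑ i, (x i : ℂ) * a i with hz
      have h1 : ‖z‖ₑ ≤ 2 * max ‖z.re‖ₑ ‖z.im‖ₑ := by
        have : ‖z‖ₑ ≤ ‖z.re‖ₑ + ‖z.im‖ₑ := by
          rw [← ofReal_norm, ← ofReal_norm, ← ofReal_norm, ← ENNReal.ofReal_add (norm_nonneg _) (norm_nonneg _)]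
          exact ENNReal.ofReal_le_ofReal (Complex.norm_le_abs_re_add_abs_im z)
        rw [two_mul]
        exact this.trans (add_le_add (le_max_left _ _) (le_max_right _ _))
      rw [← hre x, ← him x, ← hz]
      calc ‖z‖ₑ ^ q ≤ (2 * max ‖z.re‖ₑ ‖z.im‖ₑ) ^ q := ENNReal.rpow_le_rpow h1 hq.le
        _ = 2 ^ q * (max ‖z.re‖ₑ ‖z.im‖ₑ) ^ q := ENNReal.mul_rpow_of_nonneg _ _ hq.le
        _ ≤ _ := by
          gcongr
          rcases max_choice ‖z.re‖ₑ ‖z.im‖ₑ with h | h <;> rw [h]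
          · exact le_self_add
          · exact le_add_self
    refine (lintegral_mono hle).trans ?_
    rw [lintegral_const_mul _ (by fun_prop), lintegral_add_left (by fun_prop),
      lintegral_enorm_inner_stdGaussian hq, lintegral_enorm_inner_stdGaussian hq, key, key, hS]
    have h1 : ENNReal.ofReal ((‖u‖ ^ 2) ^ (q / 2)) ≤ ENNReal.ofReal ((‖u‖ ^ 2 + ‖v‖ ^ 2) ^ (q / 2)) := by
      gcongr; nlinarith [norm_nonneg v]
    have h2 : ENNReal.ofReal ((‖v‖ ^ 2) ^ (q / 2)) ≤ ENNReal.ofReal ((‖u‖ ^ 2 + ‖v‖ ^ 2) ^ (q / 2)) := by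
      gcongr; nlinarith [norm_nonneg u]
    calc _ ≤ 2 ^ q * (ENNReal.ofReal ((‖u‖ ^ 2 + ‖v‖ ^ 2) ^ (q / 2)) * gaussMoment q +
          ENNReal.ofReal ((‖u‖ ^ 2 + ‖v‖ ^ 2) ^ (q / 2)) * gaussMoment q) := by gcongr
      _ = _ := by ring

lemma lintegral_rpow_le_rpow_lintegral {Ω : Type*} [MeasurableSpace Ω] {μ : Measure Ω}
    [IsProbabilityMeasure μ] {θ : ℝ} (h0 : 0 < θ) (h1 : θ ≤ 1) {f : Ω → ℝ≥0∞} (hf : AEMeasurable f μ) :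
    ∫⁻ x, f x ^ θ ∂μ ≤ (∫⁻ x, f x ∂μ) ^ θ := by
  rcases h1.eq_or_lt with rfl | h1
  · simp
  have hc : (1 / θ).HolderConjugate (1 / (1 - θ)) := by
    rw [Real.holderConjugate_iff]
    constructor
    · rw [lt_div_iff₀ h0]; linarith
    · simp
  have := ENNReal.lintegral_mul_le_Lp_mul_Lq μ hc (hf.pow_const θ) (aemeasurable_const (b := (1 : ℝ≥0∞)))
  simpa [← ENNReal.rpow_mul, h0.ne'] using this

/-- Hilbert-space valued extension of an `L^p → L^q` bound. -/
lemma lintegral_square_function_le {p q : ℝ} (hq : 0 < q) (hqp : q ≤ p) :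
    ∃ C : ℝ≥0∞, C ≠ ⊤ ∧ ∀ {Ω : Type} [MeasurableSpace Ω] (μ : Measure Ω) [SFinite μ] {ι : Type}
      [Fintype ι] (F G : ι → Ω → ℂ) (K : ℝ≥0∞), (∀ i, Measurable (F i)) → (∀ i, Measurable (G i)) →
      (∀ x : ι → ℝ, ∫⁻ ω, ‖∑ i, (x i : ℂ) * G i ω‖ₑ ^ q ∂μ ≤
        K * (∫⁻ ω, ‖∑ i, (x i : ℂ) * F i ω‖ₑ ^ p ∂μ) ^ (q / p)) →
      ∫⁻ ω, ENNReal.ofReal ((∑ i, ‖G i ω‖ ^ 2) ^ (q / 2)) ∂μ ≤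
        C * K * (∫⁻ ω, ENNReal.ofReal ((∑ i, ‖F i ω‖ ^ 2) ^ (p / 2)) ∂μ) ^ (q / p) := by
  have hp : 0 < p := hq.trans_le hqp
  set c : ℝ≥0∞ := (2 ^ (q / 2))⁻¹ * gaussMoment q with hc
  set D : ℝ≥0∞ := 2 ^ p * 2 * gaussMoment p with hD
  have hm := gaussMoment_ne_top hq
  have hm' := gaussMoment_ne_top hp
  have hc0 : c ≠ 0 := mul_ne_zero (by simp) (gaussMoment_ne_zero hq)
  have hct : c ≠ ⊤ := ENNReal.mul_ne_top (by simp) hm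
  have hDt : D ≠ ⊤ := by finiteness
  have hθ : 0 < q / p := by positivity
  have hθ1 : q / p ≤ 1 := (div_le_one hp).2 hqp
  refine ⟨c⁻¹ * D ^ (q / p), by finiteness, fun {Ω} _ μ _ {ι} _ F G K hF hG h => ?_⟩
  set γ := stdGaussian (EuclideanSpace ℝ ι)
  have mF : Measurable fun x : EuclideanSpace ℝ ι × Ω => ‖∑ i, (x.1 i : ℂ) * F i x.2‖ₑ ^ p := by
    refine ((Finset.measurable_sum _ fun i _ => ?_).enorm).pow_const _
    exact (Complex.measurable_ofReal.comp (by fun_prop)).mul ((hF i).comp measurable_snd)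
  have mG : Measurable fun x : EuclideanSpace ℝ ι × Ω => ‖∑ i, (x.1 i : ℂ) * G i x.2‖ₑ ^ q := by
    refine ((Finset.measurable_sum _ fun i _ => ?_).enorm).pow_const _
    exact (Complex.measurable_ofReal.comp (by fun_prop)).mul ((hG i).comp measurable_snd)
  have mF2 : Measurable fun ω => ENNReal.ofReal ((∑ i, ‖F i ω‖ ^ 2) ^ (p / 2)) := by fun_prop
  have mG2 : Measurable fun ω => ENNReal.ofReal ((∑ i, ‖G i ω‖ ^ 2) ^ (q / 2)) := by fun_prop
  have e1 : c * ∫⁻ ω, ENNReal.ofReal ((∑ i, ‖G i ω‖ ^ 2) ^ (q / 2)) ∂μ ≤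
      ∫⁻ x, ∫⁻ ω, ‖∑ i, (x i : ℂ) * G i ω‖ₑ ^ q ∂μ ∂γ := by
    rw [lintegral_lintegral_swap mG.aemeasurable, ← lintegral_const_mul _ mG2]
    refine lintegral_mono fun ω => ?_
    rw [mul_comm]
    exact (lintegral_gaussian_sum hq fun i => G i ω).1
  have e2 : ∫⁻ x, ∫⁻ ω, ‖∑ i, (x i : ℂ) * F i ω‖ₑ ^ p ∂μ ∂γ ≤
      D * ∫⁻ ω, ENNReal.ofReal ((∑ i, ‖F i ω‖ ^ 2) ^ (p / 2)) ∂μ := by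
    rw [lintegral_lintegral_swap mF.aemeasurable, ← lintegral_const_mul _ mF2]
    refine lintegral_mono fun ω => ?_
    rw [mul_comm D]
    exact (lintegral_gaussian_sum hp fun i => F i ω).2
  have mF3 : Measurable fun x : EuclideanSpace ℝ ι => ∫⁻ ω, ‖∑ i, (x i : ℂ) * F i ω‖ₑ ^ p ∂μ :=
    mF.lintegral_prod_right'
  have e3 : ∫⁻ x, ∫⁻ ω, ‖∑ i, (x i : ℂ) * G i ω‖ₑ ^ q ∂μ ∂γ ≤
      K * (D * ∫⁻ ω, ENNReal.ofReal ((∑ i, ‖F i ω‖ ^ 2) ^ (p / 2)) ∂μ) ^ (q / p) :=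
    calc _ ≤ ∫⁻ x, K * (∫⁻ ω, ‖∑ i, (x i : ℂ) * F i ω‖ₑ ^ p ∂μ) ^ (q / p) ∂γ :=
          lintegral_mono fun x => h x
      _ = K * ∫⁻ x, (∫⁻ ω, ‖∑ i, (x i : ℂ) * F i ω‖ₑ ^ p ∂μ) ^ (q / p) ∂γ :=
          lintegral_const_mul _ (mF3.pow_const _)
      _ ≤ K * (∫⁻ x, ∫⁻ ω, ‖∑ i, (x i : ℂ) * F i ω‖ₑ ^ p ∂μ ∂γ) ^ (q / p) := by
          gcongr
          exact lintegral_rpow_le_rpow_lintegral hθ hθ1 mF3.aemeasurable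
      _ ≤ _ := by gcongr
  have e4 := e1.trans e3
  rw [ENNReal.mul_rpow_of_nonneg _ _ hθ.le] at e4
  calc _ = c⁻¹ * (c * ∫⁻ ω, ENNReal.ofReal ((∑ i, ‖G i ω‖ ^ 2) ^ (q / 2)) ∂μ) := by
        rw [← mul_assoc, ENNReal.inv_mul_cancel hc0 hct, one_mul]
    _ ≤ _ := mul_le_mul_right e4 _
    _ = _ := by ring

end GaussianSums

section KernelSums

variable {n : ℕ} [IsProbabilityMeasure (sigmaS n)]

lemma qv_le_measure_qball {a : En n} (ha : ‖a‖ < 1) :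
    qv n (1 - ‖a‖) ≤ sigmaS n (qball a (2 * (1 - ‖a‖))) := by
  obtain ⟨η, hη1, -, hη2⟩ := exists_unit_direction a ha.le
  rw [← sigmaS_qball hη1, ← measure_inter_Sn]
  refine measure_mono fun ζ hζ => ?_
  have h1 := qd_le_add_dist (a := a) (b := η) (norm_eq_one_of_mem_Sn hζ.2).le
  have h2 : qd ζ η < 1 - ‖a‖ := hζ.1
  change qd ζ a < _
  linarith

lemma lintegral_kernel_mul_le_setLIntegral {a : En n} (ha : ‖a‖ < 1) {γ : ℝ} (hγ0 : 0 ≤ γ)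
    (hγ : 2 * (qN n : ℝ) ≤ 2 ^ γ) {w : En n → ℝ≥0∞} (hw : Measurable w) :
    ∫⁻ ζ, ENNReal.ofReal (((1 - ‖a‖) / qd ζ a) ^ γ) * w ζ ∂(sigmaS n) ≤
      2 * qN n ^ 2 * ∫⁻ ζ in qball a (2 * (1 - ‖a‖)), hlM w ζ ∂(sigmaS n) := by
  set A := ∫⁻ ζ, ENNReal.ofReal (((1 - ‖a‖) / qd ζ a) ^ γ) * w ζ ∂(sigmaS n) with hA
  set B := qball a (2 * (1 - ‖a‖)) with hB
  have hl : 0 < 1 - ‖a‖ := by linarith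
  have hv := qv_le_measure_qball ha
  have hv0 : sigmaS n B ≠ 0 := ((qv_pos hl).trans_le hv).ne'
  have hBm : MeasurableSet B := (isOpen_qball _ _).measurableSet
  have h1 : A * sigmaS n B ≤ (2 * qN n ^ 2 * ∫⁻ ζ in B, hlM w ζ ∂(sigmaS n)) * sigmaS n B := by
    calc A * sigmaS n B = ∫⁻ ζ in B, A ∂(sigmaS n) := by rw [setLIntegral_const]
      _ ≤ ∫⁻ ζ in B, 2 * qN n ^ 2 * qv n (1 - ‖a‖) * hlM w ζ ∂(sigmaS n) := by
          refine lintegral_mono_ae ?_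
          filter_upwards [ae_restrict_mem hBm, ae_restrict_of_ae (ae_mem_Sn n)] with ζ h1 h2
          exact lintegral_kernel_mul_le ha hγ0 hγ hw (norm_eq_one_of_mem_Sn h2) h1
      _ = 2 * qN n ^ 2 * qv n (1 - ‖a‖) * ∫⁻ ζ in B, hlM w ζ ∂(sigmaS n) :=
          lintegral_const_mul _ (measurable_hlM w)
      _ ≤ 2 * qN n ^ 2 * sigmaS n B * ∫⁻ ζ in B, hlM w ζ ∂(sigmaS n) := by gcongr
      _ = _ := by ring
  exact (ENNReal.mul_le_mul_iff_left hv0 (measure_ne_top _ _)).1 h1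

lemma exists_lintegral_sum_kernel_rpow_le (n : ℕ) [IsProbabilityMeasure (sigmaS n)] {γ s : ℝ}
    (hγ0 : 0 ≤ γ) (hγ : 2 * (qN n : ℝ) ≤ 2 ^ γ) (hs : 1 < s) :
    ∃ C : ℝ≥0∞, C ≠ ⊤ ∧ ∀ {ι : Type} (t : Finset ι) (c : ι → ℝ≥0) (a : ι → En n),
      (∀ i ∈ t, ‖a i‖ < 1) →
      ∫⁻ ζ, (∑ i ∈ t, c i * ENNReal.ofReal (((1 - ‖a i‖) / qd ζ (a i)) ^ γ)) ^ s ∂(sigmaS n) ≤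
        C * ∫⁻ ζ, (∑ i ∈ t, (qball (a i) (2 * (1 - ‖a i‖))).indicator
          (fun _ => (c i : ℝ≥0∞)) ζ) ^ s ∂(sigmaS n) := by
  have hs' : s.HolderConjugate (s / (s - 1)) := Real.HolderConjugate.conjExponent hs
  set s' := s / (s - 1) with hs'e
  obtain ⟨C, hC, H⟩ := exists_hlM_strong n hs'.symm.lt
  have hs0 : 0 < s := by linarith
  have hs'0 : 0 < s' := hs'.symm.pos
  refine ⟨(2 * qN n ^ 2 * C ^ (1 / s')) ^ s, by finiteness, fun {ι} t c a ha => ?_⟩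
  set Ψ : En n → ℝ≥0∞ := fun ζ => ∑ i ∈ t, c i * ENNReal.ofReal (((1 - ‖a i‖) / qd ζ (a i)) ^ γ)
    with hΨ
  set N : En n → ℝ≥0∞ := fun ζ => ∑ i ∈ t, (qball (a i) (2 * (1 - ‖a i‖))).indicator
          (fun _ => (c i : ℝ≥0∞)) ζ with hN
  have hqc : ∀ a : En n, Continuous fun ζ : En n => qd ζ a := fun a => by unfold qd; fun_prop
  have hkm : ∀ i, Measurable fun ζ : En n => ENNReal.ofReal (((1 - ‖a i‖) / qd ζ (a i)) ^ γ) :=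
    fun i => ((measurable_const.div (hqc (a i)).measurable).pow_const γ).ennreal_ofReal
  have hΨm : Measurable Ψ := Finset.measurable_fun_sum _ fun i _ => (hkm i).const_mul _
  have hNm : Measurable N := Finset.measurable_fun_sum _ fun i _ =>
    measurable_const.indicator (isOpen_qball _ _).measurableSet
  set K : ℝ≥0 := ∑ i ∈ t, c i with hK
  have hΨK : ∀ ζ ∈ Sn n, Ψ ζ ≤ K := by
    intro ζ hζ
    rw [hK, ENNReal.ofNNReal_finsetSum]
    refine Finset.sum_le_sum fun i hi => ?_
    refine mul_le_of_le_one_right' ?_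
    rw [ENNReal.ofReal_le_one]
    have h1 := one_sub_norm_le_qd (a := a i) (norm_eq_one_of_mem_Sn hζ).le
    have h2 : 0 < 1 - ‖a i‖ := by linarith [ha i hi]
    exact Real.rpow_le_one (div_nonneg h2.le (norm_nonneg _))
      ((div_le_one (h2.trans_le h1)).2 h1) hγ0
  have hSm : MeasurableSet (Sn n) := isCompact_Sn.isClosed.measurableSet
  set w : En n → ℝ≥0∞ := (Sn n).indicator fun ζ => Ψ ζ ^ (s - 1) with hw
  have hwm : Measurable w := (hΨm.pow_const _).indicator hSm
  have hwK : ∀ ζ, w ζ ≤ ((K ^ (s - 1) : ℝ≥0) : ℝ≥0∞) := by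
    intro ζ
    refine indicator_le (s := Sn n) (f := fun ζ => Ψ ζ ^ (s - 1))
      (g := fun _ => ((K ^ (s - 1) : ℝ≥0) : ℝ≥0∞)) (fun ζ hζ => ?_) ζ
    rw [ENNReal.coe_rpow_of_nonneg _ (by linarith : 0 ≤ s - 1)]
    exact ENNReal.rpow_le_rpow (hΨK ζ hζ) (by linarith)
  have hkwm : ∀ i, Measurable fun ζ : En n =>
      ENNReal.ofReal (((1 - ‖a i‖) / qd ζ (a i)) ^ γ) * w ζ := fun i => (hkm i).mul hwm
  have hNwm : ∀ i, Measurable fun ζ : En n => (qball (a i) (2 * (1 - ‖a i‖))).indicator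
      (fun _ => (c i : ℝ≥0∞)) ζ * hlM w ζ := fun i => (measurable_const.indicator
        (isOpen_qball _ _).measurableSet).mul (measurable_hlM w)
  set X := ∫⁻ ζ, Ψ ζ ^ s ∂(sigmaS n) with hX
  set Y := ∫⁻ ζ, N ζ ^ s ∂(sigmaS n) with hY
  have e1 : X = ∫⁻ ζ, Ψ ζ * w ζ ∂(sigmaS n) := by
    refine lintegral_congr_ae ?_
    filter_upwards [ae_mem_Sn n] with ζ hζ
    rw [hw, indicator_of_mem hζ]
    conv_lhs => rw [show s = 1 + (s - 1) by ring,
      ENNReal.rpow_add_of_nonneg _ _ zero_le_one (by linarith), ENNReal.rpow_one]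
  have e2 : ∫⁻ ζ, w ζ ^ s' ∂(sigmaS n) = X := by
    refine lintegral_congr_ae ?_
    filter_upwards [ae_mem_Sn n] with ζ hζ
    rw [hw, indicator_of_mem hζ, ← ENNReal.rpow_mul]
    congr 1
    rw [hs'e]; field_simp [(by linarith : s - 1 ≠ 0)]
  have hXt : X ≠ ⊤ := by
    refine ne_top_of_le_ne_top (b := (K : ℝ≥0∞) ^ s) (by finiteness) ?_
    calc X ≤ ∫⁻ ζ, (K : ℝ≥0∞) ^ s ∂(sigmaS n) := by
          refine lintegral_mono_ae ?_
          filter_upwards [ae_mem_Sn n] with ζ hζ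
          exact ENNReal.rpow_le_rpow (hΨK ζ hζ) hs0.le
      _ = _ := by simp
  have key : X ≤ 2 * qN n ^ 2 * C ^ (1 / s') * Y ^ (1 / s) * X ^ (1 / s') := by
    calc X = ∑ i ∈ t, c i * ∫⁻ ζ, ENNReal.ofReal (((1 - ‖a i‖) / qd ζ (a i)) ^ γ) * w ζ
            ∂(sigmaS n) := by
          rw [e1]
          simp only [hΨ, Finset.sum_mul, mul_assoc]
          rw [lintegral_finsetSum _ fun i _ => (hkwm i).const_mul _]
          exact Finset.sum_congr rfl fun i _ => lintegral_const_mul _ (hkwm i)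
      _ ≤ ∑ i ∈ t, c i * (2 * qN n ^ 2 *
            ∫⁻ ζ in qball (a i) (2 * (1 - ‖a i‖)), hlM w ζ ∂(sigmaS n)) := by
          refine Finset.sum_le_sum fun i hi => ?_
          gcongr
          exact lintegral_kernel_mul_le_setLIntegral (ha i hi) hγ0 hγ hwm
      _ = 2 * qN n ^ 2 * ∫⁻ ζ, N ζ * hlM w ζ ∂(sigmaS n) := by
          simp only [hN, Finset.sum_mul]
          rw [lintegral_finsetSum _ fun i _ => hNwm i, Finset.mul_sum]
          refine Finset.sum_congr rfl fun i _ => ?_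
          rw [← lintegral_indicator (isOpen_qball _ _).measurableSet, ← mul_assoc,
            mul_comm (c i : ℝ≥0∞), mul_assoc, ← lintegral_const_mul _
              ((measurable_hlM w).indicator (isOpen_qball _ _).measurableSet)]
          congr 1
          refine lintegral_congr fun ζ => ?_
          by_cases h : ζ ∈ qball (a i) (2 * (1 - ‖a i‖)) <;> simp [h]
      _ ≤ 2 * qN n ^ 2 * (Y ^ (1 / s) * (∫⁻ ζ, hlM w ζ ^ s' ∂(sigmaS n)) ^ (1 / s')) := by
          gcongr
          exact ENNReal.lintegral_mul_le_Lp_mul_Lq _ hs' hNm.aemeasurable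
            (measurable_hlM w).aemeasurable
      _ ≤ 2 * qN n ^ 2 * (Y ^ (1 / s) * (C * X) ^ (1 / s')) := by
          gcongr
          exact (H w hwm _ hwK).trans_eq (by rw [e2])
      _ = _ := by
          rw [ENNReal.mul_rpow_of_nonneg _ _ (by positivity)]; ring
  by_cases hX0 : X = 0
  · rw [hX0]; exact zero_le
  have h1 : X ^ (1 / s) ≤ 2 * qN n ^ 2 * C ^ (1 / s') * Y ^ (1 / s) := by
    have h2 : X ^ (1 / s) * X ^ (1 / s') ≤ 2 * qN n ^ 2 * C ^ (1 / s') * Y ^ (1 / s) * X ^ (1 / s') := by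
      rw [← ENNReal.rpow_add _ _ hX0 hXt, one_div, one_div, hs'.inv_add_inv_eq_one, ENNReal.rpow_one]
      rw [one_div, one_div] at key
      exact key
    refine (ENNReal.mul_le_mul_iff_left ?_ ?_).1 h2
    · exact (ENNReal.rpow_pos (pos_iff_ne_zero.2 hX0) hXt).ne'
    · finiteness
  calc X = (X ^ (1 / s)) ^ s := by rw [← ENNReal.rpow_mul, one_div, inv_mul_cancel₀ hs0.ne', ENNReal.rpow_one]
    _ ≤ (2 * qN n ^ 2 * C ^ (1 / s') * Y ^ (1 / s)) ^ s := ENNReal.rpow_le_rpow h1 hs0.le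
    _ = _ := by
      rw [ENNReal.mul_rpow_of_nonneg _ _ hs0.le, ← ENNReal.rpow_mul, one_div,
        one_div, inv_mul_cancel₀ hs0.ne', ENNReal.rpow_one]

end KernelSums

section PointwiseMaximal

variable {n : ℕ}

lemma one_sub_inner_ne_zero {a z : En n} (h : ‖a‖ * ‖z‖ < 1) : 1 - inner ℂ a z ≠ 0 := by
  intro h0
  have h1 : ‖inner ℂ a z‖ ≤ ‖a‖ * ‖z‖ := norm_inner_le_norm a z
  rw [← sub_eq_zero.1 h0, norm_one] at h1
  linarith

lemma differentiableOn_kernel {a : En n} {ρ : ℝ} (h : ‖a‖ * ρ < 1) (c : ℂ) (M : ℕ) :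
    DifferentiableOn ℂ (fun z => (c / (1 - inner ℂ a z)) ^ M) (ball 0 ρ) := by
  have hi : Differentiable ℂ fun z : En n => inner ℂ a z := (innerSL ℂ a).differentiable
  have h0 : ∀ z ∈ ball (0 : En n) ρ, 1 - inner ℂ a z ≠ 0 := by
    intro z hz
    refine one_sub_inner_ne_zero ?_
    have := mem_ball_zero_iff.1 hz
    nlinarith [norm_nonneg a]
  have h1 : DifferentiableOn ℂ (fun z : En n => 1 - inner ℂ a z) (ball 0 ρ) :=
    ((differentiable_const _).sub hi).differentiableOn
  have h2 : DifferentiableOn ℂ (fun z => c / (1 - inner ℂ a z)) (ball 0 ρ) := by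
    simp only [div_eq_mul_inv]
    exact (h1.inv h0).const_mul c
  exact h2.pow M

lemma norm_kernel (a z : En n) {l : ℝ} (hl : 0 ≤ l) (M : ℕ) :
    ‖((l : ℂ) / (1 - inner ℂ a z)) ^ M‖ = (l / qd z a) ^ M := by
  rw [norm_pow, norm_div, Complex.norm_real, Real.norm_of_nonneg hl, qd]

variable [IsProbabilityMeasure (sigmaS n)]

/-- The value of a holomorphic function at `a` is controlled by a maximal function on the shadow
of `a`. -/
lemma ofReal_norm_rpow_le_hlM {g : En n → ℂ} (hg : DifferentiableOn ℂ g (Bn n)) {s : ℝ}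
    (hs : 0 < s) {M : ℕ} (hM : 2 * (qN n : ℝ) ≤ 2 ^ (M * s)) {δ : ℝ} (hδ : 0 < δ) {a : En n}
    (ha : ‖a‖ ≤ 1 - 2 * δ) {ζ₀ : En n} (h₀ : ‖ζ₀‖ = 1) (hζ : ζ₀ ∈ qball a (2 * (1 - ‖a‖))) :
    ENNReal.ofReal (‖g a‖ ^ s) ≤ ENNReal.ofReal (2 ^ (M * s)) * 16 * qN n ^ 4 *
      hlM ((Sn n).indicator fun ζ => ENNReal.ofReal (‖g (((1 - δ : ℝ) : ℂ) • ζ)‖ ^ s)) ζ₀ := by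
  set R := 1 - δ with hR
  set ℓ := 1 - ‖a‖ with hℓ
  set x : En n → ℝ≥0∞ := (Sn n).indicator fun ζ => ENNReal.ofReal (‖g ((R : ℂ) • ζ)‖ ^ s) with hx
  have hna := norm_nonneg a
  have hR0 : 0 < R := by linarith
  have hR1 : R < 1 := by linarith
  have haR : ‖a‖ < R := by linarith
  have hl0 : 0 < ℓ := by linarith
  have hl1 : ℓ ≤ 1 := by linarith
  have hdil := differentiableOn_dilate hg hR0
  have hh : DifferentiableOn ℂ (fun z => g ((R : ℂ) • z) * ((ℓ : ℂ) / (1 - inner ℂ a z)) ^ M)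
      (ball 0 (1 / R)) := by
    refine hdil.mul (differentiableOn_kernel ?_ _ _)
    rw [mul_one_div, div_lt_one hR0]; exact haR
  set z₀ : En n := ((R⁻¹ : ℝ) : ℂ) • a with hz₀
  have hz₀n : ‖z₀‖ = ‖a‖ / R := by
    rw [hz₀, norm_smul, Complex.norm_real, Real.norm_of_nonneg (by positivity)]; field_simp
  have hz₀1 : ‖z₀‖ < 1 := by rw [hz₀n, div_lt_one hR0]; exact haR
  have hRz : (R : ℂ) • z₀ = a := by
    rw [hz₀, smul_smul, ← Complex.ofReal_mul, mul_inv_cancel₀ hR0.ne', Complex.ofReal_one, one_smul]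
  have hPE := qv_mul_norm_rpow_le ((one_lt_div hR0).2 hR1) hh hs hz₀1
  -- bounds on the point
  have hb1 : ℓ / 2 ≤ 1 - ‖z₀‖ := by
    rw [hz₀n, show (1 : ℝ) - ‖a‖ / R = (R - ‖a‖) / R by field_simp, le_div_iff₀ hR0]
    nlinarith
  have hv : qv n ℓ ≤ qN n * qv n (1 - ‖z₀‖) := by
    calc qv n ℓ = qv n (2 * (ℓ / 2)) := by congr 1; ring
      _ ≤ qN n * qv n (ℓ / 2) := qv_two_mul_le (by positivity)
      _ ≤ _ := by gcongr; exact qv_mono hb1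
  have hqd : qd z₀ a ≤ 2 * ℓ ∧ 0 < qd z₀ a := by
    have e : inner ℂ a z₀ = ((‖a‖ ^ 2 / R : ℝ) : ℂ) := by
      rw [hz₀, inner_smul_right, inner_self_eq_norm_sq_to_K]; push_cast; field_simp
      rfl
    have h1 : ‖a‖ ^ 2 / R < 1 := by rw [div_lt_one hR0]; nlinarith
    have h2 : ‖a‖ ^ 2 ≤ ‖a‖ ^ 2 / R := by
      rw [le_div_iff₀ hR0]; nlinarith [sq_nonneg ‖a‖]
    have h3 : qd z₀ a = 1 - ‖a‖ ^ 2 / R := by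
      rw [qd, e, ← Complex.ofReal_one, ← Complex.ofReal_sub, Complex.norm_real,
        Real.norm_of_nonneg (by linarith)]
    rw [h3]
    constructor <;> nlinarith
  have hga : ‖g a‖ ^ s ≤ 2 ^ (M * s) *
      ‖g ((R : ℂ) • z₀) * ((ℓ : ℂ) / (1 - inner ℂ a z₀)) ^ M‖ ^ s := by
    rw [hRz, norm_mul, norm_kernel _ _ hl0.le, Real.rpow_mul zero_le_two, Real.rpow_natCast,
      ← Real.mul_rpow (by positivity) (mul_nonneg (norm_nonneg _) (pow_nonneg (div_nonneg hl0.le hqd.2.le) _))]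
    refine Real.rpow_le_rpow (norm_nonneg _) ?_ hs.le
    have : 1 ≤ 2 ^ M * (ℓ / qd z₀ a) ^ M := by
      rw [← mul_pow]
      refine one_le_pow₀ ?_
      rw [← mul_div_assoc, le_div_iff₀ hqd.2, one_mul]; exact hqd.1
    calc ‖g a‖ = ‖g a‖ * 1 := (mul_one _).symm
      _ ≤ ‖g a‖ * (2 ^ M * (ℓ / qd z₀ a) ^ M) := by gcongr
      _ = _ := by ring
  -- the integral
  have hxm : Measurable x := by
    have hc : ContinuousOn (fun ζ => ENNReal.ofReal (‖g ((R : ℂ) • ζ)‖ ^ s)) (Sn n) := by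
      refine ENNReal.continuous_ofReal.comp_continuousOn ((hdil.continuousOn.mono ?_).norm.rpow_const
        fun _ _ => Or.inr hs.le)
      intro ζ hζ
      rw [mem_ball_zero_iff, norm_eq_one_of_mem_Sn hζ, one_lt_div hR0]; exact hR1
    classical
    rw [hx, ← piecewise_eq_indicator]
    exact hc.measurable_piecewise continuousOn_const isCompact_Sn.isClosed.measurableSet
  have hsub : sphere (0 : En n) 1 ⊆ ball 0 (1 / R) := by
    intro ζ hζ
    rw [mem_ball_zero_iff, mem_sphere_zero_iff_norm.1 hζ, one_lt_div hR0]; exact hR1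
  have h_int : ENNReal.ofReal (∫ ζ, ‖g ((R : ℂ) • ζ) * ((ℓ : ℂ) / (1 - inner ℂ a ζ)) ^ M‖ ^ s ∂(sigmaS n)) ≤
      2 * qN n ^ 2 * qv n ℓ * hlM x ζ₀ := by
    rw [ofReal_integral_eq_lintegral_ofReal]
    · calc _ ≤ ∫⁻ ζ, ENNReal.ofReal (((1 - ‖a‖) / qd ζ a) ^ (M * s)) * x ζ ∂(sigmaS n) := by
            refine lintegral_mono_ae ?_
            filter_upwards [ae_mem_Sn n] with ζ hζ
            have hq0 : 0 ≤ ℓ / qd ζ a := div_nonneg hl0.le (norm_nonneg _)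
            rw [hx, indicator_of_mem hζ, norm_mul, norm_kernel _ _ hl0.le,
              Real.mul_rpow (norm_nonneg _) (pow_nonneg hq0 _), mul_comm,
              ENNReal.ofReal_mul (by positivity), Real.rpow_mul hq0, Real.rpow_natCast]
        _ ≤ _ := lintegral_kernel_mul_le (by linarith) (by positivity) hM hxm h₀ hζ
    · exact ((hh.continuousOn.mono hsub).norm.rpow_const fun _ _ => Or.inr hs.le).integrable_sigmaS
    · exact Eventually.of_forall fun _ => Real.rpow_nonneg (norm_nonneg _) _
  have hvt : qv n (1 - ‖z₀‖) ≠ ⊤ := qv_ne_top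
  have hv0 : qv n (1 - ‖z₀‖) ≠ 0 := (qv_pos (by linarith)).ne'
  have hPE' : qv n (1 - ‖z₀‖) * ENNReal.ofReal
      (‖g ((R : ℂ) • z₀) * ((ℓ : ℂ) / (1 - inner ℂ a z₀)) ^ M‖ ^ s) ≤
      8 * qN n * (2 * qN n ^ 2 * (qN n * qv n (1 - ‖z₀‖)) * hlM x ζ₀) := by
    have := ENNReal.ofReal_le_ofReal hPE
    rw [ENNReal.ofReal_mul ENNReal.toReal_nonneg, ENNReal.ofReal_toReal hvt,
      ENNReal.ofReal_mul (by positivity), ENNReal.ofReal_mul (by positivity), ENNReal.ofReal_natCast,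
      ENNReal.ofReal_ofNat] at this
    refine this.trans ?_
    gcongr
    exact h_int.trans (by gcongr)
  have h3 : ENNReal.ofReal
      (‖g ((R : ℂ) • z₀) * ((ℓ : ℂ) / (1 - inner ℂ a z₀)) ^ M‖ ^ s) ≤ 16 * qN n ^ 4 * hlM x ζ₀ := by
    refine (ENNReal.mul_le_mul_iff_right hv0 hvt).1 (hPE'.trans_eq ?_)
    ring
  calc ENNReal.ofReal (‖g a‖ ^ s) ≤ _ := ENNReal.ofReal_le_ofReal hga
    _ = ENNReal.ofReal (2 ^ (M * s)) * _ := ENNReal.ofReal_mul (by positivity)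
    _ ≤ ENNReal.ofReal (2 ^ (M * s)) * (16 * qN n ^ 4 * hlM x ζ₀) := by gcongr
    _ = _ := by ring

end PointwiseMaximal

lemma exists_rpow_sum_range_le {ρ : ℝ≥0} (hρ : 1 < ρ) :
    ∃ D : ℝ≥0, ∀ (s : ℝ), 0 < s → ∀ (v : ℕ → ℝ≥0∞), (∀ m, v m ≤ ρ ^ m) → ∀ (W : ℝ≥0∞) (N : ℕ),
      (∀ m < N, v m ≠ 0 → ((ρ : ℝ≥0∞) ^ m) ^ s ≤ W) →
      (∑ m ∈ Finset.range N, v m) ^ s ≤ (D : ℝ≥0∞) ^ s * W := by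
  have hgeo : ∀ k : ℕ, ∑ m ∈ Finset.range (k + 1), ρ ^ m ≤ (ρ / (ρ - 1)) * ρ ^ k := by
    intro k
    have h1 : (∑ m ∈ Finset.range (k + 1), (ρ : ℝ) ^ m) ≤ (ρ / (ρ - 1)) * ρ ^ k := by
      have h : (1 : ℝ) < ρ := by exact_mod_cast hρ
      rw [geom_sum_eq h.ne', div_mul_eq_mul_div]
      refine div_le_div_of_nonneg_right ?_ (by linarith)
      rw [pow_succ]; linarith
    rw [← NNReal.coe_le_coe]; push_cast [NNReal.coe_sub hρ.le]; exact h1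
  refine ⟨ρ / (ρ - 1), fun s hs v hv W N => ?_⟩
  induction N with
  | zero => intro _; simp [hs]
  | succ k ih =>
    intro h
    by_cases hk : v k = 0
    · rw [Finset.sum_range_succ, hk, add_zero]
      exact ih fun m hm => h m (hm.trans k.lt_succ_self)
    · have h1 : ∑ m ∈ Finset.range (k + 1), v m ≤ ((ρ / (ρ - 1) : ℝ≥0) : ℝ≥0∞) * ρ ^ k :=
        (Finset.sum_le_sum fun m _ => hv m).trans (by exact_mod_cast hgeo k)
      calc _ ≤ (((ρ / (ρ - 1) : ℝ≥0) : ℝ≥0∞) * ρ ^ k) ^ s := ENNReal.rpow_le_rpow h1 hs.le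
        _ = _ := ENNReal.mul_rpow_of_nonneg _ _ hs.le
        _ ≤ _ := by gcongr; exact h k k.lt_succ_self hk

section Covering

variable {n : ℕ} [IsProbabilityMeasure (sigmaS n)]

lemma exists_finset_shadow_cover {Ω : Set (En n)} {δ : ℝ} (hδ : 0 < δ)
    (hΩ : ∀ a ∈ Ω, ‖a‖ ≤ 1 - δ) :
    ∃ A : Finset (En n), (∀ a ∈ A, a ∈ Ω) ∧
      (A : Set (En n)).PairwiseDisjoint (fun a => qball a (2 * (1 - ‖a‖)) ∩ Sn n) ∧
      ∀ z ∈ Ω, ∃ a ∈ A, qd z a ≤ 12 * (1 - ‖a‖) := by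
  have hmeas : ∀ a ∈ Ω, qv n δ ≤ sigmaS n (qball a (2 * (1 - ‖a‖)) ∩ Sn n) := by
    intro a ha
    have h := hΩ a ha
    rw [measure_inter_Sn]
    exact (qv_mono (by linarith)).trans (qv_le_measure_qball (by linarith))
  obtain ⟨u, hu, hdis, hcov⟩ := Vitali.exists_disjoint_subfamily_covering_enlargement
    (fun a : En n => qball a (2 * (1 - ‖a‖)) ∩ Sn n) Ω (fun a => 1 - ‖a‖) 2 one_lt_two
    (fun a ha => by linarith [hΩ a ha]) 1 (fun a _ => by linarith [norm_nonneg a])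
    (fun a ha => nonempty_of_measure_ne_zero ((qv_pos (n := n) hδ).trans_le (hmeas a ha)).ne')
  have hfin : u.Finite := by
    have h := Measure.finite_const_le_meas_of_disjoint_iUnion (sigmaS n) (ι := u)
      (As := fun a => qball (a : En n) (2 * (1 - ‖(a : En n)‖)) ∩ Sn n) (qv_pos (n := n) hδ)
      (fun a => (isOpen_qball _ _).measurableSet.inter isCompact_Sn.isClosed.measurableSet)
      (fun a b hab => hdis a.2 b.2 fun e => hab (Subtype.ext e)) (measure_ne_top _ _)
    have h2 : {i : u | qv n δ ≤ sigmaS n (qball (i : En n) (2 * (1 - ‖(i : En n)‖)) ∩ Sn n)} = univ :=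
      eq_univ_of_forall fun i => hmeas i (hu i.2)
    rw [h2] at h
    exact Set.finite_coe_iff.1 (Set.finite_univ_iff.1 h)
  refine ⟨hfin.toFinset, fun a ha => hu (hfin.mem_toFinset.1 ha), by simpa using hdis, ?_⟩
  intro z hz
  obtain ⟨b, hb, ⟨ζ, hζz, hζb⟩, hle⟩ := hcov z hz
  refine ⟨b, hfin.mem_toFinset.2 hb, ?_⟩
  have h1 : qd ζ z < 2 * (1 - ‖z‖) := hζz.1
  have h2 : qd ζ b < 2 * (1 - ‖b‖) := hζb.1
  have h3 := qd_triangle (norm_eq_one_of_mem_Sn hζz.2) (a := z) (c := b)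
    (by linarith [hΩ z hz]) (by linarith [hΩ b (hu hb)])
  rw [qd_comm z ζ] at h3
  have h4 : 1 - ‖z‖ ≤ 2 * (1 - ‖b‖) := hle
  linarith

end Covering

lemma ContinuousOn.measurable_indicator_Sn {n : ℕ} {E : Type*} [TopologicalSpace E]
    [MeasurableSpace E] [BorelSpace E] [Zero E] {A : En n → E} (hA : ContinuousOn A (Sn n)) :
    Measurable ((Sn n).indicator A) := by
  classical
  rw [← piecewise_eq_indicator]
  exact hA.measurable_piecewise continuousOn_const isCompact_Sn.isClosed.measurableSet

lemma sq_add_one_rpow_le {G s : ℝ} (hG : 0 ≤ G) (hs : 0 ≤ s) :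
    (G ^ 2 + 1) ^ s ≤ 2 ^ s * (G ^ s + 1) ^ 2 := by
  have h0 := Real.rpow_nonneg hG s
  have h2 : (0 : ℝ) ≤ 2 ^ s := by positivity
  rcases le_total G 1 with h | h
  · calc (G ^ 2 + 1) ^ s ≤ 2 ^ s := Real.rpow_le_rpow (by positivity) (by nlinarith) hs
      _ ≤ _ := le_mul_of_one_le_right h2 (by nlinarith)
  · calc (G ^ 2 + 1) ^ s ≤ (2 * G ^ 2) ^ s := Real.rpow_le_rpow (by positivity) (by nlinarith) hs
      _ = 2 ^ s * (G ^ s) ^ 2 := by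
        rw [Real.mul_rpow zero_le_two (by positivity), ← Real.rpow_natCast, ← Real.rpow_natCast,
          ← Real.rpow_mul hG, ← Real.rpow_mul hG, mul_comm s]
      _ ≤ _ := by gcongr; linarith

lemma ENNReal.sum_rpow_le_sum_rpow {ι : Type*} (t : Finset ι) (f : ι → ℝ≥0∞) {θ : ℝ}
    (h0 : 0 < θ) (h1 : θ ≤ 1) : (∑ i ∈ t, f i) ^ θ ≤ ∑ i ∈ t, f i ^ θ := by
  classical
  induction t using Finset.induction_on with
  | empty => simp [h0]
  | insert a t ha ih =>
    rw [Finset.sum_insert ha, Finset.sum_insert ha]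
    exact (ENNReal.rpow_add_le_add_rpow _ _ h0.le h1).trans (by gcongr)

section TestFunctions

variable {n : ℕ} [IsProbabilityMeasure (sigmaS n)]

lemma lintegral_hlM_add_one_sq_le {r : ℝ} (hr : 0 < r) {A : ℝ≥0∞} (hA : A ≠ ⊤) :
    ∃ C : ℝ≥0∞, C ≠ ⊤ ∧ ∀ h : En n → ℂ, ContinuousOn h (Sn n) →
      ∫⁻ ζ, (A * hlM ((Sn n).indicator fun ζ => ENNReal.ofReal (‖h ζ‖ ^ (r / 2))) ζ + 1) ^ (2 : ℝ)
        ∂(sigmaS n) ≤ C * ∫⁻ ζ, ENNReal.ofReal ((‖h ζ‖ ^ 2 + 1) ^ (r / 2)) ∂(sigmaS n) := by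
  obtain ⟨C, hC, H⟩ := exists_hlM_strong n one_lt_two
  refine ⟨2 * (A ^ (2 : ℝ) * C + 1), by finiteness, fun h hh => ?_⟩
  set x := (Sn n).indicator fun ζ => ENNReal.ofReal (‖h ζ‖ ^ (r / 2)) with hx
  set I := ∫⁻ ζ, ENNReal.ofReal ((‖h ζ‖ ^ 2 + 1) ^ (r / 2)) ∂(sigmaS n) with hI
  have hc : ContinuousOn (fun ζ => ‖h ζ‖ ^ (r / 2)) (Sn n) :=
    hh.norm.rpow_const fun _ _ => Or.inr (by positivity)
  have hxm : Measurable x :=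
    (ENNReal.continuous_ofReal.comp_continuousOn hc).measurable_indicator_Sn
  obtain ⟨K, hK⟩ := isCompact_Sn.exists_bound_of_continuousOn hc
  have hxK : ∀ ζ, x ζ ≤ (K.toNNReal : ℝ≥0∞) := by
    intro ζ
    refine indicator_le (s := Sn n) (f := fun ζ => ENNReal.ofReal (‖h ζ‖ ^ (r / 2)))
      (g := fun _ => (K.toNNReal : ℝ≥0∞)) (fun ζ hζ => ?_) ζ
    exact ENNReal.ofReal_le_ofReal ((le_abs_self _).trans (hK ζ hζ))
  have h1 : 1 ≤ I := by
    calc (1 : ℝ≥0∞) = ∫⁻ _, 1 ∂(sigmaS n) := by simp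
      _ ≤ I := by
        refine lintegral_mono fun ζ => ?_
        rw [ENNReal.one_le_ofReal]
        exact Real.one_le_rpow (by nlinarith [sq_nonneg ‖h ζ‖]) (by positivity)
  have h2 : ∫⁻ ζ, x ζ ^ (2 : ℝ) ∂(sigmaS n) ≤ I := by
    refine lintegral_mono_ae ?_
    filter_upwards [ae_mem_Sn n] with ζ hζ
    rw [hx, indicator_of_mem hζ, ENNReal.ofReal_rpow_of_nonneg (by positivity) zero_le_two,
      ← Real.rpow_mul (norm_nonneg _)]
    refine ENNReal.ofReal_le_ofReal ?_
    calc ‖h ζ‖ ^ (r / 2 * 2) = (‖h ζ‖ ^ 2) ^ (r / 2) := by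
          rw [mul_comm, Real.rpow_mul (norm_nonneg _), Real.rpow_two]
      _ ≤ _ := Real.rpow_le_rpow (by positivity) (by linarith) (by positivity)
  calc _ ≤ ∫⁻ ζ, 2 * (A ^ (2 : ℝ) * hlM x ζ ^ (2 : ℝ) + 1) ∂(sigmaS n) := by
        refine lintegral_mono fun ζ => ?_
        refine (ENNReal.rpow_add_le_mul_rpow_add_rpow _ _ one_le_two).trans_eq ?_
        rw [ENNReal.mul_rpow_of_nonneg _ _ zero_le_two, ENNReal.one_rpow]
        norm_num
    _ = 2 * (A ^ (2 : ℝ) * ∫⁻ ζ, hlM x ζ ^ (2 : ℝ) ∂(sigmaS n) + 1) := by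
        have hm : Measurable fun ζ => hlM x ζ ^ (2 : ℝ) := (measurable_hlM x).pow_const _
        rw [lintegral_const_mul _ ((hm.const_mul _).add_const _), lintegral_add_right _ measurable_const,
          lintegral_const_mul _ hm]
        simp
    _ ≤ 2 * (A ^ (2 : ℝ) * (C * I) + I) := by
        gcongr
        exact (H x hxm _ hxK).trans (by gcongr)
    _ = _ := by ring

lemma exists_lintegral_test_sum_le (n : ℕ) [IsProbabilityMeasure (sigmaS n)] {p r : ℝ} (hp : 0 < p)
    (hr : 0 < r) :
    ∃ b : ℕ, ∃ C : ℝ≥0∞, C ≠ ⊤ ∧ ∀ {κ : ℝ}, κ * p = r → ∀ {g : En n → ℂ},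
      DifferentiableOn ℂ g (Bn n) → ∀ {δ : ℝ}, 0 < δ → δ < 1 / 2 → ∀ (N : ℕ)
      (A : ℕ → Finset (En n)),
      (∀ m, ∀ a ∈ A m, ‖a‖ ≤ 1 - 2 * δ ∧ 2 ^ m ≤ (‖g a‖ ^ 2 + 1) ^ κ) →
      (∀ m, (A m : Set (En n)).PairwiseDisjoint (fun a => qball a (2 * (1 - ‖a‖)) ∩ Sn n)) →
      ∫⁻ ζ, ENNReal.ofReal ((∑ i ∈ (Finset.range N).sigma A,
          2 ^ i.1 * ((1 - ‖i.2‖) / qd ζ i.2) ^ (2 * b)) ^ (p / 2)) ∂(sigmaS n) ≤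
        C * ∫⁻ ζ, ENNReal.ofReal ((‖g (((1 - δ : ℝ) : ℂ) • ζ)‖ ^ 2 + 1) ^ (r / 2)) ∂(sigmaS n) := by
  set θ := min 1 (p / 4) with hθ
  have hθ0 : 0 < θ := by positivity
  have hθ1 : θ ≤ 1 := min_le_left _ _
  set S := p / 2 / θ with hS
  have hS1 : 1 < S := by
    rw [hS, one_lt_div hθ0]; exact (min_le_right _ _).trans_lt (by linarith)
  have hS0 : 0 < S := by linarith
  have hSθ : θ * S = p / 2 := by rw [hS]; field_simp
  have htwo : 2 * (qN n : ℝ) ≤ 2 ^ (2 * qN n : ℝ) := by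
    have : 2 * qN n < 2 ^ (2 * qN n) := Nat.lt_two_pow_self
    exact_mod_cast this.le
  obtain ⟨b, hb⟩ := exists_nat_ge (qN n / θ)
  obtain ⟨M, hM⟩ := exists_nat_ge (2 * qN n / (r / 2))
  rw [div_le_iff₀ hθ0] at hb
  rw [div_le_iff₀ (by positivity)] at hM
  have hbγ : 2 * (qN n : ℝ) ≤ 2 ^ (2 * b * θ) :=
    htwo.trans (Real.rpow_le_rpow_of_exponent_le one_le_two (by linarith))
  have hMγ : 2 * (qN n : ℝ) ≤ 2 ^ (M * (r / 2)) :=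
    htwo.trans (Real.rpow_le_rpow_of_exponent_le one_le_two hM)
  set ρ : ℝ≥0 := 2 ^ θ with hρ
  have hρ1 : 1 < ρ := NNReal.one_lt_rpow one_lt_two hθ0
  obtain ⟨D, hD⟩ := exists_rpow_sum_range_le hρ1
  obtain ⟨C₁, hC₁, H₁⟩ := exists_lintegral_sum_kernel_rpow_le n (by positivity) hbγ hS1
  have hAt : ENNReal.ofReal (2 ^ (M * (r / 2))) * 16 * (qN n : ℝ≥0∞) ^ 4 ≠ ⊤ := by finiteness
  obtain ⟨C₂, hC₂, H₂⟩ := lintegral_hlM_add_one_sq_le (n := n) hr hAt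
  set E := ENNReal.ofReal (2 ^ (M * (r / 2))) * 16 * (qN n : ℝ≥0∞) ^ 4 with hE
  refine ⟨b, C₁ * ((D : ℝ≥0∞) ^ S * ENNReal.ofReal (2 ^ (r / 2)) * C₂), by finiteness,
    fun {κ} hκ {g} hg {δ} hδ hδ2 N A hA hdis => ?_⟩
  set h : En n → ℂ := fun ζ => g (((1 - δ : ℝ) : ℂ) • ζ) with hh
  set x := (Sn n).indicator fun ζ => ENNReal.ofReal (‖h ζ‖ ^ (r / 2)) with hx
  have hR0 : 0 < 1 - δ := by linarith
  have hhc : ContinuousOn h (Sn n) := by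
    refine (differentiableOn_dilate hg hR0).continuousOn.mono fun ζ hζ => ?_
    rw [mem_ball_zero_iff, norm_eq_one_of_mem_Sn hζ, one_lt_div hR0]; linarith
  have hlt : ∀ m, ∀ a ∈ A m, ‖a‖ < 1 := fun m a ha => by linarith [(hA m a ha).1]
  have hρm : ∀ m : ℕ, ((ρ : ℝ≥0∞) ^ m) = ENNReal.ofReal ((2 ^ m : ℝ) ^ θ) := by
    intro m
    rw [hρ, ← ENNReal.coe_pow, ENNReal.ofReal, ENNReal.coe_inj, ← NNReal.coe_inj,
      Real.coe_toNNReal _ (by positivity)]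
    push_cast
    rw [← Real.rpow_natCast, ← Real.rpow_natCast, ← Real.rpow_mul zero_le_two,
      ← Real.rpow_mul zero_le_two, mul_comm]
  calc _ ≤ ∫⁻ ζ, (∑ i ∈ (Finset.range N).sigma A, ((ρ ^ i.1 : ℝ≥0) : ℝ≥0∞) *
          ENNReal.ofReal (((1 - ‖i.2‖) / qd ζ i.2) ^ (2 * b * θ))) ^ S ∂(sigmaS n) := by
        refine lintegral_mono fun ζ => ?_
        have hk : ∀ i ∈ (Finset.range N).sigma A, 0 ≤ (1 - ‖i.2‖) / qd ζ i.2 := fun i hi =>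
          div_nonneg (by linarith [hlt _ _ (Finset.mem_sigma.1 hi).2]) (norm_nonneg _)
        have hk2 : ∀ i ∈ (Finset.range N).sigma A,
            0 ≤ (2 : ℝ) ^ i.1 * ((1 - ‖i.2‖) / qd ζ i.2) ^ (2 * b) := fun i hi =>
          mul_nonneg (by positivity) (pow_nonneg (hk i hi) _)
        rw [← ENNReal.ofReal_rpow_of_nonneg (Finset.sum_nonneg hk2) (by positivity), ← hSθ,
          ENNReal.rpow_mul, ENNReal.ofReal_sum_of_nonneg hk2]
        refine ENNReal.rpow_le_rpow ((ENNReal.sum_rpow_le_sum_rpow _ _ hθ0 hθ1).trans_eq ?_) hS0.le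
        refine Finset.sum_congr rfl fun i hi => ?_
        rw [ENNReal.ofReal_rpow_of_nonneg (hk2 i hi) hθ0.le, Real.mul_rpow (by positivity)
          (pow_nonneg (hk i hi) _), ENNReal.ofReal_mul (by positivity), ENNReal.coe_pow, hρm,
          Real.rpow_mul (hk i hi)]
        congr 3
        rw [← Real.rpow_natCast]; push_cast; rfl
    _ ≤ C₁ * ∫⁻ ζ, (∑ i ∈ (Finset.range N).sigma A, (qball i.2 (2 * (1 - ‖i.2‖))).indicator
          (fun _ => ((ρ ^ i.1 : ℝ≥0) : ℝ≥0∞)) ζ) ^ S ∂(sigmaS n) :=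
        H₁ ((Finset.range N).sigma A) (fun i => ρ ^ i.1) (fun i => i.2)
          fun i hi => hlt _ _ (Finset.mem_sigma.1 hi).2
    _ ≤ C₁ * ∫⁻ ζ, (D : ℝ≥0∞) ^ S * (ENNReal.ofReal (2 ^ (r / 2)) * (E * hlM x ζ + 1) ^ (2 : ℝ))
          ∂(sigmaS n) := by
        gcongr C₁ * ?_
        refine lintegral_mono_ae ?_
        filter_upwards [ae_mem_Sn n] with ζ hζ
        rw [Finset.sum_sigma]
        refine hD S hS0 _ (fun m => ?_) _ N fun m _ hm0 => ?_
        · by_cases hex : ∃ a ∈ A m, ζ ∈ qball a (2 * (1 - ‖a‖))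
          · obtain ⟨a, ha, haζ⟩ := hex
            rw [Finset.sum_eq_single_of_mem a ha]
            · exact (indicator_le_self' (fun _ _ => zero_le) ζ).trans_eq (by simp)
            · intro c hc hca
              refine indicator_of_notMem (fun hcζ => ?_) _
              exact disjoint_left.1 (hdis m hc ha hca) ⟨hcζ, hζ⟩ ⟨haζ, hζ⟩
          · push Not at hex
            rw [Finset.sum_eq_zero fun a ha => indicator_of_notMem (hex a ha) _]
            exact zero_le
        · obtain ⟨a, ha, ha0⟩ := Finset.exists_ne_zero_of_sum_ne_zero hm0
          have haζ := mem_of_indicator_ne_zero ha0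
          have hpt := ofReal_norm_rpow_le_hlM hg (by positivity : 0 < r / 2) hMγ hδ (hA m a ha).1
            (norm_eq_one_of_mem_Sn hζ) haζ
          calc ((ρ : ℝ≥0∞) ^ m) ^ S = ENNReal.ofReal ((2 ^ m : ℝ) ^ (p / 2)) := by
                rw [hρm, ENNReal.ofReal_rpow_of_nonneg (by positivity) hS0.le,
                  ← Real.rpow_mul (by positivity), hSθ]
            _ ≤ ENNReal.ofReal (2 ^ (r / 2) * (‖g a‖ ^ (r / 2) + 1) ^ 2) := by
                refine ENNReal.ofReal_le_ofReal ?_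
                refine le_trans ?_ (sq_add_one_rpow_le (norm_nonneg _) (by positivity))
                calc ((2 : ℝ) ^ m) ^ (p / 2) ≤ ((‖g a‖ ^ 2 + 1) ^ κ) ^ (p / 2) :=
                      Real.rpow_le_rpow (by positivity) (hA m a ha).2 (by positivity)
                  _ = _ := by
                      rw [← Real.rpow_mul (by positivity)]; congr 1; rw [← hκ]; ring
            _ ≤ _ := by
                rw [ENNReal.ofReal_mul (by positivity), ENNReal.ofReal_pow (by positivity),
                  ENNReal.ofReal_add (by positivity) zero_le_one, ENNReal.ofReal_one]
                gcongr
                rw [ENNReal.rpow_two]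
                gcongr
    _ = C₁ * ((D : ℝ≥0∞) ^ S * (ENNReal.ofReal (2 ^ (r / 2)) *
          ∫⁻ ζ, (E * hlM x ζ + 1) ^ (2 : ℝ) ∂(sigmaS n))) := by
        have hm : Measurable fun ζ => (E * hlM x ζ + 1) ^ (2 : ℝ) :=
          (((measurable_hlM x).const_mul _).add_const _).pow_const _
        rw [lintegral_const_mul _ (hm.const_mul _), lintegral_const_mul _ hm]
    _ ≤ C₁ * ((D : ℝ≥0∞) ^ S * (ENNReal.ofReal (2 ^ (r / 2)) * (C₂ *
          ∫⁻ ζ, ENNReal.ofReal ((‖h ζ‖ ^ 2 + 1) ^ (r / 2)) ∂(sigmaS n)))) := by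
        gcongr
        exact H₂ h hhc
    _ = _ := by ring

end TestFunctions

section TestFamily

/-- Test functions whose square function dominates a power of `g` inside a ball, with controlled
`L^p`-norm on the sphere. -/
lemma exists_test_family (n : ℕ) [IsProbabilityMeasure (sigmaS n)] {p r : ℝ} (hp : 0 < p)
    (hr : 0 < r) :
    ∃ c : ℝ, 0 < c ∧ ∃ C : ℝ≥0∞, C ≠ ⊤ ∧ ∀ {κ : ℝ}, κ * p = r → ∀ {g : En n → ℂ},
      DifferentiableOn ℂ g (Bn n) → ∀ {δ : ℝ}, 0 < δ → δ < 1 / 2 →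
      ∃ (t : Finset (Σ _ : ℕ, En n)) (F : (Σ _ : ℕ, En n) → En n → ℂ),
      (∀ i ∈ t, DifferentiableOn ℂ (F i) (ball 0 (1 / (1 - δ)))) ∧
      (∀ z, ‖z‖ ≤ 1 - 2 * δ → c * (‖g z‖ ^ 2 + 1) ^ κ ≤ ∑ i ∈ t, ‖F i z‖ ^ 2) ∧
      ∫⁻ ζ, ENNReal.ofReal ((∑ i ∈ t, ‖F i ζ‖ ^ 2) ^ (p / 2)) ∂(sigmaS n) ≤
        C * ∫⁻ ζ, ENNReal.ofReal ((‖g (((1 - δ : ℝ) : ℂ) • ζ)‖ ^ 2 + 1) ^ (r / 2)) ∂(sigmaS n) := by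
  obtain ⟨b, C, hC, H⟩ := exists_lintegral_test_sum_le n hp hr
  refine ⟨((12 : ℝ) ^ (2 * b))⁻¹ / 2, by positivity, C, hC, fun {κ} hκ {g} hg {δ} hδ hδ2 => ?_⟩
  have hκ0 : 0 < κ := by
    by_contra h
    nlinarith [mul_nonneg (sub_nonneg.2 (not_lt.1 h)) hp.le]
  choose A hA1 hA2 hA3 using fun m : ℕ => exists_finset_shadow_cover
    (Ω := {a : En n | ‖a‖ ≤ 1 - 2 * δ ∧ 2 ^ m ≤ (‖g a‖ ^ 2 + 1) ^ κ}) (δ := 2 * δ) (by positivity)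
    (fun a ha => ha.1)
  have hKc : ContinuousOn g (closedBall 0 (1 - 2 * δ)) :=
    hg.continuousOn.mono (closedBall_subset_ball (by linarith))
  obtain ⟨B, hB⟩ := (isCompact_closedBall (0 : En n) (1 - 2 * δ)).exists_bound_of_continuousOn hKc
  obtain ⟨N, hN⟩ := pow_unbounded_of_one_lt ((B ^ 2 + 1) ^ κ) (one_lt_two (α := ℝ))
  have hlt : ∀ m, ∀ a ∈ A m, ‖a‖ ≤ 1 - 2 * δ := fun m a ha => (hA1 m a ha).1
  have hnorm : ∀ i ∈ (Finset.range N).sigma A, ∀ z : En n,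
      ‖(((√2 ^ i.1 : ℝ)) : ℂ) * ((((1 - ‖i.2‖ : ℝ)) : ℂ) / (1 - inner ℂ i.2 z)) ^ b‖ ^ 2 =
        2 ^ i.1 * ((1 - ‖i.2‖) / qd z i.2) ^ (2 * b) := by
    intro i hi z
    have h1 := hlt _ _ (Finset.mem_sigma.1 hi).2
    rw [norm_mul, norm_kernel _ _ (by linarith), Complex.norm_real,
      Real.norm_of_nonneg (by positivity), mul_pow, ← pow_mul, ← pow_mul, mul_comm i.1 2, pow_mul,
      Real.sq_sqrt zero_le_two, mul_comm b 2]
  refine ⟨(Finset.range N).sigma A, fun i z =>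
    (((√2 ^ i.1 : ℝ)) : ℂ) * ((((1 - ‖i.2‖ : ℝ)) : ℂ) / (1 - inner ℂ i.2 z)) ^ b, ?_, ?_, ?_⟩
  · intro i hi
    have h1 := hlt _ _ (Finset.mem_sigma.1 hi).2
    refine (differentiableOn_kernel ?_ _ _).const_mul _
    rw [mul_one_div, div_lt_one (by linarith)]; linarith
  · intro z hz
    obtain ⟨m, hm1, hm2⟩ := exists_nat_pow_near (x := (‖g z‖ ^ 2 + 1) ^ κ) (y := (2 : ℝ))
      (Real.one_le_rpow (by nlinarith [sq_nonneg ‖g z‖]) hκ0.le) one_lt_two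
    obtain ⟨a, ha, haz⟩ := hA3 m z ⟨hz, hm1⟩
    have hmN : m < N := by
      have h1 : (‖g z‖ ^ 2 + 1) ^ κ ≤ (B ^ 2 + 1) ^ κ := by
        have := hB z (mem_closedBall_zero_iff.2 hz)
        exact Real.rpow_le_rpow (by positivity) (by gcongr) hκ0.le
      exact (pow_lt_pow_iff_right₀ one_lt_two).1 (hm1.trans_lt (h1.trans_lt hN))
    have hi : (⟨m, a⟩ : Σ _ : ℕ, En n) ∈ (Finset.range N).sigma A :=
      Finset.mem_sigma.2 ⟨Finset.mem_range.2 hmN, ha⟩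
    refine le_trans ?_ (Finset.single_le_sum (fun i _ => sq_nonneg _) hi)
    rw [hnorm _ hi]
    have hal : 0 < 1 - ‖a‖ := by linarith [hlt m a ha]
    have hq : 0 < qd z a := hal.trans_le (one_sub_norm_le_qd (by linarith))
    have h12 : (12 : ℝ)⁻¹ ≤ (1 - ‖a‖) / qd z a := by
      rw [le_div_iff₀ hq]; linarith
    calc ((12 : ℝ) ^ (2 * b))⁻¹ / 2 * (‖g z‖ ^ 2 + 1) ^ κ
        ≤ ((12 : ℝ) ^ (2 * b))⁻¹ / 2 * 2 ^ (m + 1) := by gcongr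
      _ = 2 ^ m * (12 : ℝ)⁻¹ ^ (2 * b) := by rw [pow_succ, inv_pow]; ring
      _ ≤ _ := by gcongr
  · refine le_trans (le_of_eq (lintegral_congr fun ζ => ?_)) (H hκ hg hδ hδ2 N A (fun m a ha => hA1 m a ha) hA2)
    rw [Finset.sum_congr rfl fun i hi => hnorm i hi ζ]

end TestFamily

section Growth

variable {n : ℕ} {p q r : ℝ} {f g : En n → ℂ}

lemma continuousOn_Sn_of_differentiableOn_ball {ρ : ℝ} (hρ : 1 < ρ)
    (hf : DifferentiableOn ℂ f (ball 0 ρ)) : ContinuousOn f (Sn n) :=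
  hf.continuousOn.mono fun z hz => by
    rw [mem_ball_zero_iff, norm_eq_one_of_mem_Sn hz]; exact hρ

/-- A regularized integral mean which is at least `1`. -/
def regMean (n : ℕ) (r R : ℝ) (g : En n → ℂ) : ℝ :=
  ∫ ζ, (‖g ((R : ℂ) • ζ)‖ ^ 2 + 1) ^ (r / 2) ∂(sigmaS n)

lemma continuousOn_regMean_integrand (r : ℝ) {s : Set (En n)} (hg : ContinuousOn g s) :
    ContinuousOn (fun z => (‖g z‖ ^ 2 + 1) ^ (r / 2)) s := by
  have h : ContinuousOn (fun z => ‖g z‖ ^ 2 + 1) s := (hg.norm.pow 2).add continuousOn_const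
  exact h.rpow_const fun _ _ => Or.inl (by positivity)

variable [IsProbabilityMeasure (sigmaS n)]

lemma pMean_le_pMean_one {ρ R : ℝ} (hρ : 1 < ρ) (hf : DifferentiableOn ℂ f (ball 0 ρ)) (hp : 0 < p)
    (hR : 0 ≤ R) (hR1 : R ≤ 1) : pMean n p R f ≤ pMean n p 1 f := by
  have hρ0 : 0 < ρ := one_pos.trans hρ
  have hf' : DifferentiableOn ℂ (fun z : En n => f ((ρ : ℂ) • z)) (Bn n) := by
    refine hf.comp (by fun_prop) fun z hz => ?_
    rw [Bn, mem_ball_zero_iff] at hz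
    rw [mem_ball_zero_iff, norm_smul, Complex.norm_real, Real.norm_of_nonneg hρ0.le]
    nlinarith
  have e : ∀ x : ℝ, pMean n p (x / ρ) (fun z : En n => f ((ρ : ℂ) • z)) = pMean n p x f := by
    intro x
    have : (ρ : ℂ) ≠ 0 := by exact_mod_cast hρ0.ne'
    simp only [pMean, smul_smul]
    push_cast
    simp only [mul_div_cancel₀ _ this]
  have := pMean_mono hf' hp (R₁ := R / ρ) (R₂ := 1 / ρ) (by positivity) (by gcongr)
    ((div_lt_one hρ0).2 hρ)
  rwa [e, e] at this

lemma lintegral_enorm_rpow_eq_ofReal_integral {A : En n → ℂ} (hA : ContinuousOn A (Sn n)) (hp : 0 < p) :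
    ∫⁻ ζ, ‖A ζ‖ₑ ^ p ∂(sigmaS n) = ENNReal.ofReal (∫ ζ, ‖A ζ‖ ^ p ∂(sigmaS n)) := by
  rw [ofReal_integral_eq_lintegral_ofReal
    (hA.norm.rpow_const fun _ _ => Or.inr hp.le).integrable_sigmaS
    (Eventually.of_forall fun _ => by positivity)]
  congr 1; funext ζ
  rw [← ENNReal.ofReal_rpow_of_nonneg (norm_nonneg _) hp.le, ofReal_norm]

lemma lintegral_J_rpow_le {K : ℝ≥0∞} (hp : 0 < p) (hq : 0 < q) (hg : DifferentiableOn ℂ g (Bn n))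
    (hK : ∀ f, MemHp n p f → hNorm n q (J g f) ≤ K * hNorm n p f) {ρ : ℝ} (hρ : 1 < ρ)
    (hf : DifferentiableOn ℂ f (ball 0 ρ)) {R : ℝ} (hR : 0 ≤ R) (hR1 : R < 1) :
    ∫⁻ ζ, ‖J g f ((R : ℂ) • ζ)‖ₑ ^ q ∂(sigmaS n) ≤
      K ^ q * (∫⁻ ζ, ‖f ζ‖ₑ ^ p ∂(sigmaS n)) ^ (q / p) := by
  have hfB : DifferentiableOn ℂ f (Bn n) := hf.mono (ball_subset_ball hρ.le)
  set A := pMean n p 1 f with hA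
  have hA0 : 0 ≤ A := pMean_nonneg
  have eA : ∫⁻ ζ, ‖f ζ‖ₑ ^ p ∂(sigmaS n) = ENNReal.ofReal A := by
    rw [lintegral_enorm_rpow_eq_ofReal_integral (continuousOn_Sn_of_differentiableOn_ball hρ hf) hp, hA,
      pMean]
    simp
  have hle : hNorm n p f ≤ ENNReal.ofReal (A ^ p⁻¹) := by
    rw [hNorm_le_ofReal_iff hfB.continuousOn hp (by positivity), Real.rpow_inv_rpow hA0 hp.ne']
    exact fun R hR => pMean_le_pMean_one hρ hf hp hR.1.le hR.2.le
  have hJ := hK f ⟨hfB, hle.trans_lt ENNReal.ofReal_lt_top⟩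
  have hJc := continuousOn_J hfB.continuousOn hg
  rw [eA, lintegral_enorm_rpow_eq_ofReal_integral (continuousOn_dilate hJc hR hR1) hq]
  rcases hR.eq_or_lt with rfl | hR0
  · have := pMean_zero_of_eq_zero (n := n) hq (J_zero (g := g) (f := f))
    rw [pMean] at this
    rw [this]; simp
  · have h1 : ENNReal.ofReal (pMean n q R (J g f)) ≤ hNorm n q (J g f) ^ q := by
      rw [← lintegral_eq_ofReal_pMean hJc hq hR hR1, hNorm, one_div, ENNReal.rpow_inv_rpow hq.ne']
      exact le_iSup₂_of_le (f := fun (r : ℝ) (_ : r ∈ Ioo (0:ℝ) 1) =>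
        ∫⁻ ζ, (‖J g f (r • ζ)‖₊ : ℝ≥0∞) ^ q ∂(sigmaS n)) R ⟨hR0, hR1⟩ le_rfl
    refine h1.trans ?_
    calc hNorm n q (J g f) ^ q ≤ (K * ENNReal.ofReal (A ^ p⁻¹)) ^ q := by
          gcongr; exact hJ.trans (by gcongr)
      _ = K ^ q * ENNReal.ofReal A ^ (q / p) := by
          rw [ENNReal.mul_rpow_of_nonneg _ _ hq.le, ← ENNReal.ofReal_rpow_of_nonneg hA0 (by positivity),
            ← ENNReal.rpow_mul]
          congr 2; field_simp

/-- The square function form of the boundedness of `J g`. -/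
lemma exists_lintegral_square_J_le (hq : 0 < q) (hqp : q ≤ p) :
    ∃ C : ℝ≥0∞, C ≠ ⊤ ∧ ∀ {g : En n → ℂ} {K : ℝ≥0∞}, DifferentiableOn ℂ g (Bn n) →
      (∀ f, MemHp n p f → hNorm n q (J g f) ≤ K * hNorm n p f) →
      ∀ {ι : Type} (t : Finset ι) (F : ι → En n → ℂ) {ρ : ℝ}, 1 < ρ →
      (∀ i ∈ t, DifferentiableOn ℂ (F i) (ball 0 ρ)) → ∀ {R : ℝ}, 0 ≤ R → R < 1 →
      ∫⁻ ζ, ENNReal.ofReal ((∑ i ∈ t, ‖J g (F i) ((R : ℂ) • ζ)‖ ^ 2) ^ (q / 2)) ∂(sigmaS n) ≤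
        C * K ^ q * (∫⁻ ζ, ENNReal.ofReal ((∑ i ∈ t, ‖F i ζ‖ ^ 2) ^ (p / 2)) ∂(sigmaS n)) ^ (q / p) := by
  obtain ⟨C, hC, h⟩ := lintegral_square_function_le hq hqp
  refine ⟨C, hC, fun {g K} hg hK ι t F ρ hρ hF R hR hR1 => ?_⟩
  have hp := hq.trans_le hqp
  have hFB : ∀ i ∈ t, ContinuousOn (F i) (Bn n) := fun i hi =>
    (hF i hi).continuousOn.mono (ball_subset_ball hρ.le)
  have hind : ∀ A : En n → ℂ, ∀ᵐ ζ ∂(sigmaS n), (Sn n).indicator A ζ = A ζ := fun A =>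
    (ae_mem_Sn n).mono fun ζ hζ => indicator_of_mem hζ A
  have := h (sigmaS n) (ι := t) (fun i => (Sn n).indicator (F i))
    (fun i => (Sn n).indicator fun ζ => J g (F i) ((R : ℂ) • ζ)) (K ^ q)
    (fun i => (continuousOn_Sn_of_differentiableOn_ball hρ (hF i i.2)).measurable_indicator_Sn)
    (fun i => (continuousOn_dilate (continuousOn_J (hFB i i.2) hg) hR hR1).measurable_indicator_Sn) ?_
  · refine le_trans (le_of_eq (lintegral_congr_ae ?_)) (this.trans (le_of_eq ?_))
    · filter_upwards [ae_mem_Sn n] with ζ hζ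
      simp only [indicator_of_mem hζ]
      rw [Finset.sum_coe_sort t fun i => ‖J g (F i) ((R : ℂ) • ζ)‖ ^ 2]
    · congr 2
      refine lintegral_congr_ae ?_
      filter_upwards [ae_mem_Sn n] with ζ hζ
      simp only [indicator_of_mem hζ]
      rw [Finset.sum_coe_sort t fun i => ‖F i ζ‖ ^ 2]
  · intro x
    have hx : DifferentiableOn ℂ (fun w => ∑ i : t, (x i : ℂ) * F i w) (ball 0 ρ) :=
      DifferentiableOn.fun_sum fun i _ => (hF i i.2).const_mul _
    refine le_trans (le_of_eq (lintegral_congr_ae ?_))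
      ((lintegral_J_rpow_le hp hq hg hK hρ hx hR hR1).trans (le_of_eq ?_))
    · filter_upwards [ae_mem_Sn n] with ζ hζ
      simp only [indicator_of_mem hζ]
      rw [J_sum Finset.univ (fun i : t => (x i : ℂ)) (fun i : t => F i) (fun i _ => hFB i i.2) hg
        (smul_mem_Bn_of_Sn hζ (ofReal_mem_ball hR hR1))]
    · congr 2
      refine lintegral_congr_ae ?_
      filter_upwards [ae_mem_Sn n] with ζ hζ
      simp only [indicator_of_mem hζ]

lemma one_le_regMean (hr : 0 < r) (hg : ContinuousOn g (Bn n)) {R : ℝ} (hR : 0 ≤ R) (hR1 : R < 1) :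
    1 ≤ regMean n r R g := by
  have := integral_sigmaS_mono (continuousOn_const (c := (1 : ℝ)))
    (continuousOn_dilate (continuousOn_regMean_integrand r hg) hR hR1) fun ζ _ =>
      Real.one_le_rpow (by nlinarith [sq_nonneg ‖g ((R : ℂ) • ζ)‖]) (by positivity)
  rw [regMean]; simpa using this

theorem exists_regMean_le {K : ℝ≥0∞} (hq : 0 < q) (hqp : q < p) (hr : 0 < r)
    (hpqr : 1 / q = 1 / p + 1 / r) (hg : DifferentiableOn ℂ g (Bn n)) (hKt : K < ⊤)
    (hK : ∀ f, MemHp n p f → hNorm n q (J g f) ≤ K * hNorm n p f) :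
    ∃ C : ℝ, 0 ≤ C ∧ ∀ δ, 0 < δ → δ < 1 / 2 → ∀ R, 0 ≤ R → R < 1 - 2 * δ →
      regMean n r R g ≤ C * regMean n r (1 - δ) g ^ (q / p) := by
  have hp := hq.trans hqp
  obtain ⟨c, hc, Ct, hCt, htest⟩ := exists_test_family n hp hr
  obtain ⟨Cs, hCs, hsq⟩ := exists_lintegral_square_J_le (n := n) hq hqp.le
  have hκ : 0 < r / p := by positivity
  obtain ⟨Cb, hCb, hbi⟩ := circleAverage_le_primitives (q := q) (κ := r / p) (c := c) hq hκ hc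
  set D : ℝ≥0∞ := Cs * K ^ q * Ct ^ (q / p) with hD
  have hDt : D ≠ ⊤ := by
    refine ENNReal.mul_ne_top (ENNReal.mul_ne_top hCs ?_) ?_
    · exact (ENNReal.rpow_lt_top_of_nonneg hq.le hKt.ne).ne
    · exact (ENNReal.rpow_lt_top_of_nonneg (by positivity) hCt).ne
  have hexp : (r / p + 1) * q / 2 = r / 2 := by
    have : (r / p + 1) * q = r := by field_simp at hpqr ⊢; linarith
    rw [this]
  set G := (‖g 0‖ ^ 2 + 1) ^ (r / 2) with hG
  refine ⟨2 * G + Cb * (2 ^ (q / 2) * (D.toReal + 1)), by positivity, fun δ hδ hδ2 R hR hRδ => ?_⟩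
  obtain ⟨t, F, hF, hFc, hFi⟩ := htest (κ := r / p) (by field_simp) hg hδ hδ2
  have hρ : 1 < 1 / (1 - δ) := by rw [lt_div_iff₀ (by linarith)]; linarith
  have hFB : ∀ i ∈ t, DifferentiableOn ℂ (F i) (Bn n) := fun i hi =>
    (hF i hi).mono (ball_subset_ball hρ.le)
  have hR1 : R < 1 := by linarith
  set I := regMean n r (1 - δ) g with hI
  have hI1 : 1 ≤ I := one_le_regMean hr hg.continuousOn (by linarith) (by linarith)
  have hIq : 1 ≤ I ^ (q / p) := Real.one_le_rpow hI1 (by positivity)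
  set S : En n → ℝ := fun z => ∑ i ∈ t, ‖J g (F i) z‖ ^ 2 with hS
  have hS0 : ∀ z, 0 ≤ S z := fun z => Finset.sum_nonneg fun i _ => by positivity
  have hSc : ContinuousOn S (Bn n) := continuousOn_finsetSum _ fun i hi =>
    (continuousOn_J (hFB i hi).continuousOn hg).norm.pow 2
  have hS1c : ContinuousOn (fun z => (S z + 1) ^ (q / 2)) (Bn n) := by
    have h : ContinuousOn (fun z => S z + 1) (Bn n) := hSc.add continuousOn_const
    exact h.rpow_const fun z _ => Or.inl (by have := hS0 z; positivity)
  have hSqc : ContinuousOn (fun z => S z ^ (q / 2)) (Bn n) :=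
    hSc.rpow_const fun z _ => Or.inr (by positivity)
  have hsquare : ∫ ζ, S ((R : ℂ) • ζ) ^ (q / 2) ∂(sigmaS n) ≤ D.toReal * I ^ (q / p) := by
    rw [← ENNReal.ofReal_le_ofReal_iff (by positivity), ofReal_integral_eq_lintegral_ofReal
      (continuousOn_dilate hSqc hR hR1).integrable_sigmaS
      (Eventually.of_forall fun ζ => Real.rpow_nonneg (hS0 _) _),
      ENNReal.ofReal_mul ENNReal.toReal_nonneg, ENNReal.ofReal_toReal hDt,
      ← ENNReal.ofReal_rpow_of_nonneg (by linarith) (by positivity)]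
    refine (hsq hg hK t F hρ hF hR hR1).trans ?_
    rw [hD, mul_assoc (Cs * K ^ q), ← ENNReal.mul_rpow_of_nonneg _ _ (by positivity)]
    gcongr
    refine hFi.trans (le_of_eq ?_)
    rw [hI, regMean, ofReal_integral_eq_lintegral_ofReal
      (continuousOn_dilate (continuousOn_regMean_integrand r hg.continuousOn) (by linarith)
        (by linarith)).integrable_sigmaS (Eventually.of_forall fun _ => by positivity)]
  have hslice : ∀ ζ ∈ Sn n,
      Real.circleAverage (fun l : ℂ => (‖g (l • ζ)‖ ^ 2 + 1) ^ (r / 2)) 0 R ≤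
        2 * G + Cb * Real.circleAverage (fun l : ℂ => (S (l • ζ) + 1) ^ (q / 2)) 0 R := by
    intro ζ hζ
    have hsub : ball (0 : ℂ) (1 - 2 * δ) ⊆ ball 0 1 := ball_subset_ball (by linarith)
    have := hbi _ t (1 - 2 * δ) (fun l => g (l • ζ)) (fun i l => F i (l • ζ))
      (fun i l => J g (F i) (l • ζ)) ((differentiableOn_slice hg hζ).mono hsub)
      (fun i hi l hl => hasDerivAt_J_slice (hFB i hi) hg hζ (hsub hl))
      (fun l hl => hFc _ (by rw [norm_smul_Sn hζ]; exact (mem_ball_zero_iff.1 hl).le)) R hR hRδ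
    simpa only [hexp, zero_smul] using this
  obtain ⟨i1, e1⟩ := integral_eq_integral_circleAverage (A := fun z => (‖g z‖ ^ 2 + 1) ^ (r / 2)) hR
    ((continuousOn_regMean_integrand r hg.continuousOn).mono (sphere_subset_Bn hR1))
  obtain ⟨i2, e2⟩ := integral_eq_integral_circleAverage (A := fun z => (S z + 1) ^ (q / 2)) hR
    (hS1c.mono (sphere_subset_Bn hR1))
  have h1 : regMean n r R g ≤ 2 * G + Cb * ∫ ζ, (S ((R : ℂ) • ζ) + 1) ^ (q / 2) ∂(sigmaS n) := by
    rw [regMean, e1, e2, ← integral_const_mul]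
    have e3 : 2 * G = ∫ _, 2 * G ∂(sigmaS n) := by simp
    rw [e3, ← integral_add (integrable_const _) (i2.const_mul _)]
    exact integral_mono_ae i1 ((integrable_const _).add (i2.const_mul _))
      ((ae_mem_Sn n).mono fun ζ hζ => hslice ζ hζ)
  have h2 : ∫ ζ, (S ((R : ℂ) • ζ) + 1) ^ (q / 2) ∂(sigmaS n) ≤
      2 ^ (q / 2) * (D.toReal * I ^ (q / p) + 1) := by
    have hi := (continuousOn_dilate hSqc hR hR1).integrable_sigmaS
    calc ∫ ζ, (S ((R : ℂ) • ζ) + 1) ^ (q / 2) ∂(sigmaS n)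
        ≤ ∫ ζ, 2 ^ (q / 2) * (S ((R : ℂ) • ζ) ^ (q / 2) + 1) ∂(sigmaS n) := by
          refine integral_mono (continuousOn_dilate hS1c hR hR1).integrable_sigmaS
            ((hi.add (integrable_const _)).const_mul _) fun ζ => ?_
          have hs := hS0 ((R : ℂ) • ζ)
          simp only
          generalize S ((R : ℂ) • ζ) = s at hs
          rcases le_total s 1 with h | h
          · calc (s + 1) ^ (q / 2) ≤ 2 ^ (q / 2) := by gcongr; linarith
              _ ≤ _ := le_mul_of_one_le_right (by positivity) (by have := Real.rpow_nonneg hs (q/2); linarith)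
          · calc (s + 1) ^ (q / 2) ≤ (2 * s) ^ (q / 2) := by gcongr; linarith
              _ = 2 ^ (q / 2) * s ^ (q / 2) := Real.mul_rpow (by norm_num) hs
              _ ≤ _ := by gcongr; linarith
      _ = 2 ^ (q / 2) * (∫ ζ, S ((R : ℂ) • ζ) ^ (q / 2) ∂(sigmaS n) + 1) := by
          rw [integral_const_mul, integral_add hi (integrable_const _)]; simp
      _ ≤ _ := by gcongr
  calc regMean n r R g ≤ 2 * G + Cb * (2 ^ (q / 2) * (D.toReal * I ^ (q / p) + 1)) := by
        refine h1.trans ?_; gcongr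
    _ ≤ 2 * G * I ^ (q / p) + Cb * (2 ^ (q / 2) * (D.toReal * I ^ (q / p) + I ^ (q / p))) := by
        refine add_le_add (le_mul_of_one_le_right (by positivity) hIq) ?_
        gcongr
    _ = _ := by ring

end Growth

/-- A sublinear recursion with at most linearly growing terms is bounded by its fixed point. -/
lemma le_div_of_forall_le_add_mul {x : ℕ → ℝ} {c θ A B : ℝ} (hθ : 0 ≤ θ) (hθ1 : θ < 1)
    (h : ∀ j, x j ≤ c + θ * x (j + 1)) (hx : ∀ j : ℕ, x j ≤ A + B * j) : x 0 ≤ c / (1 - θ) := by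
  have h1 : 1 - θ ≠ 0 := by linarith
  have key : ∀ j : ℕ, x 0 ≤ c / (1 - θ) * (1 - θ ^ j) + θ ^ j * x j := by
    intro j
    induction j with
    | zero => simp
    | succ j ih =>
      refine ih.trans ?_
      have := mul_le_mul_of_nonneg_left (h j) (pow_nonneg hθ j)
      have e : c / (1 - θ) * (1 - θ ^ (j + 1)) = c / (1 - θ) * (1 - θ ^ j) + θ ^ j * c := by
        field_simp; ring
      rw [e, pow_succ]
      linarith
  have hp : Tendsto (fun j : ℕ => θ ^ j) atTop (𝓝 0) := tendsto_pow_atTop_nhds_zero_of_lt_one hθ hθ1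
  have hl := tendsto_self_mul_const_pow_of_lt_one hθ hθ1
  have ht : Tendsto (fun j : ℕ => c / (1 - θ) * (1 - θ ^ j) + (A * θ ^ j + B * (j * θ ^ j))) atTop
      (𝓝 (c / (1 - θ) * (1 - 0) + (A * 0 + B * 0))) :=
    ((hp.const_sub 1).const_mul _).add ((hp.const_mul A).add (hl.const_mul B))
  simp only [sub_zero, mul_one, mul_zero, add_zero] at ht
  refine ge_of_tendsto' ht fun j => (key j).trans ?_
  have := mul_le_mul_of_nonneg_left (hx j) (pow_nonneg hθ j)
  linarith

section Necessity

variable {n : ℕ} {p q r : ℝ} {g : En n → ℂ}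

lemma J_one (hg : DifferentiableOn ℂ g (Bn n)) {ζ : En n} (hζ : ζ ∈ Sn n) {l : ℂ}
    (hl : l ∈ ball (0 : ℂ) 1) : J g (fun _ => 1) (l • ζ) = g (l • ζ) - g 0 := by
  have hd : ∀ l ∈ ball (0 : ℂ) 1,
      HasDerivAt (fun l : ℂ => J g (fun _ => 1) (l • ζ) - g (l • ζ)) 0 l := by
    intro l hl
    have h1 := hasDerivAt_J_slice (f := fun _ => 1) (differentiableOn_const 1) hg hζ hl
    have h2 := (((differentiableOn_slice hg hζ) l hl).differentiableAt
      (isOpen_ball.mem_nhds hl)).hasDerivAt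
    simpa using h1.fun_sub h2
  have := isOpen_ball.is_const_of_deriv_eq_zero (convex_ball (0 : ℂ) 1).isPreconnected
    (fun l hl => (hd l hl).differentiableAt.differentiableWithinAt)
    (fun l hl => (hd l hl).deriv) hl (mem_ball_self one_pos)
  simp only [zero_smul, J_zero] at this
  linear_combination this

lemma pMean_le_regMean [IsProbabilityMeasure (sigmaS n)] (hr : 0 < r) (hg : ContinuousOn g (Bn n))
    {R : ℝ} (hR : 0 ≤ R) (hR1 : R < 1) : pMean n r R g ≤ regMean n r R g := by
  refine integral_sigmaS_mono (continuousOn_norm_rpow_dilate hg hr hR hR1)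
    (continuousOn_dilate (continuousOn_regMean_integrand r hg) hR hR1) fun ζ _ => ?_
  calc ‖g ((R : ℂ) • ζ)‖ ^ r = (‖g ((R : ℂ) • ζ)‖ ^ 2) ^ (r / 2) := by
        rw [← Real.rpow_natCast, ← Real.rpow_mul (norm_nonneg _)]; congr 1; push_cast; ring
    _ ≤ _ := by gcongr; linarith

/-- Geometric growth of the symbol along a geometric sequence of radii. -/
lemma exists_norm_le_mul_pow [IsProbabilityMeasure (sigmaS n)] {K : ℝ≥0∞} (hp : 0 < p) (hq : 0 < q)
    (hg : DifferentiableOn ℂ g (Bn n)) (hKt : K < ⊤)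
    (hK : ∀ f, MemHp n p f → hNorm n q (J g f) ≤ K * hNorm n p f) {ε : ℝ} (hε : 0 < ε) (hε1 : ε < 1) :
    ∃ W U : ℝ, 0 ≤ W ∧ 1 ≤ U ∧ ∀ (j : ℕ) (z : En n), ‖z‖ ≤ 1 - ε / 3 ^ j → ‖g z‖ ≤ W * U ^ j := by
  have h1c : ContinuousOn (fun _ : En n => (1 : ℂ)) (Bn n) := continuousOn_const
  have hone : hNorm n p (fun _ : En n => (1 : ℂ)) ≤ ENNReal.ofReal 1 := by
    rw [hNorm_le_ofReal_iff h1c hp zero_le_one]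
    intro R _; simp [pMean]
  have hJt : hNorm n q (J g fun _ => 1) < ⊤ :=
    (hK _ ⟨differentiableOn_const 1, hone.trans_lt ENNReal.ofReal_lt_top⟩).trans_lt
      (ENNReal.mul_lt_top hKt (hone.trans_lt ENNReal.ofReal_lt_top))
  have hm := pMean_le_of_hNorm (continuousOn_J h1c hg) hq hJt
  set M := (hNorm n q (J g fun _ => 1)).toReal ^ q with hM
  have hM0 : 0 ≤ M := by positivity
  set f : En n → ℂ := fun z => g z - g 0 with hf
  have hfd : DifferentiableOn ℂ f (Bn n) := hg.sub_const _
  have hfm : ∀ R ∈ Ioo (0 : ℝ) 1, pMean n q R f ≤ M := by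
    intro R hR
    refine le_trans (le_of_eq (integral_congr_ae ?_)) (hm R hR)
    filter_upwards [ae_mem_Sn n] with ζ hζ
    rw [J_one hg hζ (ofReal_mem_ball hR.1.le hR.2)]
  obtain ⟨k, hk⟩ := pow_unbounded_of_one_lt (6 / ε) (one_lt_two)
  have hN : (1 : ℝ) ≤ qN n := by exact_mod_cast one_le_qN
  set b := (8 * qN n * M * qN n ^ k) ^ (1 / q) with hb
  set U := ((qN n : ℝ) ^ 2) ^ (1 / q) with hU
  have hU1 : 1 ≤ U := Real.one_le_rpow (one_le_pow₀ hN) (by positivity)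
  have hb0 : 0 ≤ b := by positivity
  refine ⟨‖g 0‖ + b, U, by positivity, hU1, fun j z hz => ?_⟩
  have h3 : (0 : ℝ) < 3 ^ j := by positivity
  set R := 1 - ε / 3 ^ (j + 1) with hR
  have hd : 0 < ε / 3 ^ (j + 1) := by positivity
  have e3 : ε / 3 ^ j = 3 * (ε / 3 ^ (j + 1)) := by rw [pow_succ]; field_simp
  have hd1 : ε / 3 ^ (j + 1) < 1 / 3 := by
    have : ε / 3 ^ j ≤ ε := div_le_self hε.le (one_le_pow₀ (by norm_num))
    linarith
  have hR0 : 0 < R := by linarith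
  have hR1 : R < 1 := by linarith
  have hzR : ‖z‖ < R := by linarith
  have hPE := qv_mul_norm_rpow_le_pMean hfd hq hR0 hR1 hzR
  have hδ : 2 * (ε / 3 ^ (j + 1)) ≤ 1 - ‖z‖ / R := by
    rw [le_sub_iff_add_le, ← le_sub_iff_add_le', div_le_iff₀ hR0]
    nlinarith
  have hqv : 1 ≤ (qN n : ℝ) ^ (2 * j + k) * (qv n (1 - ‖z‖ / R)).toReal := by
    have h0 : 0 < 1 - ‖z‖ / R := by linarith
    have h2 := qv_two_pow_mul_le (n := n) h0 (2 * j + k)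
    rw [qv_eq_one] at h2
    · have := ENNReal.toReal_mono (ENNReal.mul_ne_top (by simp) qv_ne_top) h2
      simpa using this
    · have h4 : (3 : ℝ) ^ j ≤ 2 ^ (2 * j) := by
        rw [pow_mul]; exact pow_le_pow_left₀ (by norm_num) (by norm_num) j
      have h5 : 6 < ε * 2 ^ k := by rwa [div_lt_iff₀' hε] at hk
      calc (2 : ℝ) < 3 ^ j * 2 ^ k * (2 * (ε / 3 ^ (j + 1))) := by
            rw [pow_succ]; field_simp; linarith
        _ ≤ 2 ^ (2 * j) * 2 ^ k * (1 - ‖z‖ / R) := by gcongr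
        _ = 2 ^ (2 * j + k) * (1 - ‖z‖ / R) := by rw [pow_add]
  have hfz : ‖f z‖ ≤ b * U ^ j := by
    have h6 : ‖f z‖ ^ q ≤ 8 * qN n * M * qN n ^ k * (qN n ^ 2) ^ j := by
      calc ‖f z‖ ^ q ≤ (qN n : ℝ) ^ (2 * j + k) * (qv n (1 - ‖z‖ / R)).toReal * ‖f z‖ ^ q :=
            le_mul_of_one_le_left (by positivity) hqv
        _ = (qN n : ℝ) ^ (2 * j + k) * ((qv n (1 - ‖z‖ / R)).toReal * ‖f z‖ ^ q) := by ring
        _ ≤ (qN n : ℝ) ^ (2 * j + k) * (8 * qN n * M) := by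
            refine mul_le_mul_of_nonneg_left (hPE.trans ?_) (by positivity)
            gcongr
            exact hfm R ⟨hR0, hR1⟩
        _ = _ := by rw [← pow_mul]; ring
    have h7 : b * U ^ j = (8 * qN n * M * qN n ^ k * (qN n ^ 2) ^ j) ^ (1 / q) := by
      rw [Real.mul_rpow (by positivity) (by positivity), hU, ← Real.rpow_natCast, ← Real.rpow_natCast _ j,
        ← Real.rpow_mul (by positivity), ← Real.rpow_mul (by positivity), mul_comm (1 / q)]
    rw [h7, one_div]
    exact (Real.le_rpow_inv_iff_of_pos (norm_nonneg _) (by positivity) hq).2 h6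
  calc ‖g z‖ = ‖g 0 + f z‖ := by rw [hf]; simp
    _ ≤ ‖g 0‖ + ‖f z‖ := norm_add_le _ _
    _ ≤ ‖g 0‖ * U ^ j + b * U ^ j :=
        add_le_add (le_mul_of_one_le_right (norm_nonneg _) (one_le_pow₀ hU1)) hfz
    _ = _ := by ring

/-- If `J g : H^p → H^q` is bounded then `g ∈ H^r`. -/
theorem hNorm_lt_top_of_J_bounded [IsProbabilityMeasure (sigmaS n)] {K : ℝ≥0∞} (hq : 0 < q)
    (hqp : q < p) (hr : 0 < r) (hpqr : 1 / q = 1 / p + 1 / r) (hg : DifferentiableOn ℂ g (Bn n))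
    (hKt : K < ⊤) (hK : ∀ f, MemHp n p f → hNorm n q (J g f) ≤ K * hNorm n p f) :
    hNorm n r g < ⊤ := by
  have hp := hq.trans hqp
  obtain ⟨C, hC, hmain⟩ := exists_regMean_le hq hqp hr hpqr hg hKt hK
  have hθ1 : q / p < 1 := (div_lt_one hp).2 hqp
  set B := Real.exp (Real.log (C + 1) / (1 - q / p)) with hB
  have key : ∀ R, 1 / 2 ≤ R → R < 1 → regMean n r R g ≤ B := by
    intro R hR hR1
    set ε := 1 - R with hε
    have hε0 : 0 < ε := by linarith
    obtain ⟨W, U, hW, hU, hWU⟩ := exists_norm_le_mul_pow hp hq hg hKt hK hε0 (by linarith)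
    have hd : ∀ j : ℕ, 0 < ε / 3 ^ j ∧ ε / 3 ^ j ≤ 1 / 2 := fun j =>
      ⟨by positivity, (div_le_self hε0.le (one_le_pow₀ (by norm_num))).trans (by linarith)⟩
    have hI1 : ∀ j : ℕ, 1 ≤ regMean n r (1 - ε / 3 ^ j) g := fun j =>
      one_le_regMean hr hg.continuousOn (by linarith [(hd j).2]) (by linarith [(hd j).1])
    have hx := le_div_of_forall_le_add_mul (x := fun j : ℕ => Real.log (regMean n r (1 - ε / 3 ^ j) g))
      (c := Real.log (C + 1)) (θ := q / p) (A := r / 2 * Real.log (W ^ 2 + 1))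
      (B := r / 2 * Real.log (U ^ 2)) (by positivity) hθ1 (fun j => ?_) (fun j => ?_)
    · have := Real.exp_le_exp.2 hx
      rw [Real.exp_log (by linarith [hI1 0])] at this
      simpa [hε] using this
    · have h0 := hI1 (j + 1)
      rw [← Real.log_rpow (by linarith), ← Real.log_mul (by positivity)
        (Real.rpow_pos_of_pos (by linarith) _).ne']
      refine Real.log_le_log (by linarith [hI1 j]) ?_
      have e3 : ε / 3 ^ j = 3 * (ε / 3 ^ (j + 1)) := by rw [pow_succ]; field_simp
      have hd' := hd (j + 1)
      refine (hmain _ hd'.1 (by linarith [(hd j).2]) _ (by linarith [(hd j).2]) (by linarith)).trans ?_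
      gcongr
      linarith
    · have hb : regMean n r (1 - ε / 3 ^ j) g ≤ ((W ^ 2 + 1) * (U ^ 2) ^ j) ^ (r / 2) := by
        have := integral_sigmaS_mono (n := n)
          (continuousOn_dilate (continuousOn_regMean_integrand r hg.continuousOn)
            (R := 1 - ε / 3 ^ j) (by linarith [(hd j).2]) (by linarith [(hd j).1]))
          (continuousOn_const (c := ((W ^ 2 + 1) * (U ^ 2) ^ j) ^ (r / 2))) fun ζ hζ => by
            have hz := hWU j (((1 - ε / 3 ^ j : ℝ) : ℂ) • ζ) (by
              rw [norm_smul_Sn hζ, Complex.norm_real, Real.norm_of_nonneg (by linarith [(hd j).2])])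
            have h1 : 1 ≤ (U ^ 2) ^ j := one_le_pow₀ (one_le_pow₀ hU)
            gcongr
            calc ‖g (((1 - ε / 3 ^ j : ℝ) : ℂ) • ζ)‖ ^ 2 + 1 ≤ (W * U ^ j) ^ 2 + 1 := by gcongr
              _ ≤ (W ^ 2 + 1) * (U ^ 2) ^ j := by rw [mul_pow, ← pow_mul, mul_comm j, pow_mul]; linarith
        rw [regMean]; simpa using this
      refine (Real.log_le_log (by linarith [hI1 j]) hb).trans (le_of_eq ?_)
      rw [Real.log_rpow (by positivity), Real.log_mul (by positivity) (by positivity), Real.log_pow]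
      ring
  refine hNorm_lt_top_of_pMean_le hg.continuousOn hr (B := B) (by positivity) fun R hR => ?_
  have hm : max R (1 / 2) < 1 := max_lt hR.2 (by norm_num)
  exact (pMean_mono hg hr hR.1.le (le_max_left R (1 / 2)) hm).trans
    ((pMean_le_regMean hr hg.continuousOn (hR.1.le.trans (le_max_left _ _)) hm).trans
      (key _ (le_max_right _ _) hm))

end Necessity

/-- For `0 < q < p < ∞`, `r = pq/(p-q)` and `g` holomorphic on `B_n`,
the following are equivalent: `J_g : H^p → H^q` is compact; `J_g : H^p → H^q` is bounded;
`g ∈ H^r`. -/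
theorem stmt15 (n : ℕ) (hn : 1 ≤ n) (p q r : ℝ) (hq : 0 < q) (hqp : q < p)
    (hr : r = p * q / (p - q))
    (g : En n → ℂ) (hg : DifferentiableOn ℂ g (Bn n)) :
    ((∀ f : ℕ → En n → ℂ, (∀ k, MemHp n p (f k)) →
        (∃ M : ℝ≥0∞, M < ⊤ ∧ ∀ k, hNorm n p (f k) ≤ M) →
        (∀ K : Set (En n), K ⊆ Bn n → IsCompact K →
          TendstoUniformlyOn (fun k => f k) 0 atTop K) →
        Tendsto (fun k => hNorm n q (J g (f k))) atTop (𝓝 0)) ↔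
      (∃ C : ℝ≥0∞, 0 < C ∧ C < ⊤ ∧
        ∀ f, MemHp n p f → hNorm n q (J g f) ≤ C * hNorm n p f)) ∧
    ((∃ C : ℝ≥0∞, 0 < C ∧ C < ⊤ ∧
        ∀ f, MemHp n p f → hNorm n q (J g f) ≤ C * hNorm n p f) ↔
      hNorm n r g < ⊤) := by
  have hp := hq.trans hqp
  have hpq : 0 < p - q := sub_pos.2 hqp
  have hr0 : 0 < r := by rw [hr]; positivity
  rcases sigmaS_eq_zero_or_isProbabilityMeasure n with h | h
  · have h0 : ∀ s : ℝ, 0 < s → ∀ f : En n → ℂ, hNorm n s f = 0 := fun s hs f => by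
      simp [hNorm, h, hs]
    refine ⟨iff_of_true (fun f _ _ _ => ?_) ⟨1, one_pos, ENNReal.one_lt_top, fun f _ => ?_⟩,
      iff_of_true ⟨1, one_pos, ENNReal.one_lt_top, fun f _ => ?_⟩ ?_⟩ <;>
    simp [h0 q hq, h0 r hr0]
  · have hpqr : 1 / q = 1 / p + 1 / r := by rw [hr]; field_simp; ring
    have h23 : (∃ C : ℝ≥0∞, 0 < C ∧ C < ⊤ ∧
        ∀ f, MemHp n p f → hNorm n q (J g f) ≤ C * hNorm n p f) → hNorm n r g < ⊤ :=
      fun ⟨C, _, hC, hJ⟩ => hNorm_lt_top_of_J_bounded hq hqp hr0 hpqr hg hC hJ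
    refine ⟨⟨J_bounded_of_compact hp hq, fun h2 f hf ⟨M, hM, hfM⟩ hlim => ?_⟩, h23, fun h3 => ?_⟩
    · exact J_compact_of_hNorm_lt_top hp hq hr0 hpqr hg (h23 h2) hf hM hfM hlim
    · exact J_bounded_of_hNorm_lt_top hp hq hr0 hpqr hg h3

end
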